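/- arXiv:1910.06231 — 2 statements merged into one kernel-verified Lean document; each statement's English description precedes it below -/
import Mathlib

section
/- Let A₁ and A₂ be two finite sets of points in ℝ² such that A₁ ∪ A₂ is in general position (no three points collinear), and let r be a positive integer dividing both |A₁| and |A₂|. Then there exists a convex partition (C₁, …, C_r) of ℝ² into r parts such that |A_i ∩ C_j| = |A_i|/r for every i ∈ {1,2} and every j ∈ {1, …, r}. -/
/-- A convex partition of the plane into `r` parts: closed convex sets covering `ℝ²`
with pairwise disjoint interiors. -/
def ConvexPartition {r : ℕ} (C : Fin r → Set (ℝ × ℝ)) : Prop :=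
  (∀ j, IsClosed (C j)) ∧ (∀ j, Convex ℝ (C j)) ∧
  (⋃ j, C j) = Set.univ ∧
  Pairwise fun i j => interior (C i) ∩ interior (C j) = ∅

namespace Equipartition

open Filter Topology

/-- `P` is an initial segment of `Y` for the preorder induced by the key `f`. -/
def IsPrefix {α : Type*} (f : α → ℝ) (Y P : Finset α) : Prop :=
  P ⊆ Y ∧ ∀ v ∈ P, ∀ w ∈ Y, w ∉ P → f v ≤ f w

/-- No three elements of `Y` share the same key. -/
def NoTriple {α : Type*} (f : α → ℝ) (Y : Finset α) : Prop :=
  ∀ a ∈ Y, ∀ b ∈ Y, ∀ c ∈ Y, a ≠ b → a ≠ c → b ≠ c → f a = f b → f a ≠ f c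

/-- Two elements of `Y` share the same key. -/
def HasTie {α : Type*} (f : α → ℝ) (Y : Finset α) : Prop :=
  ∃ a ∈ Y, ∃ b ∈ Y, a ≠ b ∧ f a = f b

section Prefix

variable {α : Type*} {f : α → ℝ} {Y P Q P₁ P₃ : Finset α} {ρ β : α → ℕ}

theorem NoTriple.of_not_hasTie (h : ¬ HasTie f Y) : NoTriple f Y :=
  fun a ha b hb _ _ hab _ _ hf => absurd ⟨a, ha, b, hb, hab, hf⟩ h

theorem isPrefix_empty : IsPrefix f Y ∅ := ⟨Finset.empty_subset _, by simp⟩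

theorem isPrefix_self : IsPrefix f Y Y := ⟨subset_rfl, fun _ _ _ hw hw' => absurd hw hw'⟩

variable [DecidableEq α]

theorem sum_insert_erase (ρ : α → ℕ) {v w : α} (hv : v ∈ P) (hw : w ∉ P) :
    ∑ x ∈ insert w (P.erase v), ρ x + ρ v = ∑ x ∈ P, ρ x + ρ w := by
  rw [Finset.sum_insert (by simp [hw]), ← Finset.sum_erase_add P ρ hv]
  ring

/-- Two initial segments are nested, or differ by exchanging two elements with equal keys. -/
theorem IsPrefix.compare (hno : NoTriple f Y) (hP : IsPrefix f Y P) (hQ : IsPrefix f Y Q) :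
    P ⊆ Q ∨ Q ⊆ P ∨
      ∃ v w, v ∈ P ∧ v ∉ Q ∧ w ∈ Q ∧ w ∉ P ∧ HasTie f Y ∧ Q = insert w (P.erase v) := by
  by_cases h₁ : P ⊆ Q
  · exact Or.inl h₁
  by_cases h₂ : Q ⊆ P
  · exact Or.inr (Or.inl h₂)
  obtain ⟨v, hvP, hvQ⟩ := Finset.not_subset.1 h₁
  obtain ⟨w, hwQ, hwP⟩ := Finset.not_subset.1 h₂
  have key : ∀ a ∈ P, a ∉ Q → ∀ b ∈ Q, b ∉ P → f a = f b := fun a ha ha' b hb hb' =>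
    le_antisymm (hP.2 a ha b (hQ.1 hb) hb') (hQ.2 b hb a (hP.1 ha) ha')
  have hvw : v ≠ w := fun h => hvQ (h ▸ hwQ)
  refine Or.inr (Or.inr ⟨v, w, hvP, hvQ, hwQ, hwP,
    ⟨v, hP.1 hvP, w, hQ.1 hwQ, hvw, key v hvP hvQ w hwQ hwP⟩, ?_⟩)
  have hone : ∀ a ∈ P, a ∉ Q → a = v := by
    intro a ha ha'
    by_contra hav
    exact hno v (hP.1 hvP) w (hQ.1 hwQ) a (hP.1 ha) hvw (Ne.symm hav)
      (fun h => ha' (h ▸ hwQ)) (key v hvP hvQ w hwQ hwP)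
      ((key v hvP hvQ w hwQ hwP).trans (key a ha ha' w hwQ hwP).symm)
  have hone' : ∀ b ∈ Q, b ∉ P → b = w := by
    intro b hb hb'
    by_contra hbw
    exact hno v (hP.1 hvP) w (hQ.1 hwQ) b (hQ.1 hb) hvw (fun h => hvQ (h ▸ hb))
      (Ne.symm hbw) (key v hvP hvQ w hwQ hwP) (key v hvP hvQ b hb hb')
  ext x
  simp only [Finset.mem_insert, Finset.mem_erase]
  constructor
  · intro hx
    by_cases hxP : x ∈ P
    · exact Or.inr ⟨fun h => hvQ (h ▸ hx), hxP⟩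
    · exact Or.inl (hone' x hx hxP)
  · rintro (rfl | ⟨hxv, hxP⟩)
    · exact hwQ
    · by_contra hxQ
      exact hxv (hone x hxP hxQ)

theorem IsPrefix.erase_max {d : α} (hQ : IsPrefix f Y Q) (hd : ∀ v ∈ Q, f v ≤ f d) :
    IsPrefix f Y (Q.erase d) := by
  refine ⟨(Finset.erase_subset _ _).trans hQ.1, fun v hv w hw hwQ => ?_⟩
  have hvQ := Finset.mem_of_mem_erase hv
  by_cases h : w = d
  · exact h ▸ hd v hvQ
  · exact hQ.2 v hvQ w hw fun h' => hwQ (Finset.mem_erase.2 ⟨h, h'⟩)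

/-- Discrete intermediate value property for nested initial segments. -/
theorem IsPrefix.exists_between (hρ : ∀ v, ρ v ≤ 1) {m : ℕ} (hP : IsPrefix f Y P)
    (hQ : IsPrefix f Y Q) (hPQ : P ⊆ Q) (hm : ∑ v ∈ P, ρ v ≤ m) (hm' : m ≤ ∑ v ∈ Q, ρ v) :
    ∃ R, IsPrefix f Y R ∧ P ⊆ R ∧ R ⊆ Q ∧ ∑ v ∈ R, ρ v = m := by
  induction hn : Q.card generalizing Q with
  | zero =>
    have hQ0 := Finset.card_eq_zero.1 hn
    subst hQ0
    obtain rfl := Finset.subset_empty.1 hPQ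
    exact ⟨∅, hP, subset_rfl, subset_rfl, le_antisymm hm hm'⟩
  | succ n ih =>
    by_cases heq : ∑ v ∈ Q, ρ v = m
    · exact ⟨Q, hQ, hPQ, subset_rfl, heq⟩
    have hne : (Q \ P).Nonempty := by
      rw [Finset.sdiff_nonempty]
      intro h
      have := Finset.sum_le_sum_of_subset (f := ρ) h
      omega
    obtain ⟨d, hd, hmax⟩ := Finset.exists_max_image (Q \ P) f hne
    rw [Finset.mem_sdiff] at hd
    have hdm : ∀ v ∈ Q, f v ≤ f d := by
      intro v hv
      by_cases hvP : v ∈ P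
      · exact hP.2 v hvP d (hQ.1 hd.1) hd.2
      · exact hmax v (Finset.mem_sdiff.2 ⟨hv, hvP⟩)
    have hsum := Finset.sum_erase_add Q ρ hd.1
    have := hρ d
    obtain ⟨R, hR, hPR, hRQ, hRm⟩ := ih (hQ.erase_max hdm)
      (fun x hx => Finset.mem_erase.2 ⟨fun h => hd.2 (h ▸ hx), hPQ hx⟩) (by omega)
      (by rw [Finset.card_erase_of_mem hd.1, hn]; rfl)
    exact ⟨R, hR, hPR, hRQ.trans (Finset.erase_subset _ _), hRm⟩

/-- An initial segment of prescribed weight which is followed by an element of weight one. -/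
theorem exists_prefix_next (f : α → ℝ) (hρ : ∀ v, ρ v ≤ 1) {m : ℕ} (hm : m < ∑ v ∈ Y, ρ v) :
    ∃ P z, IsPrefix f Y P ∧ IsPrefix f Y (insert z P) ∧ z ∈ Y ∧ z ∉ P ∧ ρ z = 1 ∧
      ∑ v ∈ P, ρ v = m := by
  classical
  obtain ⟨Q₀, hQ₀, -, -, hQ₀m⟩ := isPrefix_empty.exists_between hρ (m := m + 1)
    (isPrefix_self (f := f) (Y := Y)) (Finset.empty_subset _) (by simp) hm
  obtain ⟨Q, hQ, hmin⟩ := Finset.exists_min_image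
    (Y.powerset.filter fun Q => IsPrefix f Y Q ∧ ∑ v ∈ Q, ρ v = m + 1) Finset.card
    ⟨Q₀, by simp [hQ₀, hQ₀.1, hQ₀m]⟩
  simp only [Finset.mem_filter, Finset.mem_powerset] at hQ hmin
  obtain ⟨-, hQ, hQm⟩ := hQ
  have hne : Q.Nonempty := by
    by_contra h
    rw [Finset.not_nonempty_iff_eq_empty] at h
    simp [h] at hQm
  obtain ⟨d, hd, hmax⟩ := Finset.exists_max_image Q f hne
  have he := hQ.erase_max hmax
  have hsum := Finset.sum_erase_add Q ρ hd
  have h1 := hρ d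
  have hd1 : ρ d = 1 := by
    by_contra h
    have := hmin (Q.erase d) ⟨he.1, he, by omega⟩
    have := Finset.card_erase_lt_of_mem hd
    omega
  exact ⟨Q.erase d, d, he, by rwa [Finset.insert_erase hd], hQ.1 hd, Finset.notMem_erase _ _,
    hd1, by omega⟩

/-- A valid initial segment against a deficient one, up to a point of weight `(ru, bu)` which
belongs to them according to `e₃` and `e₁`. -/
theorem hasTie_or_of_valid (hno : NoTriple f Y) {z : α} {e₁ e₃ ru bu k m : ℕ}
    (h₃ : IsPrefix f Y P₃) (h₁ : IsPrefix f Y P₁) (h₁z : IsPrefix f Y (insert z P₁))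
    (hz : z ∉ P₁) (hρz : ρ z = 1) (he₁ : e₁ ≤ 1) (he₃ : e₃ ≤ 1) (hru : ru ≤ 1) (hbu : bu ≤ 1)
    (hr₃ : ∑ v ∈ P₃, ρ v + e₃ * ru = k) (hb₃ : m ≤ ∑ v ∈ P₃, β v + e₃ * bu)
    (hr₁ : ∑ v ∈ P₁, ρ v + e₁ * ru = k) (hb₁ : ∑ v ∈ P₁, β v + e₁ * bu < m) :
    HasTie f Y ∨ (e₃ = 1 ∧ e₁ = 0 ∧ bu = 1) ∨ (e₁ = 1 ∧ e₃ = 0 ∧ ru = 1) := by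
  have low : P₃ ⊆ P₁ → e₃ = 1 ∧ e₁ = 0 ∧ bu = 1 := by
    intro h
    have := Finset.sum_le_sum_of_subset (f := β) h
    interval_cases e₁ <;> interval_cases e₃ <;> omega
  have high : insert z P₁ ⊆ P₃ → e₁ = 1 ∧ e₃ = 0 ∧ ru = 1 := by
    intro h
    have := Finset.sum_le_sum_of_subset (f := ρ) h
    rw [Finset.sum_insert hz] at this
    interval_cases e₁ <;> interval_cases e₃ <;> omega
  rcases h₃.compare hno h₁z with h | h | ⟨_, _, _, _, _, _, h, _⟩
  · rcases h₃.compare hno h₁ with h' | h' | ⟨_, _, _, _, _, _, h', _⟩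
    · exact Or.inr (Or.inl (low h'))
    · by_cases hz3 : z ∈ P₃
      · exact Or.inr (Or.inr (high (Finset.insert_subset hz3 h')))
      · exact Or.inr (Or.inl (low ((Finset.subset_insert_iff_of_notMem hz3).1 h)))
    · exact Or.inl h'
  · exact Or.inr (Or.inr (high h))
  · exact Or.inl h

/-- If moreover the valid segment has an excess and a final element of weight one, then the
extra point is monochromatic and there is a tie. -/
theorem hasTie_and_of_excess (hno : NoTriple f Y) {z : α} {e₁ e₃ ru bu k m : ℕ}
    (hρ : ∀ v, ρ v ≤ 1) (hβ : ∀ v, β v ≤ 1)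
    (h₃ : IsPrefix f Y P₃) (h₁ : IsPrefix f Y P₁) (h₁z : IsPrefix f Y (insert z P₁))
    (hz : z ∉ P₁) (hρz : ρ z = 1) (he₁ : e₁ ≤ 1) (he₃ : e₃ ≤ 1) (hru : ru ≤ 1) (hbu : bu ≤ 1)
    (hr₃ : ∑ v ∈ P₃, ρ v + e₃ * ru = k) (hb₃ : m < ∑ v ∈ P₃, β v + e₃ * bu)
    (hr₁ : ∑ v ∈ P₁, ρ v + e₁ * ru = k) (hb₁ : ∑ v ∈ P₁, β v + e₁ * bu < m)
    (hlast : e₃ = 0 → ∃ d ∈ P₃, ρ d = 1 ∧ IsPrefix f Y (P₃.erase d)) :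
    HasTie f Y ∧
      ((e₃ = 1 ∧ e₁ = 0 ∧ bu = 1 ∧ ru = 0) ∨ (e₁ = 1 ∧ e₃ = 0 ∧ ru = 1 ∧ bu = 0)) := by
  have hzb := hβ z
  rcases h₁.compare hno h₃ with h | h | ⟨w, v, hw₁, hw₃, hv₃, hv₁, htie, h⟩
  · by_cases hz3 : z ∈ P₃
    · have hsub : insert z P₁ ⊆ P₃ := Finset.insert_subset hz3 h
      have h1 := Finset.sum_le_sum_of_subset (f := ρ) hsub
      rw [Finset.sum_insert hz] at h1
      have h2 : e₁ = 1 ∧ e₃ = 0 ∧ ru = 1 := by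
        interval_cases e₁ <;> interval_cases e₃ <;> omega
      obtain ⟨rfl, rfl, rfl⟩ := h2
      obtain ⟨d, hd, hρd, hpre⟩ := hlast rfl
      have hs := Finset.sum_erase_add P₃ ρ hd
      have hs' := Finset.sum_erase_add P₃ β hd
      have hdb := hβ d
      by_cases hd1 : d ∈ P₁
      · exfalso
        rcases h₁.compare hno hpre with h' | h' | ⟨w, v, hw₁, hw₃, hv₃, hv₁, -, h'⟩
        · exact Finset.notMem_erase d P₃ (h' hd1)
        · have hzd : z ≠ d := fun h => hz (h ▸ hd1)
          exact hz (h' (Finset.mem_erase.2 ⟨hzd, hz3⟩))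
        · have hwd : w = d := by
            by_contra hwd
            exact hw₃ (Finset.mem_erase.2 ⟨hwd, h hw₁⟩)
          subst hwd
          have := sum_insert_erase β hw₁ hv₁
          rw [← h'] at this
          have := hβ v
          omega
      · have h' : P₁ ⊆ P₃.erase d := fun x hx =>
          Finset.mem_erase.2 ⟨fun h => hd1 (h ▸ hx), h hx⟩
        by_cases hzd : z = d
        · subst hzd
          rcases h₁z.compare hno hpre with h'' | h'' | ⟨w, v, hw₁, hw₃, hv₃, hv₁, htie, h''⟩
          · exact absurd (h'' (Finset.mem_insert_self _ _)) (Finset.notMem_erase _ _)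
          · have := Finset.sum_le_sum_of_subset (f := β)
              ((Finset.subset_insert_iff_of_notMem (Finset.notMem_erase _ _)).1 h'')
            omega
          · have hwz : w = z := by
              rcases Finset.mem_insert.1 hw₁ with h | h
              · exact h
              · exact absurd (h' h) hw₃
            subst hwz
            have := sum_insert_erase β hw₁ hv₁
            rw [← h'', Finset.sum_insert hz] at this
            have := hβ v
            refine ⟨htie, Or.inr ⟨rfl, rfl, rfl, by omega⟩⟩
        · have := Finset.sum_le_sum_of_subset (f := ρ)
            (Finset.insert_subset (Finset.mem_erase.2 ⟨hzd, hz3⟩) h')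
          rw [Finset.sum_insert hz] at this
          omega
    · rcases h₁z.compare hno h₃ with h' | h' | ⟨w, v, hw₁, hw₃, hv₃, hv₁, htie, h'⟩
      · exact absurd (h' (Finset.mem_insert_self _ _)) hz3
      · have := Finset.sum_le_sum_of_subset (f := β)
          ((Finset.subset_insert_iff_of_notMem hz3).1 h')
        exfalso
        interval_cases e₁ <;> interval_cases e₃ <;> omega
      · have hwz : w = z := by
          rcases Finset.mem_insert.1 hw₁ with h'' | h''
          · exact h''
          · exact absurd (h h'') hw₃
        subst hwz
        have e1 := sum_insert_erase β hw₁ hv₁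
        have e2 := sum_insert_erase ρ hw₁ hv₁
        rw [← h', Finset.sum_insert hz] at e1 e2
        have := hβ v
        refine ⟨htie, Or.inl ?_⟩
        interval_cases e₁ <;> interval_cases e₃ <;> omega
  · have := Finset.sum_le_sum_of_subset (f := β) h
    exfalso
    interval_cases e₁ <;> interval_cases e₃ <;> omega
  · have hvz : v = z := by
      by_contra hvz
      rcases h₁z.compare hno h₃ with h' | h' | ⟨w', v', hw₁', hw₃', hv₃', hv₁', -, h'⟩
      · exact hw₃ (h' (Finset.mem_insert_of_mem hw₁))
      · rcases Finset.mem_insert.1 (h' hv₃) with h'' | h''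
        · exact hvz h''
        · exact hv₁ h''
      · have hz3 : z ∉ P₃ := by
          rw [h, Finset.mem_insert, Finset.mem_erase]
          rintro (h'' | h'')
          · exact hvz h''.symm
          · exact hz h''.2
        have : ∀ x ∈ insert z P₁, x ∉ P₃ → x = w' := by
          intro x hx hx3
          by_contra hxw
          exact hx3 (h' ▸ Finset.mem_insert_of_mem (Finset.mem_erase.2 ⟨hxw, hx⟩))
        have h1 := this z (Finset.mem_insert_self _ _) hz3
        have h2 := this w (Finset.mem_insert_of_mem hw₁) hw₃
        exact hz (h1.trans h2.symm ▸ hw₁)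
    subst hvz
    have e1 := sum_insert_erase β hw₁ hv₁
    have e2 := sum_insert_erase ρ hw₁ hv₁
    rw [← h] at e1 e2
    have := hρ w
    refine ⟨htie, Or.inl ?_⟩
    interval_cases e₁ <;> interval_cases e₃ <;> omega

/-- The variant of `hasTie_and_of_excess` where the extra point itself follows the deficient
segment. -/
theorem not_excess_of_next (htie : ¬ HasTie f Y) {e₃ bu k m : ℕ} (hβ : ∀ v, β v ≤ 1)
    (h₃ : IsPrefix f Y P₃) (h₁ : IsPrefix f Y P₁) (he₃ : e₃ ≤ 1) (hbu : bu ≤ 1)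
    (hr₃ : ∑ v ∈ P₃, ρ v + e₃ = k) (hb₃ : m < ∑ v ∈ P₃, β v + e₃ * bu)
    (hr₁ : ∑ v ∈ P₁, ρ v = k) (hb₁ : ∑ v ∈ P₁, β v < m)
    (hlast : e₃ = 0 → ∃ d ∈ P₃, ρ d = 1 ∧ IsPrefix f Y (P₃.erase d)) : False := by
  have hno := NoTriple.of_not_hasTie htie
  rcases h₁.compare hno h₃ with h | h | ⟨_, _, _, _, _, _, h, _⟩
  · have h1 := Finset.sum_le_sum_of_subset (f := ρ) h
    have h0 : e₃ = 0 := by omega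
    obtain ⟨d, hd, hρd, hpre⟩ := hlast h0
    have hs := Finset.sum_erase_add P₃ ρ hd
    have hs' := Finset.sum_erase_add P₃ β hd
    have hdb := hβ d
    subst h0
    rcases h₁.compare hno hpre with h' | h' | ⟨_, _, _, _, _, _, h', _⟩
    · have := Finset.sum_le_sum_of_subset (f := ρ) h'
      omega
    · have := Finset.sum_le_sum_of_subset (f := β) h'
      omega
    · exact htie h'
  · have := Finset.sum_le_sum_of_subset (f := β) h
    interval_cases e₃ <;> omega
  · exact htie h

end Prefix

/-- `P` is an initial segment of `Y` cut out at the level `a` of the key `f`. -/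
def IsLevel {α : Type*} (f : α → ℝ) (Y P : Finset α) (a : ℝ) : Prop :=
  P ⊆ Y ∧ (∀ v ∈ P, f v ≤ a) ∧ ∀ w ∈ Y, w ∉ P → a ≤ f w

/-- Aligned initial segments of `Y` and `Z`, with an extra weight `(x, y)`, which have total
first weight `k`, have total second weight less than `m`. -/
def AlignedBound {α : Type*} (f : α → ℝ) (Y Z : Finset α) (ρ β : α → ℕ) (k m x y : ℕ) : Prop :=
  ∀ a P O, IsLevel f Y P a → IsLevel f Z O (-a) →
    ∑ v ∈ P, ρ v + ∑ v ∈ O, ρ v + x = k → ∑ v ∈ P, β v + ∑ v ∈ O, β v + y < m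

section Level

variable {α : Type*} {f : α → ℝ} {Y Z P Q P₃ P₄ O₃ O₄ : Finset α} {ρ β : α → ℕ}
  {a b c a₃ a₄ b₃ b₄ : ℝ}

theorem IsLevel.isPrefix (h : IsLevel f Y P a) : IsPrefix f Y P :=
  ⟨h.1, fun _ hv _ hw hw' => (h.2.1 _ hv).trans (h.2.2 _ hw hw')⟩

theorem IsLevel.subset (hP : IsLevel f Y P a) (hQ : IsLevel f Y Q b) (hab : a < b) : P ⊆ Q := by
  intro v hv
  by_contra h
  have := hP.2.1 v hv
  have := hQ.2.2 v (hP.1 hv) h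
  linarith

theorem isLevel_filter_lt : IsLevel f Y (Y.filter fun v => f v < a) a :=
  ⟨Finset.filter_subset _ _, fun _ hv => (Finset.mem_filter.1 hv).2.le,
    fun _ hw h => not_lt.1 fun h' => h (Finset.mem_filter.2 ⟨hw, h'⟩)⟩

theorem IsLevel.exists_between (hP : IsLevel f Y P a) (hQ : IsLevel f Y Q b) (hab : a < b)
    (hac : a ≤ c) (hcb : c ≤ b) : ∃ R, IsLevel f Y R c ∧ P ⊆ R ∧ R ⊆ Q := by
  rcases hac.eq_or_lt with rfl | hac
  · exact ⟨P, hP, subset_rfl, hP.subset hQ hab⟩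
  rcases hcb.eq_or_lt with rfl | hcb
  · exact ⟨Q, hQ, hP.subset hQ hab, subset_rfl⟩
  exact ⟨_, isLevel_filter_lt, hP.subset isLevel_filter_lt hac, isLevel_filter_lt.subset hQ hcb⟩

theorem AlignedBound.symm {k m x y : ℕ} (h : AlignedBound f Y Z ρ β k m x y) :
    AlignedBound f Z Y ρ β k m x y := fun a P O hP hO hr => by
  have := h (-a) O P hO (by rwa [neg_neg]) (by omega)
  omega

theorem sum_between {R : Finset α} (ρ : α → ℕ) (h : P ⊆ R) (h' : R ⊆ Q) :
    ∑ v ∈ P, ρ v ≤ ∑ v ∈ R, ρ v ∧ ∑ v ∈ R, ρ v ≤ ∑ v ∈ Q, ρ v :=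
  ⟨Finset.sum_le_sum_of_subset h, Finset.sum_le_sum_of_subset h'⟩

theorem AlignedBound.false_of_eq {k m x y B₁ B₂ : ℕ} (h : AlignedBound f Y Z ρ β k m x y)
    (hP₃ : IsLevel f Y P₃ a₃) (hO₃ : IsLevel f Z O₃ b₃) (h₃ : 0 < a₃ + b₃)
    (hP₄ : IsLevel f Y P₄ a₄) (hO₄ : IsLevel f Z O₄ b₄) (h₄ : a₄ + b₄ < 0)
    (hr₃ : ∑ v ∈ P₃, ρ v + ∑ v ∈ O₃, ρ v + x = k)
    (hrP : ∑ v ∈ P₃, ρ v = ∑ v ∈ P₄, ρ v) (hrO : ∑ v ∈ O₃, ρ v = ∑ v ∈ O₄, ρ v)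
    (hbP₃ : B₁ ≤ ∑ v ∈ P₃, β v) (hbP₄ : B₁ ≤ ∑ v ∈ P₄, β v)
    (hbO₄ : B₂ ≤ ∑ v ∈ O₄, β v)
    (hm : m ≤ B₁ + B₂ + y) : False := by
  rcases le_or_gt (a₃ + b₄) 0 with hc | hc
  · obtain ⟨O, hO, h1, h2⟩ := hO₄.exists_between (c := -a₃) hO₃ (by linarith) (by linarith)
      (by linarith)
    have := sum_between ρ h1 h2
    have := sum_between β h1 h2
    have := h a₃ P₃ O hP₃ hO (by omega)
    omega
  · obtain ⟨P, hP, h1, h2⟩ := hP₄.exists_between (c := -b₄) hP₃ (by linarith) (by linarith)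
      (by linarith)
    have := sum_between ρ h1 h2
    have := sum_between β h1 h2
    have := h (-b₄) P O₄ hP (by rwa [neg_neg]) (by omega)
    omega

/-- In a segment cut strictly below the level `c`, contained in `Q` and of the same weight, the
excess of `Q` is impossible. -/
theorem subset_filter_of_last {d : α} (hd : d ∈ Q) (hρd : ρ d = 1) (hmax : ∀ v ∈ Q, f v ≤ f d)
    (hQ : Q ⊆ Y) (hsub : (Y.filter fun v => f v < c) ⊆ Q)
    (hr : ∑ v ∈ Q, ρ v ≤ ∑ v ∈ Y.filter fun v => f v < c, ρ v) :
    Q ⊆ Y.filter fun v => f v < c := by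
  classical
  have hdc : d ∈ Y.filter fun v => f v < c := by
    by_contra h
    have := Finset.sum_le_sum_of_subset (f := ρ) (Finset.insert_subset hd hsub)
    rw [Finset.sum_insert h] at this
    omega
  intro v hv
  exact Finset.mem_filter.2 ⟨hQ hv, (hmax v hv).trans_lt (Finset.mem_filter.1 hdc).2⟩

theorem AlignedBound.exact_left_right {ra rc ba bc ru bu : ℕ} (hru : ru ≤ 1) (hbu : bu ≤ 1)
    (h : AlignedBound f Y Z ρ β (ra + rc) (ba + bc) ru bu)
    (hP₃ : IsLevel f Y P₃ a₃) (hO₃ : IsLevel f Z O₃ b₃) (h₃ : 0 < a₃ + b₃)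
    (hP₄ : IsLevel f Y P₄ a₄) (hO₄ : IsLevel f Z O₄ b₄) (h₄ : a₄ + b₄ < 0)
    (hrP₃ : ∑ v ∈ P₃, ρ v + ru = ra) (hrO₃ : ∑ v ∈ O₃, ρ v = rc)
    (hrP₄ : ∑ v ∈ P₄, ρ v = ra) (hrO₄ : ∑ v ∈ O₄, ρ v + ru = rc)
    (hbP₃ : ba ≤ ∑ v ∈ P₃, β v + bu) (hbO₃ : bc ≤ ∑ v ∈ O₃, β v)
    (hbP₄ : ba ≤ ∑ v ∈ P₄, β v) (hbO₄ : bc ≤ ∑ v ∈ O₄, β v + bu)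
    (hlast : bc < ∑ v ∈ O₃, β v → ∃ d ∈ O₃, ρ d = 1 ∧ ∀ v ∈ O₃, f v ≤ f d) :
    ∑ v ∈ P₃, β v + bu = ba ∧ ∑ v ∈ O₃, β v = bc := by
  rcases lt_or_ge 0 (a₃ + b₄) with hc | hc
  · obtain ⟨P, hP, h1, h2⟩ := hP₄.exists_between (c := -b₄) hP₃ (by linarith) (by linarith)
      (by linarith)
    have := sum_between ρ h1 h2
    have := sum_between β h1 h2
    have := h (-b₄) P O₄ hP (by rwa [neg_neg]) (by omega)
    omega
  rcases Nat.eq_zero_or_pos ru with rfl | hru'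
  · rcases lt_or_ge 0 (a₄ + b₃) with hc' | hc'
    · obtain ⟨O, hO, h1, h2⟩ := hO₄.exists_between (c := -a₄) hO₃ (by linarith) (by linarith)
        (by linarith)
      have := sum_between ρ h1 h2
      have := sum_between β h1 h2
      have := h a₄ P₄ O hP₄ hO (by omega)
      omega
    · obtain ⟨P, hP, h1, h2⟩ := hP₄.exists_between (c := -b₃) hP₃ (by linarith) (by linarith)
        (by linarith)
      have := sum_between ρ h1 h2
      have := sum_between β h1 h2
      have := h (-b₃) P O₃ hP (by rwa [neg_neg]) (by omega)
      omega
  · have h34 : a₃ ≤ a₄ := by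
      by_contra! h'
      have := Finset.sum_le_sum_of_subset (f := ρ) (hP₄.subset hP₃ h')
      omega
    have s1 := hO₄.subset (isLevel_filter_lt (f := f) (Y := Z) (a := -a₄)) (by linarith)
    have s2 : (Z.filter fun v => f v < -a₄) ⊆ Z.filter fun v => f v < -a₃ :=
      Finset.monotone_filter_right _ fun v _ (hv : f v < -a₄) => by
        linarith
    have s3 := (isLevel_filter_lt (f := f) (Y := Z) (a := -a₃)).subset hO₃ (by linarith)
    have r1 := sum_between ρ s1 s2
    have r2 := sum_between ρ s2 s3
    have t1 := sum_between β s1 s2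
    have t2 := sum_between β s2 s3
    have u1 := h a₄ P₄ _ hP₄ isLevel_filter_lt
    have u2 := h a₃ P₃ _ hP₃ isLevel_filter_lt
    have u3 := u2 (by omega)
    refine ⟨by omega, ?_⟩
    by_contra hne
    obtain ⟨d, hd, hρd, hmax⟩ := hlast (by omega)
    have := Finset.sum_le_sum_of_subset (f := β)
      (subset_filter_of_last hd hρd hmax hO₃.1 s3 (by omega))
    omega

theorem AlignedBound.exact_top_left {ra rc ba bc ru bu : ℕ} (hru : ru ≤ 1) (hbu : bu ≤ 1)
    (h0 : AlignedBound f Y Z ρ β (ra + rc) (ba + bc) 0 0)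
    (h : AlignedBound f Y Z ρ β (ra + rc) (ba + bc) ru bu)
    (hP₃ : IsLevel f Y P₃ a₃) (hO₃ : IsLevel f Z O₃ b₃) (h₃ : 0 < a₃ + b₃)
    (hP₄ : IsLevel f Y P₄ a₄) (hO₄ : IsLevel f Z O₄ b₄) (h₄ : a₄ + b₄ < 0)
    (hrP₃ : ∑ v ∈ P₃, ρ v = ra) (hrO₃ : ∑ v ∈ O₃, ρ v = rc)
    (hrP₄ : ∑ v ∈ P₄, ρ v + ru = ra) (hrO₄ : ∑ v ∈ O₄, ρ v = rc)
    (hbP₃ : ba ≤ ∑ v ∈ P₃, β v) (hbO₃ : bc ≤ ∑ v ∈ O₃, β v)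
    (hbP₄ : ba ≤ ∑ v ∈ P₄, β v + bu) (hbO₄ : bc ≤ ∑ v ∈ O₄, β v)
    (hlast : ba < ∑ v ∈ P₃, β v → ∃ d ∈ P₃, ρ d = 1 ∧ ∀ v ∈ P₃, f v ≤ f d) :
    ∑ v ∈ P₃, β v = ba ∧ ∑ v ∈ O₃, β v = bc := by
  rcases le_or_gt (a₃ + b₄) 0 with hc | hc
  · obtain ⟨O, hO, h1, h2⟩ := hO₄.exists_between (c := -a₃) hO₃ (by linarith) (by linarith)
      (by linarith)
    have := sum_between ρ h1 h2
    have := sum_between β h1 h2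
    have := h0 a₃ P₃ O hP₃ hO (by omega)
    omega
  constructor
  · have s1 := hP₄.subset (isLevel_filter_lt (f := f) (Y := Y) (a := -b₄)) (by linarith)
    have s2 := (isLevel_filter_lt (f := f) (Y := Y) (a := -b₄)).subset hP₃ (by linarith)
    have r := sum_between ρ s1 s2
    have t := sum_between β s1 s2
    have u0 := h0 (-b₄) _ O₄ isLevel_filter_lt (by rwa [neg_neg])
    have u1 := h (-b₄) _ O₄ isLevel_filter_lt (by rwa [neg_neg])
    have u2 := u0 (by omega)
    by_contra hne
    obtain ⟨d, hd, hρd, hmax⟩ := hlast (by omega)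
    have := Finset.sum_le_sum_of_subset (f := β)
      (subset_filter_of_last hd hρd hmax hP₃.1 s2 (by omega))
    omega
  · rcases le_or_gt 0 (a₄ + b₃) with hc' | hc'
    · obtain ⟨O, hO, h1, h2⟩ := hO₄.exists_between (c := -a₄) hO₃ (by linarith) (by linarith)
        (by linarith)
      have := sum_between ρ h1 h2
      have := sum_between β h1 h2
      have := h a₄ P₄ O hP₄ hO (by omega)
      omega
    · have s1 := hP₄.subset (isLevel_filter_lt (f := f) (Y := Y) (a := -b₃)) (by linarith)
      have s2 := (isLevel_filter_lt (f := f) (Y := Y) (a := -b₃)).subset hP₃ (by linarith)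
      have r := sum_between ρ s1 s2
      have t := sum_between β s1 s2
      have u0 := h0 (-b₃) _ O₃ isLevel_filter_lt (by rwa [neg_neg])
      have u1 := h (-b₃) _ O₃ isLevel_filter_lt (by rwa [neg_neg])
      omega

theorem AlignedBound.false_of_left_top {ra rc ba bc ru bu : ℕ}
    (h0 : AlignedBound f Y Z ρ β (ra + rc) (ba + bc) 0 0)
    (h : AlignedBound f Y Z ρ β (ra + rc) (ba + bc) ru bu)
    (hP₃ : IsLevel f Y P₃ a₃) (hO₃ : IsLevel f Z O₃ b₃) (h₃ : 0 < a₃ + b₃)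
    (hP₄ : IsLevel f Y P₄ a₄) (hO₄ : IsLevel f Z O₄ b₄) (h₄ : a₄ + b₄ < 0)
    (hrP₃ : ∑ v ∈ P₃, ρ v + ru = ra) (hrO₃ : ∑ v ∈ O₃, ρ v = rc)
    (hrP₄ : ∑ v ∈ P₄, ρ v = ra) (hrO₄ : ∑ v ∈ O₄, ρ v = rc)
    (hbP₃ : ba ≤ ∑ v ∈ P₃, β v + bu)
    (hbP₄ : ba ≤ ∑ v ∈ P₄, β v) (hbO₄ : bc ≤ ∑ v ∈ O₄, β v) : False := by
  rcases le_or_gt (a₃ + b₄) 0 with hc | hc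
  · obtain ⟨O, hO, h1, h2⟩ := hO₄.exists_between (c := -a₃) hO₃ (by linarith) (by linarith)
      (by linarith)
    have := sum_between ρ h1 h2
    have := sum_between β h1 h2
    have := h a₃ P₃ O hP₃ hO (by omega)
    omega
  · obtain ⟨P, hP, h1, h2⟩ := hP₄.exists_between (c := -b₄) hP₃ (by linarith) (by linarith)
      (by linarith)
    have := sum_between ρ h1 h2
    have := sum_between β h1 h2
    have := h0 (-b₄) P O₄ hP (by rwa [neg_neg]) (by omega)
    omega

/-- A convex configuration which is a limit of nonconvex ones is exact. The extra point, of
weight `(ru, bu)`, is distributed among the three parts according to `eᵢ` and `δᵢ`. -/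
theorem AlignedBound.exact {ra rc ba bc ru bu e₃ δ₃ e₄ δ₄ : ℕ} (hru : ru ≤ 1) (hbu : bu ≤ 1)
    (he₃ : e₃ + δ₃ ≤ 1) (he₄ : e₄ + δ₄ ≤ 1)
    (h0 : AlignedBound f Y Z ρ β (ra + rc) (ba + bc) 0 0 ∨ e₃ + δ₃ = 1 ∧ e₄ + δ₄ = 1)
    (h : AlignedBound f Y Z ρ β (ra + rc) (ba + bc) ru bu)
    (hP₃ : IsLevel f Y P₃ a₃) (hO₃ : IsLevel f Z O₃ b₃) (h₃ : 0 ≤ a₃ + b₃)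
    (hP₄ : IsLevel f Y P₄ a₄) (hO₄ : IsLevel f Z O₄ b₄) (h₄ : a₄ + b₄ ≤ 0)
    (hrP₃ : ∑ v ∈ P₃, ρ v + e₃ * ru = ra) (hrO₃ : ∑ v ∈ O₃, ρ v + δ₃ * ru = rc)
    (hrP₄ : ∑ v ∈ P₄, ρ v + e₄ * ru = ra) (hrO₄ : ∑ v ∈ O₄, ρ v + δ₄ * ru = rc)
    (hbP₃ : ba ≤ ∑ v ∈ P₃, β v + e₃ * bu) (hbO₃ : bc ≤ ∑ v ∈ O₃, β v + δ₃ * bu)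
    (hbP₄ : ba ≤ ∑ v ∈ P₄, β v + e₄ * bu) (hbO₄ : bc ≤ ∑ v ∈ O₄, β v + δ₄ * bu)
    (hlastP : e₃ = 0 → ba < ∑ v ∈ P₃, β v → ∃ d ∈ P₃, ρ d = 1 ∧ ∀ v ∈ P₃, f v ≤ f d)
    (hlastO : δ₃ = 0 → bc < ∑ v ∈ O₃, β v → ∃ d ∈ O₃, ρ d = 1 ∧ ∀ v ∈ O₃, f v ≤ f d) :
    ∑ v ∈ P₃, β v + e₃ * bu = ba ∧ ∑ v ∈ O₃, β v + δ₃ * bu = bc := by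
  have hκ : ∀ κ, (κ = 1 ∨ κ = 0 ∧ ¬ (e₃ + δ₃ = 1 ∧ e₄ + δ₄ = 1)) →
      AlignedBound f Y Z ρ β (ra + rc) (ba + bc) (κ * ru) (κ * bu) := by
    rintro κ (rfl | ⟨rfl, hκ⟩)
    · simpa using h
    · simpa using h0.resolve_right hκ
  have strict : ∀ a b P O e δ, IsLevel f Y P a → IsLevel f Z O b →
      ∑ v ∈ P, ρ v + e * ru = ra → ∑ v ∈ O, ρ v + δ * ru = rc →
      ba ≤ ∑ v ∈ P, β v + e * bu → bc ≤ ∑ v ∈ O, β v + δ * bu →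
      AlignedBound f Y Z ρ β (ra + rc) (ba + bc) ((e + δ) * ru) ((e + δ) * bu) → a + b ≠ 0 := by
    intro a b P O e δ hP hO hr hr' hb hb' hA hab
    obtain rfl : b = -a := by linarith
    have := hA a P O hP hO (by rw [add_mul]; omega)
    rw [add_mul] at this
    omega
  have h₃' : 0 < a₃ + b₃ := lt_of_le_of_ne h₃
    (strict _ _ _ _ e₃ δ₃ hP₃ hO₃ hrP₃ hrO₃ hbP₃ hbO₃ (hκ _ (by omega))).symm
  have h₄' : a₄ + b₄ < 0 := lt_of_le_of_ne h₄
    (strict _ _ _ _ e₄ δ₄ hP₄ hO₄ hrP₄ hrO₄ hbP₄ hbO₄ (hκ _ (by omega)))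
  by_cases hsame : e₃ = e₄ ∧ δ₃ = δ₄
  · obtain ⟨rfl, rfl⟩ := hsame
    have := hκ (e₃ + δ₃) (by omega)
    rw [add_mul, add_mul] at this
    exact (this.false_of_eq (B₁ := ba - e₃ * bu) (B₂ := bc - δ₃ * bu) hP₃ hO₃ h₃' hP₄ hO₄ h₄'
      (by omega) (by omega) (by omega) (by omega) (by omega) (by omega) (by omega)).elim
  have h₃'' : 0 < b₃ + a₃ := by linarith
  have h₄'' : b₄ + a₄ < 0 := by linarith
  have hs : AlignedBound f Z Y ρ β (rc + ra) (bc + ba) ru bu := by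
    rw [add_comm rc, add_comm bc]; exact h.symm
  have hs0 : AlignedBound f Y Z ρ β (ra + rc) (ba + bc) 0 0 →
      AlignedBound f Z Y ρ β (rc + ra) (bc + ba) 0 0 := fun h => by
    rw [add_comm rc, add_comm bc]; exact h.symm
  obtain ⟨rfl, rfl⟩ | ⟨rfl, rfl⟩ | ⟨rfl, rfl⟩ :
    (e₃ = 0 ∧ δ₃ = 0) ∨ (e₃ = 1 ∧ δ₃ = 0) ∨ (e₃ = 0 ∧ δ₃ = 1) := by omega
  all_goals
    obtain ⟨rfl, rfl⟩ | ⟨rfl, rfl⟩ | ⟨rfl, rfl⟩ :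
      (e₄ = 0 ∧ δ₄ = 0) ∨ (e₄ = 1 ∧ δ₄ = 0) ∨ (e₄ = 0 ∧ δ₄ = 1) := by omega
  all_goals simp only [zero_mul, one_mul, add_zero] at *
  · simp at hsame
  · exact AlignedBound.exact_top_left hru hbu (h0.resolve_right (by simp)) h hP₃ hO₃ h₃' hP₄ hO₄
      h₄' hrP₃ hrO₃ hrP₄ hrO₄ hbP₃ hbO₃ hbP₄ hbO₄ (hlastP trivial)
  · exact (AlignedBound.exact_top_left hru hbu (hs0 (h0.resolve_right (by simp))) hs hO₃ hP₃ h₃''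
      hO₄ hP₄ h₄'' hrO₃ hrP₃ hrO₄ hrP₄ hbO₃ hbP₃ hbO₄ hbP₄ (hlastO trivial)).symm
  · exact (AlignedBound.false_of_left_top (h0.resolve_right (by simp)) h hP₃ hO₃ h₃' hP₄ hO₄
      h₄' hrP₃ hrO₃ hrP₄ hrO₄ hbP₃ hbP₄ hbO₄).elim
  · simp at hsame
  · exact AlignedBound.exact_left_right hru hbu h hP₃ hO₃ h₃' hP₄ hO₄ h₄' hrP₃ hrO₃ hrP₄ hrO₄
      hbP₃ hbO₃ hbP₄ hbO₄ (hlastO trivial)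
  · exact (AlignedBound.false_of_left_top (hs0 (h0.resolve_right (by simp))) hs hO₃ hP₃ h₃'' hO₄
      hP₄ h₄'' hrO₃ hrP₃ hrO₄ hrP₄ hbO₃ hbO₄ hbP₄).elim
  · exact (AlignedBound.exact_left_right hru hbu hs hO₃ hP₃ h₃'' hO₄ hP₄ h₄'' hrO₃ hrP₃ hrO₄
      hrP₄ hbO₃ hbP₃ hbO₄ hbP₄ (hlastP trivial)).symm
  · simp at hsame

end Level

/-- The signed number of passages between the colours `0` and `1` along an edge. -/
def edgeSign (u v : Fin 3) : ℤ := if u = 0 ∧ v = 1 then 1 else if u = 1 ∧ v = 0 then -1 else 0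

theorem edgeSign_square (u v w x m : Fin 3) (hu : u ≠ m) (hv : v ≠ m) (hw : w ≠ m) (hx : x ≠ m) :
    edgeSign u v + edgeSign v x = edgeSign u w + edgeSign w x := by
  revert u v w x m
  decide

/-- Sperner's lemma for coloured square grids. -/
theorem exists_square_of_coloring {N : ℕ} (c : ℕ → ℕ → Fin 3)
    (hleft : ∀ j ≤ N, c 0 j ≠ 0) (hright : ∀ j ≤ N, c N j ≠ 1) (htop : ∀ i ≤ N, c i N ≠ 2)
    (hbot : ∀ i ≤ N, c i 0 = 2) :
    ∃ i < N, ∃ j < N, ∀ m, c i j = m ∨ c (i + 1) j = m ∨ c i (j + 1) = m ∨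
      c (i + 1) (j + 1) = m := by
  by_contra! hno
  have hrow : ∀ j < N, ∑ i ∈ Finset.range N, edgeSign (c i j) (c (i + 1) j) =
      ∑ i ∈ Finset.range N, edgeSign (c i (j + 1)) (c (i + 1) (j + 1)) := by
    intro j hj
    have h1 : ∀ i ∈ Finset.range N, edgeSign (c i j) (c (i + 1) j) -
        edgeSign (c i (j + 1)) (c (i + 1) (j + 1)) =
        -(edgeSign (c (i + 1) j) (c (i + 1) (j + 1)) - edgeSign (c i j) (c i (j + 1))) := by
      intro i hi
      obtain ⟨m, h1, h2, h3, h4⟩ := hno i (Finset.mem_range.1 hi) j hj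
      linarith [edgeSign_square _ _ _ _ m h1 h2 h3 h4]
    rw [← sub_eq_zero, ← Finset.sum_sub_distrib, Finset.sum_congr rfl h1, Finset.sum_neg_distrib,
      Finset.sum_range_sub fun i => edgeSign (c i j) (c i (j + 1))]
    have e1 : ∀ u v : Fin 3, u ≠ 0 → v ≠ 0 → edgeSign u v = 0 := by decide
    have e2 : ∀ u v : Fin 3, u ≠ 1 → v ≠ 1 → edgeSign u v = 0 := by decide
    rw [e1 _ _ (hleft j hj.le) (hleft _ hj), e2 _ _ (hright j hj.le) (hright _ hj)]
    simp
  have hall : ∀ j ≤ N, ∑ i ∈ Finset.range N, edgeSign (c i j) (c (i + 1) j) = 0 := by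
    intro j
    induction j with
    | zero =>
      intro _
      refine Finset.sum_eq_zero fun i hi => ?_
      have := Finset.mem_range.1 hi
      rw [hbot i this.le, hbot _ this]
      decide
    | succ j ih => exact fun hj => (hrow j hj).symm.trans (ih (by omega))
  have e : ∀ u v : Fin 3, u ≠ 2 → v ≠ 2 → edgeSign u v = (v.val : ℤ) - u.val := by decide
  have htel := hall N le_rfl
  rw [Finset.sum_congr rfl fun i hi => e (c i N) (c (i + 1) N)
    (htop i (Finset.mem_range.1 hi).le) (htop _ (Finset.mem_range.1 hi)),
    Finset.sum_range_sub fun i => ((c i N).val : ℤ)] at htel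
  have e' : ∀ u v : Fin 3, u ≠ 0 → u ≠ 2 → v ≠ 1 → v ≠ 2 → ((v.val : ℤ) - u.val) ≠ 0 := by decide
  exact e' _ _ (hleft N le_rfl) (htop 0 (Nat.zero_le _)) (hright N le_rfl) (htop N le_rfl) htel

/-- A Knaster–Kuratowski–Mazurkiewicz theorem for rectangles. -/
theorem exists_common_point {a b c d : ℝ} (hab : a < b) (hcd : c < d) (F : Fin 3 → Set (ℝ × ℝ))
    (hF : ∀ i, IsClosed (F i)) (hcover : Set.Icc a b ×ˢ Set.Icc c d ⊆ ⋃ i, F i)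
    (hleft : ∀ y ∈ Set.Icc c d, (a, y) ∉ F 0) (hright : ∀ y ∈ Set.Icc c d, (b, y) ∉ F 1)
    (htop : ∀ x ∈ Set.Icc a b, (x, d) ∉ F 2)
    (hbot : ∀ x ∈ Set.Icc a b, (x, c) ∉ F 0 ∧ (x, c) ∉ F 1) :
    ∃ p ∈ Set.Icc a b ×ˢ Set.Icc c d, ∀ i, p ∈ F i := by
  by_contra! hno
  obtain ⟨δ, hδ, hball⟩ := lebesgue_number_lemma_of_metric (c := fun i => (F i)ᶜ)
    (isCompact_Icc.prod isCompact_Icc) (fun i => (hF i).isOpen_compl)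
    (fun p hp => Set.mem_iUnion.2 (hno p hp))
  obtain ⟨N, hN⟩ := exists_nat_gt (max ((b - a) / δ) ((d - c) / δ))
  have hN1 : (b - a) / δ < N := (le_max_left _ _).trans_lt hN
  have hN2 : (d - c) / δ < N := (le_max_right _ _).trans_lt hN
  have hN0 : (0 : ℝ) < N := lt_of_le_of_lt (div_nonneg (by linarith) hδ.le) hN1
  rw [div_lt_iff₀ hδ] at hN1 hN2
  let X : ℕ → ℝ := fun i => a + (b - a) * (i / N)
  let W : ℕ → ℝ := fun j => c + (d - c) * (j / N)
  have hdiv : ∀ i ≤ N, (0 : ℝ) ≤ (i : ℝ) / N ∧ (i : ℝ) / N ≤ 1 := fun i hi =>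
    ⟨by positivity, (div_le_one hN0).2 (by exact_mod_cast hi)⟩
  have hX : ∀ i ≤ N, X i ∈ Set.Icc a b := fun i hi => by
    have := hdiv i hi
    constructor <;> simp only [X] <;> nlinarith
  have hW : ∀ i ≤ N, W i ∈ Set.Icc c d := fun i hi => by
    have := hdiv i hi
    constructor <;> simp only [W] <;> nlinarith
  have hcol : ∀ i j, ∃ m : Fin 3, i ≤ N → j ≤ N → (X i, W j) ∈ F m := by
    intro i j
    by_cases h : i ≤ N ∧ j ≤ N
    · obtain ⟨m, hm⟩ := Set.mem_iUnion.1 (hcover (Set.mk_mem_prod (hX i h.1) (hW j h.2)))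
      exact ⟨m, fun _ _ => hm⟩
    · exact ⟨0, fun h1 h2 => (h ⟨h1, h2⟩).elim⟩
  choose k hk using hcol
  have hX0 : X 0 = a := by simp [X]
  have hW0 : W 0 = c := by simp [W]
  have hXN : X N = b := by simp [X, hN0.ne']
  have hWN : W N = d := by simp [W, hN0.ne']
  obtain ⟨i, hi, j, hj, hsq⟩ := exists_square_of_coloring (N := N) k
    (fun j hj h => hleft (W j) (hW j hj) (by simpa [h, hX0] using hk 0 j (Nat.zero_le _) hj))
    (fun j hj h => hright (W j) (hW j hj) (by simpa [h, hXN] using hk N j le_rfl hj))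
    (fun i hi h => htop (X i) (hX i hi) (by simpa [h, hWN] using hk i N hi le_rfl))
    (fun i hi => by
      have h1 := hk i 0 hi (Nat.zero_le _)
      rw [hW0] at h1
      have h2 := hbot (X i) (hX i hi)
      have : ∀ m : Fin 3, m = 0 ∨ m = 1 ∨ m = 2 := by decide
      rcases this (k i 0) with h | h | h
      · exact absurd (h ▸ h1) h2.1
      · exact absurd (h ▸ h1) h2.2
      · exact h)
  obtain ⟨m, hm⟩ := hball (X i, W j) (Set.mk_mem_prod (hX i hi.le) (hW j hj.le))
  have hstepX : |X (i + 1) - X i| < δ := by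
    have : X (i + 1) - X i = (b - a) / N := by simp only [X]; push_cast; ring
    rw [this, abs_of_nonneg (div_nonneg (by linarith) hN0.le), div_lt_iff₀ hN0]
    linarith
  have hstepW : |W (j + 1) - W j| < δ := by
    have : W (j + 1) - W j = (d - c) / N := by simp only [W]; push_cast; ring
    rw [this, abs_of_nonneg (div_nonneg (by linarith) hN0.le), div_lt_iff₀ hN0]
    linarith
  have hin : ∀ i' j', |X i' - X i| < δ → |W j' - W j| < δ → i' ≤ N → j' ≤ N → k i' j' ≠ m := by
    intro i' j' h1 h2 hi' hj' h
    refine hm (?_ : (X i', W j') ∈ _) (h ▸ hk i' j' hi' hj')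
    rw [Metric.mem_ball, Prod.dist_eq, Real.dist_eq, Real.dist_eq]
    exact max_lt h1 h2
  have z1 : |X i - X i| < δ := by simpa
  have z2 : |W j - W j| < δ := by simpa
  rcases hsq m with h | h | h | h
  · exact hin _ _ z1 z2 hi.le hj.le h
  · exact hin _ _ hstepX z2 hi hj.le h
  · exact hin _ _ z1 hstepW hi.le hj h
  · exact hin _ _ hstepX hstepW hi hj h

/-- Twice the signed area of a triangle. -/
def cross (p q s : ℝ × ℝ) : ℝ := (q.1 - p.1) * (s.2 - p.2) - (q.2 - p.2) * (s.1 - p.1)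

/-- General position. -/
def GenPos (X : Finset (ℝ × ℝ)) : Prop :=
  ∀ p ∈ X, ∀ q ∈ X, ∀ s ∈ X, p ≠ q → p ≠ s → q ≠ s → cross p q s ≠ 0

/-- `S` is the part of `X` on one side of a line; points on the line are distributed freely. -/
def Sep (X S : Finset (ℝ × ℝ)) : Prop :=
  ∃ w : ℝ × ℝ, w ≠ 0 ∧ IsPrefix (fun v => w.1 * v.1 + w.2 * v.2) X S

theorem exists_between_images {α β : Type*} (A : Finset α) (B : Finset β) (f : α → ℝ) (g : β → ℝ)
    (h : ∀ a ∈ A, ∀ b ∈ B, f a ≤ g b) : ∃ c, (∀ a ∈ A, f a ≤ c) ∧ ∀ b ∈ B, c ≤ g b := by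
  rcases A.eq_empty_or_nonempty with rfl | hA
  · rcases B.eq_empty_or_nonempty with rfl | hB
    · exact ⟨0, by simp, by simp⟩
    · obtain ⟨b, -, hb⟩ := Finset.exists_min_image B g hB
      exact ⟨g b, by simp, hb⟩
  · obtain ⟨a, ha, hmax⟩ := Finset.exists_max_image A f hA
    exact ⟨f a, hmax, h a ha⟩

theorem IsPrefix.exists_isLevel {α : Type*} {f : α → ℝ} {Y P : Finset α} (h : IsPrefix f Y P) :
    ∃ c, IsLevel f Y P c := by
  classical
  obtain ⟨c, h1, h2⟩ := exists_between_images P (Y \ P) f f fun a ha b hb =>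
    h.2 a ha b (Finset.mem_sdiff.1 hb).1 (Finset.mem_sdiff.1 hb).2
  exact ⟨c, h.1, h1, fun w hw hw' => h2 w (Finset.mem_sdiff.2 ⟨hw, hw'⟩)⟩

variable {X S S' : Finset (ℝ × ℝ)}

theorem GenPos.noTriple (hX : GenPos X) {w : ℝ × ℝ} (hw : w ≠ 0) :
    NoTriple (fun v => w.1 * v.1 + w.2 * v.2) X := by
  intro p hp q hq s hs hpq hps hqs h1 h2
  have hc := hX p hp q hq s hs hpq hps hqs
  dsimp only at h1 h2
  have e1 : w.1 * cross p q s = 0 := by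
    unfold cross
    linear_combination (-(s.2 - p.2)) * h1 + (q.2 - p.2) * h2
  have e2 : w.2 * cross p q s = 0 := by
    unfold cross
    linear_combination (s.1 - p.1) * h1 - (q.1 - p.1) * h2
  exact hw (Prod.ext ((mul_eq_zero.1 e1).resolve_right hc) ((mul_eq_zero.1 e2).resolve_right hc))

theorem Sep.subset (h : Sep X S) : S ⊆ X := h.choose_spec.2.1

theorem Sep.sdiff (h : Sep X S) : Sep X (X \ S) := by
  obtain ⟨w, hw, hS⟩ := h
  refine ⟨-w, neg_ne_zero.2 hw, Finset.sdiff_subset, fun v hv u hu hu' => ?_⟩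
  rw [Finset.mem_sdiff] at hv
  rw [Finset.mem_sdiff, not_and_not_right] at hu'
  have := hS.2 u (hu' hu) v hv.1 hv.2
  simp only [Prod.fst_neg, Prod.snd_neg]
  linarith

theorem sep_empty : Sep X ∅ := ⟨(1, 0), by simp, isPrefix_empty⟩

/-- Points on a separating line can be pushed off it, in general position. -/
theorem Sep.exists_strict (hX : GenPos X) (h : Sep X S) :
    ∃ w : ℝ × ℝ, w ≠ 0 ∧ ∃ c, (∀ v ∈ S, w.1 * v.1 + w.2 * v.2 < c) ∧
      ∀ v ∈ X, v ∉ S → c < w.1 * v.1 + w.2 * v.2 := by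
  obtain ⟨w, hw, hS⟩ := h
  have hno := hX.noTriple hw
  obtain ⟨c, hc⟩ := hS.exists_isLevel
  obtain ⟨g, e, hg1, hg2⟩ : ∃ (g : ℝ × ℝ) (e : ℝ),
      (∀ v ∈ S, w.1 * v.1 + w.2 * v.2 = c → g.1 * v.1 + g.2 * v.2 < e) ∧
      ∀ v ∈ X, v ∉ S → w.1 * v.1 + w.2 * v.2 = c → e < g.1 * v.1 + g.2 * v.2 := by
    by_cases h1 : ∃ p ∈ S, w.1 * p.1 + w.2 * p.2 = c
    · obtain ⟨p, hp, hpc⟩ := h1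
      by_cases h2 : ∃ q ∈ X, q ∉ S ∧ w.1 * q.1 + w.2 * q.2 = c
      · obtain ⟨q, hq, hqS, hqc⟩ := h2
        have hpq : p ≠ q := fun h => hqS (h ▸ hp)
        have hpos : 0 < (q.1 - p.1) ^ 2 + (q.2 - p.2) ^ 2 := by
          by_contra! h0
          apply hpq
          ext <;> nlinarith [sq_nonneg (q.1 - p.1), sq_nonneg (q.2 - p.2)]
        refine ⟨q - p, ((q.1 - p.1) * (q.1 + p.1) + (q.2 - p.2) * (q.2 + p.2)) / 2, ?_, ?_⟩
        · intro v hv hvc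
          obtain rfl : v = p := by
            by_contra hvp
            exact hno p (hS.1 hp) q hq v (hS.1 hv) hpq (Ne.symm hvp) (fun h => hqS (h ▸ hv))
              (hpc.trans hqc.symm) (hpc.trans hvc.symm)
          simp only [Prod.fst_sub, Prod.snd_sub]
          nlinarith
        · intro v hv hvS hvc
          obtain rfl : v = q := by
            by_contra hvq
            exact hno p (hS.1 hp) q hq v hv hpq (fun h => hvS (h ▸ hp)) (Ne.symm hvq)
              (hpc.trans hqc.symm) (hpc.trans hvc.symm)
          simp only [Prod.fst_sub, Prod.snd_sub]
          nlinarith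
      · push Not at h2
        exact ⟨0, 1, by simp, fun v hv hv' hvc => absurd hvc (h2 v hv hv')⟩
    · push Not at h1
      exact ⟨0, -1, fun v hv hvc => absurd hvc (h1 v hv), by simp⟩
  have hcont : ∀ x y z t : ℝ, Tendsto (fun ε : ℝ => x + ε * y - (z + ε * t)) (𝓝[>] 0)
      (𝓝 (x + 0 * y - (z + 0 * t))) := fun x y z t =>
    (Continuous.tendsto (by fun_prop) 0).mono_left nhdsWithin_le_nhds
  have step : ∀ x y z t : ℝ, x ≤ z → (x = z → y < t) →
      ∀ᶠ ε in 𝓝[>] (0 : ℝ), x + ε * y < z + ε * t := by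
    intro x y z t hxz hyt
    rcases hxz.eq_or_lt with rfl | hlt
    · filter_upwards [self_mem_nhdsWithin] with ε (hε : 0 < ε)
      have := mul_lt_mul_of_pos_left (hyt rfl) hε
      linarith
    · filter_upwards [(hcont x y z t).eventually (eventually_lt_nhds (b := 0) (by linarith))] with ε h
      linarith
  have ev1 : ∀ᶠ ε in 𝓝[>] (0 : ℝ), ∀ v ∈ S,
      (w.1 * v.1 + w.2 * v.2) + ε * (g.1 * v.1 + g.2 * v.2) < c + ε * e :=
    (Finset.eventually_all S).2 fun v hv => step _ _ _ _ (hc.2.1 v hv) (hg1 v hv)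
  have ev2 : ∀ᶠ ε in 𝓝[>] (0 : ℝ), ∀ v ∈ X, v ∉ S →
      c + ε * e < (w.1 * v.1 + w.2 * v.2) + ε * (g.1 * v.1 + g.2 * v.2) :=
    (Finset.eventually_all X).2 fun v hv => by
      by_cases hvS : v ∈ S
      · simp [hvS]
      · filter_upwards [step _ _ _ _ (hc.2.2 v hv hvS) fun h => hg2 v hv hvS h.symm] with ε h _
        exact h
  have ev3 : ∀ᶠ ε in 𝓝[>] (0 : ℝ), w + ε • g ≠ 0 := by
    have ht : Tendsto (fun ε : ℝ => w + ε • g) (𝓝[>] 0) (𝓝 (w + (0 : ℝ) • g)) :=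
      (Continuous.tendsto (by fun_prop) 0).mono_left nhdsWithin_le_nhds
    rw [zero_smul, add_zero] at ht
    exact ht.eventually_ne hw
  obtain ⟨ε, h1, h2, h3⟩ := (ev1.and (ev2.and ev3)).exists
  refine ⟨w + ε • g, h3, c + ε * e, fun v hv => ?_, fun v hv hv' => ?_⟩
  · have := h1 v hv
    simp only [Prod.fst_add, Prod.snd_add, Prod.smul_fst, Prod.smul_snd, smul_eq_mul]
    linarith
  · have := h2 v hv hv'
    simp only [Prod.fst_add, Prod.snd_add, Prod.smul_fst, Prod.smul_snd, smul_eq_mul]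
    linarith

theorem isClosed_isPrefix (X S : Finset (ℝ × ℝ)) :
    IsClosed {w : ℝ × ℝ | IsPrefix (fun v => w.1 * v.1 + w.2 * v.2) X S} := by
  by_cases hS : S ⊆ X
  · simp only [IsPrefix, hS, true_and, Set.ofPred_forall]
    refine isClosed_biInter fun v _ => isClosed_biInter fun u _ => isClosed_iInter fun _ => ?_
    exact isClosed_le (by fun_prop) (by fun_prop)
  · simp [IsPrefix, hS]

/-- Rotating a line: intermediate values of the second weight are attained. -/
theorem Sep.exists_eq {ρ β : ℝ × ℝ → ℕ} (hρ : ∀ v, ρ v ≤ 1) (hβ : ∀ v, β v ≤ 1) (hX : GenPos X)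
    (hS : Sep X S) (hS' : Sep X S') {k m : ℕ} (hr : ∑ v ∈ S, ρ v = k) (hr' : ∑ v ∈ S', ρ v = k)
    (hb : ∑ v ∈ S, β v ≤ m) (hb' : m ≤ ∑ v ∈ S', β v) :
    ∃ T, Sep X T ∧ ∑ v ∈ T, ρ v = k ∧ ∑ v ∈ T, β v = m := by
  classical
  have hcl : ∀ q : ℕ → Prop, IsClosed (⋃ T ∈ X.powerset.filter fun T =>
      ∑ v ∈ T, ρ v = k ∧ q (∑ v ∈ T, β v),
      {w : ℝ × ℝ | IsPrefix (fun v => w.1 * v.1 + w.2 * v.2) X T}) := fun q =>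
    Set.Finite.isClosed_biUnion (Finset.finite_toSet _) fun T _ => isClosed_isPrefix X T
  have hmem : ∀ (q : ℕ → Prop) (w : ℝ × ℝ), (w ∈ ⋃ T ∈ X.powerset.filter fun T =>
      ∑ v ∈ T, ρ v = k ∧ q (∑ v ∈ T, β v),
      {w : ℝ × ℝ | IsPrefix (fun v => w.1 * v.1 + w.2 * v.2) X T}) ↔
      ∃ T, IsPrefix (fun v => w.1 * v.1 + w.2 * v.2) X T ∧ ∑ v ∈ T, ρ v = k ∧
        q (∑ v ∈ T, β v) := by
    intro q w
    simp only [Set.mem_iUnion, Finset.mem_filter, Finset.mem_powerset, Set.mem_ofPred_eq,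
      exists_prop]
    exact ⟨fun ⟨T, ⟨_, h1, h2⟩, h3⟩ => ⟨T, h3, h1, h2⟩, fun ⟨T, h3, h1, h2⟩ =>
      ⟨T, ⟨h3.1, h1, h2⟩, h3⟩⟩
  have hconn : IsPreconnected ({0}ᶜ : Set (ℝ × ℝ)) :=
    (isPathConnected_compl_singleton_of_one_lt_rank (by
      rw [← Module.finrank_eq_rank]; norm_num) 0).isConnected.isPreconnected
  obtain ⟨w, hw, hS⟩ := hS
  obtain ⟨w', hw', hS'⟩ := hS'
  obtain ⟨x, hx, hx1, hx2⟩ := isPreconnected_closed_iff.1 hconn _ _ (hcl fun n => n ≤ m)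
    (hcl fun n => m ≤ n) (fun z _ => by
      obtain ⟨T, hT, -, -, hTk⟩ := isPrefix_empty.exists_between hρ (m := k)
        (isPrefix_self (f := fun v : ℝ × ℝ => z.1 * v.1 + z.2 * v.2) (Y := X))
        (Finset.empty_subset _) (by simp) (hr ▸ Finset.sum_le_sum_of_subset hS.1)
      rcases le_total (∑ v ∈ T, β v) m with h | h
      · exact Or.inl ((hmem (fun n => n ≤ m) z).2 ⟨T, hT, hTk, h⟩)
      · exact Or.inr ((hmem (fun n => m ≤ n) z).2 ⟨T, hT, hTk, h⟩))
    ⟨w, hw, (hmem (fun n => n ≤ m) w).2 ⟨S, hS, hr, hb⟩⟩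
    ⟨w', hw', (hmem (fun n => m ≤ n) w').2 ⟨S', hS', hr', hb'⟩⟩
  obtain ⟨T, hT, hTk, hTm⟩ := (hmem (fun n => n ≤ m) x).1 hx1
  obtain ⟨T', hT', hTk', hTm'⟩ := (hmem (fun n => m ≤ n) x).1 hx2
  rcases hT.compare (hX.noTriple hx) hT' with h | h | ⟨v, u, hv, hv', hu, hu', -, h⟩
  · obtain ⟨R, hR, h1, h2, h3⟩ := hT.exists_between hβ hT' h hTm hTm'
    have := sum_between ρ h1 h2
    exact ⟨R, ⟨x, hx, hR⟩, by omega, h3⟩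
  · have := Finset.sum_le_sum_of_subset (f := β) h
    exact ⟨T, ⟨x, hx, hT⟩, hTk, by omega⟩
  · have := sum_insert_erase β hv hu'
    rw [← h] at this
    have := hβ u
    by_cases hm : ∑ v ∈ T, β v = m
    · exact ⟨T, ⟨x, hx, hT⟩, hTk, hm⟩
    · exact ⟨T', ⟨x, hx, hT'⟩, hTk', by omega⟩

/-- The slope of `v` as seen from `p`, with `x`-axis directed away from `p`. -/
noncomputable def key (p v : ℝ × ℝ) : ℝ := (v.2 - p.2) / |v.1 - p.1|

/-- The points of `X` to the left (`σ = 1`) or to the right (`σ = -1`) of `p`. -/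
noncomputable def side (σ : ℝ) (X : Finset (ℝ × ℝ)) (p : ℝ × ℝ) : Finset (ℝ × ℝ) :=
  X.filter fun v => σ * v.1 < σ * p.1

section Key

variable {X S L P O : Finset (ℝ × ℝ)} {p p₀ u v w : ℝ × ℝ} {σ a : ℝ}

theorem mem_side : v ∈ side σ X p ↔ v ∈ X ∧ σ * v.1 < σ * p.1 := Finset.mem_filter

theorem side_subset : side σ X p ⊆ X := Finset.filter_subset _ _

theorem fst_ne_of_mem_side (h : v ∈ side σ X p) : v.1 ≠ p.1 := fun h' =>
  (mem_side.1 h).2.ne (by rw [h'])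

theorem sep_side (hσ : σ ≠ 0) : Sep X (side σ X p) := by
  refine ⟨(σ, 0), by simp [hσ], side_subset, fun v hv w hw hw' => ?_⟩
  have h1 := (mem_side.1 hv).2
  have h2 : ¬ σ * w.1 < σ * p.1 := fun h => hw' (mem_side.2 ⟨hw, h⟩)
  simp only [zero_mul, add_zero]
  linarith

theorem snd_eq_key (hσ : σ = 1 ∨ σ = -1) (h : v ∈ side σ X p) :
    v.2 = p.2 + key p v * (σ * (p.1 - v.1)) := by
  have h1 := (mem_side.1 h).2
  have h2 : |v.1 - p.1| = σ * (p.1 - v.1) := by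
    rcases hσ with rfl | rfl
    · rw [abs_of_neg (by linarith)]; ring
    · rw [abs_of_pos (by linarith)]; ring
  have h3 : σ * (p.1 - v.1) ≠ 0 := by nlinarith
  rw [key, h2, div_mul_cancel₀ _ h3]
  ring

theorem cross_eq_zero_of_key_eq (hσ : σ = 1 ∨ σ = -1) (hv : v ∈ side σ X p)
    (hw : w ∈ side σ X p) (h : key p v = key p w) : cross p v w = 0 := by
  have h1 := snd_eq_key hσ hv
  have h2 := snd_eq_key hσ hw
  rw [h] at h1
  unfold cross
  rw [h1, h2]
  ring

theorem noTriple_key (hX : GenPos X) (hσ : σ = 1 ∨ σ = -1) : NoTriple (key p) (side σ X p) := by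
  intro a ha b hb c hc hab hac hbc h1 h2
  refine hX a (side_subset ha) b (side_subset hb) c (side_subset hc) hab hac hbc ?_
  have e1 := snd_eq_key hσ ha
  have e2 := snd_eq_key hσ hb
  have e3 := snd_eq_key hσ hc
  rw [← h1] at e2
  rw [← h2] at e3
  unfold cross
  rw [e1, e2, e3]
  ring

theorem sep_aligned {E : Finset (ℝ × ℝ)} (hP : IsLevel (key p) (side 1 X p) P a)
    (hO : IsLevel (key p) (side (-1) X p) O (-a)) (hEX : E ⊆ X) (hE : ∀ v ∈ E, v.1 = p.1 ∧ v.2 ≤ p.2)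
    (hE' : ∀ v ∈ X, v.1 = p.1 → v ∉ E → p.2 ≤ v.2) : Sep X (P ∪ O ∪ E) := by
  have hl : ∀ v ∈ P ∪ O ∪ E, a * v.1 + 1 * v.2 ≤ a * p.1 + p.2 := by
    intro v hv
    rcases Finset.mem_union.1 hv with hv | hv
    · rcases Finset.mem_union.1 hv with hv | hv
      · have h1 := snd_eq_key (Or.inl rfl) (hP.1 hv)
        have h2 := (mem_side.1 (hP.1 hv)).2
        have h3 := hP.2.1 v hv
        nlinarith
      · have h1 := snd_eq_key (Or.inr rfl) (hO.1 hv)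
        have h2 := (mem_side.1 (hO.1 hv)).2
        have h3 := hO.2.1 v hv
        nlinarith
    · obtain ⟨h1, h2⟩ := hE v hv
      rw [h1]
      linarith
  refine ⟨(a, 1), by simp, Finset.union_subset (Finset.union_subset (hP.1.trans side_subset)
    (hO.1.trans side_subset)) hEX, fun v hv w hw hw' => (hl v hv).trans ?_⟩
  simp only [Finset.mem_union, not_or] at hw'
  obtain ⟨⟨hwP, hwO⟩, hwE⟩ := hw'
  change _ ≤ a * w.1 + 1 * w.2
  rcases lt_trichotomy w.1 p.1 with h | h | h
  · have hm : w ∈ side 1 X p := mem_side.2 ⟨hw, by linarith⟩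
    have h1 := snd_eq_key (Or.inl rfl) hm
    have h2 := hP.2.2 w hm hwP
    nlinarith
  · have := hE' w hw h hwE
    rw [h]
    linarith
  · have hm : w ∈ side (-1) X p := mem_side.2 ⟨hw, by linarith⟩
    have h1 := snd_eq_key (Or.inr rfl) hm
    have h2 := hO.2.2 w hm hwO
    nlinarith

theorem alignedBound_key {ρ β : ℝ × ℝ → ℕ} {k m : ℕ}
    (h : ∀ S, Sep X S → ∑ v ∈ S, ρ v = k → ∑ v ∈ S, β v < m) {E : Finset (ℝ × ℝ)}
    (hEX : E ⊆ X) (hE : ∀ v ∈ E, v.1 = p.1 ∧ v.2 ≤ p.2)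
    (hE' : ∀ v ∈ X, v.1 = p.1 → v ∉ E → p.2 ≤ v.2) :
    AlignedBound (key p) (side 1 X p) (side (-1) X p) ρ β k m (∑ v ∈ E, ρ v) (∑ v ∈ E, β v) := by
  intro a P O hP hO hr
  have hsum : ∀ ρ : ℝ × ℝ → ℕ, ∑ v ∈ P ∪ O ∪ E, ρ v =
      ∑ v ∈ P, ρ v + ∑ v ∈ O, ρ v + ∑ v ∈ E, ρ v := by
    intro ρ
    rw [Finset.sum_union, Finset.sum_union]
    · rw [Finset.disjoint_left]
      intro v hv hv'
      have h1 := (mem_side.1 (hP.1 hv)).2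
      have h2 := (mem_side.1 (hO.1 hv')).2
      linarith
    · rw [Finset.disjoint_left]
      intro v hv hv'
      rcases Finset.mem_union.1 hv with hv | hv
      · exact fst_ne_of_mem_side (hP.1 hv) (hE v hv').1
      · exact fst_ne_of_mem_side (hO.1 hv) (hE v hv').1
  have := h _ (sep_aligned hP hO hEX hE hE') (by rw [hsum, hr])
  rwa [hsum] at this

/-- The order relations among the points of `X` seen from `p` refine those seen from `p₀`. -/
structure Near (X : Finset (ℝ × ℝ)) (p₀ p : ℝ × ℝ) : Prop where
  lt : ∀ v ∈ X, v.1 < p₀.1 → v.1 < p.1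
  gt : ∀ v ∈ X, p₀.1 < v.1 → p.1 < v.1
  key_lt : ∀ v ∈ X, ∀ w ∈ X, v.1 ≠ p₀.1 → w.1 ≠ p₀.1 → key p₀ v < key p₀ w → key p v < key p w
  sum_pos : ∀ v ∈ X, ∀ w ∈ X, v.1 ≠ p₀.1 → w.1 ≠ p₀.1 → 0 < key p₀ v + key p₀ w →
    0 < key p v + key p w
  sum_neg : ∀ v ∈ X, ∀ w ∈ X, v.1 ≠ p₀.1 → w.1 ≠ p₀.1 → key p₀ v + key p₀ w < 0 →
    key p v + key p w < 0
  below : ∀ u ∈ X, ∀ v ∈ X, u.1 = p₀.1 → u.2 < p₀.2 → u.1 ≠ p.1 → v.1 ≠ p₀.1 →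
    key p u < key p v
  above : ∀ u ∈ X, ∀ v ∈ X, u.1 = p₀.1 → p₀.2 < u.2 → u.1 ≠ p.1 → v.1 ≠ p₀.1 →
    key p v < key p u

theorem continuousAt_key (h : v.1 ≠ p₀.1) : ContinuousAt (fun p => key p v) p₀ := by
  unfold key
  refine ContinuousAt.div (by fun_prop) (by fun_prop) ?_
  rw [abs_ne_zero]
  exact sub_ne_zero.2 h

theorem eventually_near (X : Finset (ℝ × ℝ)) (p₀ : ℝ × ℝ) : ∀ᶠ p in 𝓝 p₀, Near X p₀ p := by
  have all2 : ∀ q : ℝ × ℝ → ℝ × ℝ → ℝ × ℝ → Prop, (∀ v w, ∀ᶠ p in 𝓝 p₀, q p v w) →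
      ∀ᶠ p in 𝓝 p₀, ∀ v ∈ X, ∀ w ∈ X, q p v w := fun q h =>
    (Finset.eventually_all X).2 fun v _ => (Finset.eventually_all X).2 fun w _ => h v w
  have hfst : ContinuousAt (fun p : ℝ × ℝ => p.1) p₀ := continuousAt_fst
  have e1 : ∀ᶠ p in 𝓝 p₀, ∀ v ∈ X, v.1 < p₀.1 → v.1 < p.1 :=
    (Finset.eventually_all X).2 fun v _ => by
      by_cases h : v.1 < p₀.1
      · filter_upwards [hfst.eventually (eventually_gt_nhds h)] with p hp _ using hp
      · simp [h]
  have e2 : ∀ᶠ p in 𝓝 p₀, ∀ v ∈ X, p₀.1 < v.1 → p.1 < v.1 :=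
    (Finset.eventually_all X).2 fun v _ => by
      by_cases h : p₀.1 < v.1
      · filter_upwards [hfst.eventually (eventually_lt_nhds h)] with p hp _ using hp
      · simp [h]
  have e3 := all2 (fun p v w => v.1 ≠ p₀.1 → w.1 ≠ p₀.1 → key p₀ v < key p₀ w →
      key p v < key p w) fun v w => by
    by_cases h : v.1 ≠ p₀.1 ∧ w.1 ≠ p₀.1 ∧ key p₀ v < key p₀ w
    · filter_upwards [((continuousAt_key h.1).sub (continuousAt_key h.2.1)).eventually
        (eventually_lt_nhds (b := 0) (sub_neg.2 h.2.2))] with p hp _ _ _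
      exact sub_neg.1 hp
    · exact Eventually.of_forall fun p h1 h2 h3 => absurd ⟨h1, h2, h3⟩ h
  have e4 := all2 (fun p v w => v.1 ≠ p₀.1 → w.1 ≠ p₀.1 → 0 < key p₀ v + key p₀ w →
      0 < key p v + key p w) fun v w => by
    by_cases h : v.1 ≠ p₀.1 ∧ w.1 ≠ p₀.1 ∧ 0 < key p₀ v + key p₀ w
    · filter_upwards [((continuousAt_key h.1).add (continuousAt_key h.2.1)).eventually
        (eventually_gt_nhds h.2.2)] with p hp _ _ _ using hp
    · exact Eventually.of_forall fun p h1 h2 h3 => absurd ⟨h1, h2, h3⟩ h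
  have e5 := all2 (fun p v w => v.1 ≠ p₀.1 → w.1 ≠ p₀.1 → key p₀ v + key p₀ w < 0 →
      key p v + key p w < 0) fun v w => by
    by_cases h : v.1 ≠ p₀.1 ∧ w.1 ≠ p₀.1 ∧ key p₀ v + key p₀ w < 0
    · filter_upwards [((continuousAt_key h.1).add (continuousAt_key h.2.1)).eventually
        (eventually_lt_nhds h.2.2)] with p hp _ _ _ using hp
    · exact Eventually.of_forall fun p h1 h2 h3 => absurd ⟨h1, h2, h3⟩ h
  have e6 := all2 (fun p u v => u.1 = p₀.1 → u.2 < p₀.2 → u.1 ≠ p.1 → v.1 ≠ p₀.1 →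
      key p u < key p v) fun u v => by
    by_cases h : u.1 = p₀.1 ∧ u.2 < p₀.2 ∧ v.1 ≠ p₀.1
    · have hc : ContinuousAt (fun p : ℝ × ℝ => u.2 - p.2 - key p v * |u.1 - p.1|) p₀ :=
        ContinuousAt.sub (by fun_prop) ((continuousAt_key h.2.2).mul (by fun_prop))
      filter_upwards [hc.eventually (eventually_lt_nhds (b := 0) (by
        simp only [h.1, sub_self, abs_zero, mul_zero]; linarith [h.2.1]))] with p hp _ _ hne _
      rw [key, div_lt_iff₀ (abs_pos.2 (sub_ne_zero.2 hne))]
      linarith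
    · exact Eventually.of_forall fun p h1 h2 _ h3 => absurd ⟨h1, h2, h3⟩ h
  have e7 := all2 (fun p u v => u.1 = p₀.1 → p₀.2 < u.2 → u.1 ≠ p.1 → v.1 ≠ p₀.1 →
      key p v < key p u) fun u v => by
    by_cases h : u.1 = p₀.1 ∧ p₀.2 < u.2 ∧ v.1 ≠ p₀.1
    · have hc : ContinuousAt (fun p : ℝ × ℝ => u.2 - p.2 - key p v * |u.1 - p.1|) p₀ :=
        ContinuousAt.sub (by fun_prop) ((continuousAt_key h.2.2).mul (by fun_prop))
      filter_upwards [hc.eventually (eventually_gt_nhds (b := 0) (by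
        simp only [h.1, sub_self, abs_zero, mul_zero]; linarith [h.2.1]))] with p hp _ _ hne _
      rw [key.eq_def p u, lt_div_iff₀ (abs_pos.2 (sub_ne_zero.2 hne))]
      linarith
    · exact Eventually.of_forall fun p h1 h2 _ h3 => absurd ⟨h1, h2, h3⟩ h
  filter_upwards [e1, e2, e3, e4, e5, e6, e7] with p h1 h2 h3 h4 h5 h6 h7
  exact ⟨h1, h2, h3, h4, h5, h6, h7⟩

/-- The points of `L` which are not on the vertical line through `p₀`. -/
noncomputable def off (p₀ : ℝ × ℝ) (L : Finset (ℝ × ℝ)) : Finset (ℝ × ℝ) :=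
  L.filter fun v => v.1 ≠ p₀.1

theorem mem_off : v ∈ off p₀ L ↔ v ∈ L ∧ v.1 ≠ p₀.1 := Finset.mem_filter

theorem off_subset : off p₀ L ⊆ L := Finset.filter_subset _ _

theorem off_eq_self (h : ∀ v ∈ L, v.1 ≠ p₀.1) : off p₀ L = L := Finset.filter_true_of_mem h

theorem Near.side_subset_side (hN : Near X p₀ p) (hσ : σ = 1 ∨ σ = -1) :
    side σ X p₀ ⊆ side σ X p := by
  intro v hv
  obtain ⟨h1, h2⟩ := mem_side.1 hv
  refine mem_side.2 ⟨h1, ?_⟩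
  rcases hσ with rfl | rfl
  · linarith [hN.lt v h1 (by linarith)]
  · linarith [hN.gt v h1 (by linarith)]

theorem Near.off_side (hN : Near X p₀ p) (hσ : σ = 1 ∨ σ = -1) :
    off p₀ (side σ X p) = side σ X p₀ := by
  ext v
  rw [mem_off]
  refine ⟨fun ⟨hv, hne⟩ => ?_, fun hv => ⟨hN.side_subset_side hσ hv, fst_ne_of_mem_side hv⟩⟩
  obtain ⟨h1, h2⟩ := mem_side.1 hv
  refine mem_side.2 ⟨h1, ?_⟩
  by_contra! h
  rcases hσ with rfl | rfl
  · linarith [hN.gt v h1 (lt_of_le_of_ne (by linarith) hne.symm)]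
  · linarith [hN.lt v h1 (lt_of_le_of_ne (by linarith) hne)]

theorem Near.isPrefix_off (hN : Near X p₀ p) (hσ : σ = 1 ∨ σ = -1)
    (hL : IsPrefix (key p) (side σ X p) L) :
    IsPrefix (key p₀) (side σ X p₀) (off p₀ L) := by
  have hsub : off p₀ L ⊆ side σ X p₀ := by
    rw [← hN.off_side hσ]
    exact Finset.filter_subset_filter _ hL.1
  refine ⟨hsub, fun v hv w hw hw' => ?_⟩
  by_contra! h
  have h1 := hN.key_lt w (side_subset hw) v (side_subset (hsub hv)) (fst_ne_of_mem_side hw)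
    (fst_ne_of_mem_side (hsub hv)) h
  have h2 := hL.2 v (off_subset hv) w (hN.side_subset_side hσ hw)
    fun h => hw' (mem_off.2 ⟨h, fst_ne_of_mem_side hw⟩)
  linarith

theorem sum_off (hx : ∀ v ∈ X, ∀ w ∈ X, v.1 = w.1 → v = w) (hL : L ⊆ X) (hu : u ∈ X)
    (hup : u.1 = p₀.1) (ρ : ℝ × ℝ → ℕ) :
    ∑ v ∈ off p₀ L, ρ v + (if u ∈ L then 1 else 0) * ρ u = ∑ v ∈ L, ρ v := by
  rw [← Finset.sum_filter_add_sum_filter_not L fun v => v.1 ≠ p₀.1, off]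
  congr 1
  have : (L.filter fun v => ¬ v.1 ≠ p₀.1) = if u ∈ L then {u} else ∅ := by
    ext v
    simp only [Finset.mem_filter, not_not]
    have huniq : v ∈ L → v.1 = p₀.1 → v = u := fun h h' => hx v (hL h) u hu (h'.trans hup.symm)
    split_ifs with h
    · rw [Finset.mem_singleton]
      exact ⟨fun h => huniq h.1 h.2, fun h' => h' ▸ ⟨h, hup⟩⟩
    · simp only [Finset.notMem_empty, iff_false, not_and]
      exact fun h1 h2 => h (huniq h1 h2 ▸ h1)
  rw [this]
  split_ifs <;> simp

/-- A nonempty initial segment contains a lowest point. -/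
theorem Near.mem_of_below (hN : Near X p₀ p) (hx : ∀ v ∈ X, ∀ w ∈ X, v.1 = w.1 → v = w)
    (hL : IsPrefix (key p) (side σ X p) L) (hne : L.Nonempty) (hu : u ∈ side σ X p)
    (hup : u.1 = p₀.1) (hlow : u.2 < p₀.2) : u ∈ L := by
  by_contra h
  obtain ⟨v, hv⟩ := hne
  have hvX := side_subset (hL.1 hv)
  have := hL.2 v hv u hu h
  have hvp : v.1 ≠ p₀.1 := fun h' => h (hx v hvX u (side_subset hu) (h'.trans hup.symm) ▸ hv)
  linarith [hN.below u (side_subset hu) v hvX hup hlow (fst_ne_of_mem_side hu) hvp]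

/-- An initial segment containing a highest point is everything. -/
theorem Near.eq_of_above (hN : Near X p₀ p) (hx : ∀ v ∈ X, ∀ w ∈ X, v.1 = w.1 → v = w)
    (hL : IsPrefix (key p) (side σ X p) L) (hu : u ∈ L)
    (hup : u.1 = p₀.1) (hhigh : p₀.2 < u.2) : L = side σ X p := by
  refine hL.1.antisymm fun v hv => ?_
  by_contra h
  have huX := side_subset (hL.1 hu)
  have := hL.2 u hu v hv h
  have hvp : v.1 ≠ p₀.1 := fun h' => h (hx v (side_subset hv) u huX (h'.trans hup.symm) ▸ hu)
  linarith [hN.above u huX v (side_subset hv) hup hhigh (fst_ne_of_mem_side (hL.1 hu)) hvp]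

end Key

section Fit

variable {α : Type*} {f : α → ℝ} {Y Z P O L R : Finset α} {ρ β : α → ℕ} {k m k' m' : ℕ}

/-- `L` is an initial segment of first weight `k` and second weight at least `m`. -/
def IsFit (f : α → ℝ) (Y : Finset α) (ρ β : α → ℕ) (k m : ℕ) (L : Finset α) : Prop :=
  IsPrefix f Y L ∧ ∑ v ∈ L, ρ v = k ∧ m ≤ ∑ v ∈ L, β v

/-- A segment with an excess of second weight ends with an element of first weight one. -/
def IsTight (f : α → ℝ) (ρ β : α → ℕ) (m : ℕ) (L : Finset α) : Prop :=
  m < ∑ v ∈ L, β v → ∃ d ∈ L, ρ d = 1 ∧ ∀ v ∈ L, f v ≤ f d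

/-- Complements of `L` and `R` seen from an apex span a convex angle. -/
def IsConvexPair (f : α → ℝ) (Y Z L R : Finset α) : Prop :=
  ∀ v ∈ Y, v ∉ L → ∀ w ∈ Z, w ∉ R → 0 ≤ f v + f w

theorem IsConvexPair.symm (h : IsConvexPair f Y Z L R) : IsConvexPair f Z Y R L :=
  fun v hv hv' w hw hw' => add_comm (f w) (f v) ▸ h w hw hw' v hv hv'

theorem IsConvexPair.exists_levels (h : IsConvexPair f Y Z P O) (hP : IsPrefix f Y P)
    (hO : IsPrefix f Z O) : ∃ a b, IsLevel f Y P a ∧ IsLevel f Z O b ∧ 0 ≤ a + b := by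
  classical
  obtain ⟨b, hb⟩ := hO.exists_isLevel
  obtain ⟨a, ha⟩ := hP.exists_isLevel
  have high : ∀ Y : Finset α, ∃ c, ∀ v ∈ Y, f v ≤ c := fun Y =>
    (exists_between_images Y ∅ f f (by simp)).imp fun _ h => h.1
  by_cases hYP : ∃ v ∈ Y, v ∉ P ∧ ∀ w ∈ Y, w ∉ P → f v ≤ f w
  · obtain ⟨v, hv, hv', hmin⟩ := hYP
    have hv1 : IsLevel f Y P (f v) := ⟨hP.1, fun w hw => hP.2 w hw v hv hv', hmin⟩
    by_cases hZO : ∃ v ∈ Z, v ∉ O ∧ ∀ w ∈ Z, w ∉ O → f v ≤ f w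
    · obtain ⟨w, hw, hw', hmin'⟩ := hZO
      exact ⟨_, _, hv1, ⟨hO.1, fun u hu => hO.2 u hu w hw hw', hmin'⟩, h v hv hv' w hw hw'⟩
    · have hall : ∀ w ∈ Z, w ∈ O := by
        by_contra! hne
        obtain ⟨w, hw, hw'⟩ := hne
        obtain ⟨u, hu, hu'⟩ := Finset.exists_min_image (Z \ O) f ⟨w, by simp [hw, hw']⟩
        rw [Finset.mem_sdiff] at hu
        exact hZO ⟨u, hu.1, hu.2, fun t ht ht' => hu' t (by simp [ht, ht'])⟩
      obtain ⟨c, hc⟩ := high O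
      exact ⟨_, max c (-f v), hv1, ⟨hO.1, fun w hw => (hc w hw).trans (le_max_left _ _),
        fun w hw hw' => absurd (hall w hw) hw'⟩, by linarith [le_max_right c (-f v)]⟩
  · have hall : ∀ w ∈ Y, w ∈ P := by
      by_contra! hne
      obtain ⟨w, hw, hw'⟩ := hne
      obtain ⟨u, hu, hu'⟩ := Finset.exists_min_image (Y \ P) f ⟨w, by simp [hw, hw']⟩
      rw [Finset.mem_sdiff] at hu
      exact hYP ⟨u, hu.1, hu.2, fun t ht ht' => hu' t (by simp [ht, ht'])⟩
    obtain ⟨c, hc⟩ := high P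
    exact ⟨max c (-b), b, ⟨hP.1, fun w hw => (hc w hw).trans (le_max_left _ _),
      fun w hw hw' => absurd (hall w hw) hw'⟩, hb, by linarith [le_max_right c (-b)]⟩

theorem exists_levels_of_nonpos (h : ∀ v ∈ P, ∀ w ∈ O, f v + f w ≤ 0) (hP : IsPrefix f Y P)
    (hO : IsPrefix f Z O) : ∃ a b, IsLevel f Y P a ∧ IsLevel f Z O b ∧ a + b ≤ 0 := by
  have low : ∀ Y : Finset α, ∃ c, ∀ v ∈ Y, c ≤ f v := fun Y =>
    (exists_between_images ∅ Y f f (by simp)).imp fun _ h => h.2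
  obtain ⟨a, ha⟩ := hP.exists_isLevel
  obtain ⟨b, hb⟩ := hO.exists_isLevel
  rcases P.eq_empty_or_nonempty with rfl | hne
  · obtain ⟨c, hc⟩ := low Y
    exact ⟨min c (-b), b, ⟨hP.1, by simp, fun w hw _ => (min_le_left _ _).trans (hc w hw)⟩, hb,
      by linarith [min_le_right c (-b)]⟩
  · obtain ⟨v, hv, hmax⟩ := Finset.exists_max_image P f hne
    have hv1 : IsLevel f Y P (f v) := ⟨hP.1, hmax, hP.2 v hv⟩
    rcases O.eq_empty_or_nonempty with rfl | hne'
    · obtain ⟨c, hc⟩ := low Z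
      exact ⟨_, min c (-f v), hv1, ⟨hO.1, by simp, fun w hw _ => (min_le_left _ _).trans (hc w hw)⟩,
        by linarith [min_le_right c (-f v)]⟩
    · obtain ⟨w, hw, hmax'⟩ := Finset.exists_max_image O f hne'
      exact ⟨_, _, hv1, ⟨hO.1, hmax', hO.2 w hw⟩, h v hv w hw⟩

variable [DecidableEq α]

/-- Dropping the last element of a segment which is not tight. -/
theorem IsFit.exists_erase (hρ : ∀ v, ρ v ≤ 1) (hβ : ∀ v, β v ≤ 1) (h : IsFit f Y ρ β k m L)
    (ht : ¬ IsTight f ρ β m L) :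
    ∃ d ∈ L, (∀ v ∈ L, f v ≤ f d) ∧ IsFit f Y ρ β k m (L.erase d) := by
  unfold IsTight at ht
  push Not at ht
  obtain ⟨hlt, hno⟩ := ht
  have hne : L.Nonempty := by
    by_contra h
    rw [Finset.not_nonempty_iff_eq_empty] at h
    simp [h] at hlt
  obtain ⟨d, hd, hmax⟩ := Finset.exists_max_image L f hne
  have hρd : ρ d ≠ 1 := fun h => by
    obtain ⟨v, hv, hv'⟩ := hno d hd h
    exact absurd (hmax v hv) (not_le.2 hv')
  have h1 := Finset.sum_erase_add L ρ hd
  have h2 := Finset.sum_erase_add L β hd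
  have h3 := hρ d
  have h4 := hβ d
  have h5 := h.2.1
  exact ⟨d, hd, hmax, h.1.erase_max hmax, by omega, by omega⟩

theorem IsFit.exists_isTight (hρ : ∀ v, ρ v ≤ 1) (hβ : ∀ v, β v ≤ 1) (h : IsFit f Y ρ β k m L) :
    ∃ L, IsFit f Y ρ β k m L ∧ IsTight f ρ β m L := by
  induction hn : L.card generalizing L with
  | zero =>
    rw [Finset.card_eq_zero] at hn
    subst hn
    exact ⟨∅, h, fun h => by simp at h⟩
  | succ n ih =>
    by_cases ht : IsTight f ρ β m L
    · exact ⟨L, h, ht⟩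
    · obtain ⟨d, hd, -, h'⟩ := h.exists_erase hρ hβ ht
      exact ih h' (by rw [Finset.card_erase_of_mem hd, hn]; rfl)

theorem IsConvexPair.erase (hA : AlignedBound f Y Z ρ β (k + k') (m + m') 0 0)
    (hL : IsFit f Y ρ β k m L) (hR : IsFit f Z ρ β k' m' R) (h : IsConvexPair f Y Z L R) {d : α}
    (hmax : ∀ v ∈ L, f v ≤ f d) : IsConvexPair f Y Z (L.erase d) R := by
  intro v hv hv' w hw hw'
  by_cases hvL : v ∈ L
  · obtain rfl : v = d := by
      by_contra hne
      exact hv' (Finset.mem_erase.2 ⟨hne, hvL⟩)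
    obtain ⟨u, hu, hmin⟩ := Finset.exists_min_image (Z \ R) f ⟨w, by simp [hw, hw']⟩
    rw [Finset.mem_sdiff] at hu
    by_contra! hneg
    have huw := hmin w (by simp [hw, hw'])
    have := hA (-f u) L R ⟨hL.1.1, fun x hx => by linarith [hmax x hx], fun x hx hx' => by
        linarith [h x hx hx' u hu.1 hu.2]⟩
      ⟨hR.1.1, fun x hx => by linarith [hR.1.2 x hx u hu.1 hu.2], fun x hx hx' => by
        linarith [hmin x (by simp [hx, hx'])]⟩ (by rw [hL.2.1, hR.2.1]; rfl)
    have h1 := hL.2.2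
    have h2 := hR.2.2
    omega
  · exact h v hv hvL w hw hw'

theorem IsConvexPair.exists_isTight (hρ : ∀ v, ρ v ≤ 1) (hβ : ∀ v, β v ≤ 1)
    (hA : AlignedBound f Y Z ρ β (k + k') (m + m') 0 0)
    (hL : IsFit f Y ρ β k m L) (hR : IsFit f Z ρ β k' m' R) (h : IsConvexPair f Y Z L R) :
    ∃ L R, IsFit f Y ρ β k m L ∧ IsFit f Z ρ β k' m' R ∧ IsConvexPair f Y Z L R ∧
      IsTight f ρ β m L ∧ IsTight f ρ β m' R := by
  induction hn : L.card + R.card using Nat.strong_induction_on generalizing L R with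
  | _ n ih =>
    by_cases htL : IsTight f ρ β m L
    · by_cases htR : IsTight f ρ β m' R
      · exact ⟨L, R, hL, hR, h, htL, htR⟩
      · obtain ⟨d, hd, hmax, h'⟩ := hR.exists_erase hρ hβ htR
        have hA' : AlignedBound f Z Y ρ β (k' + k) (m' + m) 0 0 := by
          rw [add_comm k', add_comm m']
          exact hA.symm
        have hc := (IsConvexPair.erase hA' hR hL h.symm hmax).symm
        have := Finset.card_erase_lt_of_mem hd
        exact ih _ (by omega) hL h' hc rfl
    · obtain ⟨d, hd, hmax, h'⟩ := hL.exists_erase hρ hβ htL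
      have hc := IsConvexPair.erase hA hL hR h hmax
      have := Finset.card_erase_lt_of_mem hd
      exact ih _ (by omega) h' hR hc rfl

end Fit

/-- `L` has first weight `k`, second weight less than `m`, and is followed by `z`, of first
weight one. -/
structure IsDeficient {α : Type*} [DecidableEq α] (f : α → ℝ) (Y : Finset α) (ρ β : α → ℕ)
    (k m : ℕ) (L : Finset α) (z : α) : Prop where
  isPrefix : IsPrefix f Y L
  isPrefix_insert : IsPrefix f Y (insert z L)
  notMem : z ∉ L
  weight : ρ z = 1
  sum_eq : ∑ v ∈ L, ρ v = k
  sum_lt : ∑ v ∈ L, β v < m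

section Local

variable {X L R L₁ L₂ L₃ L₄ R₃ R₄ : Finset (ℝ × ℝ)} {p p₀ p₁ p₂ p₃ p₄ u v w z z₁ z₂ d : ℝ × ℝ}
  {σ : ℝ} {ρ β : ℝ × ℝ → ℕ} {k m k' m' : ℕ}

theorem Near.le_off (hN : Near X p₀ p) (hL : L ⊆ X) (hd : d ∈ off p₀ L)
    (hmax : ∀ v ∈ L, key p v ≤ key p d) : ∀ v ∈ off p₀ L, key p₀ v ≤ key p₀ d := by
  intro v hv
  rw [mem_off] at hv hd
  by_contra! h
  exact absurd (hN.key_lt d (hL hd.1) v (hL hv.1) hd.2 hv.2 h) (not_lt.2 (hmax v hv.1))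

theorem IsDeficient.insert_off (h : IsDeficient (key p) (side σ X p) ρ β k m L z)
    (hN : Near X p₀ p) (hσ : σ = 1 ∨ σ = -1) (hz : z.1 ≠ p₀.1) :
    IsPrefix (key p₀) (side σ X p₀) (insert z (off p₀ L)) := by
  have := hN.isPrefix_off hσ h.isPrefix_insert
  rwa [off, Finset.filter_insert, if_pos hz] at this

theorem Near.sum_side_of_above (hN : Near X p₀ p) (hσ : σ = 1 ∨ σ = -1)
    (hx : ∀ v ∈ X, ∀ w ∈ X, v.1 = w.1 → v = w) (hL : IsPrefix (key p) (side σ X p) L) (hu : u ∈ L)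
    (hup : u.1 = p₀.1) (hhigh : p₀.2 < u.2) (ρ : ℝ × ℝ → ℕ) :
    ∑ v ∈ L, ρ v = ∑ v ∈ side σ X p₀, ρ v + ρ u := by
  have h1 := hN.eq_of_above hx hL hu hup hhigh
  rw [← sum_off hx (hL.1.trans side_subset) (side_subset (hL.1 hu)) hup ρ, if_pos hu, one_mul,
    ← hN.off_side hσ, h1]

theorem IsFit.fst_ne (h : IsFit (key p) (side σ X p) ρ β k m L) (ht : IsTight (key p) ρ β m L)
    (hN : Near X p₀ p) (hσ : σ = 1 ∨ σ = -1) (hx : ∀ v ∈ X, ∀ w ∈ X, v.1 = w.1 → v = w)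
    (hfree : ∀ u ∈ X, u.1 = p₀.1 → p₀.2 < u.2)
    (hpos : ∀ S, Sep X S → ∑ v ∈ S, ρ v = k → m < ∑ v ∈ S, β v)
    (hk : k ≤ ∑ v ∈ side σ X p₀, ρ v) : ∀ u ∈ L, u.1 ≠ p₀.1 := by
  intro u hu hup
  have huX := side_subset (h.1.1 hu)
  have hs := hN.sum_side_of_above hσ hx h.1 hu hup (hfree u huX hup)
  have h1 := hs ρ
  have h2 := h.2.1
  have h3 := hpos (side σ X p₀) (sep_side (by rcases hσ with rfl | rfl <;> norm_num)) (by omega)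
  have h4 := hs β
  obtain ⟨d, hd, hρd, hmax⟩ := ht (by omega)
  have hdX := side_subset (h.1.1 hd)
  have hdp : d.1 ≠ p₀.1 := fun h' => by
    obtain rfl := hx d hdX u huX (h'.trans hup.symm)
    omega
  exact absurd (hmax u hu) (not_le.2 (hN.above u huX d hdX hup (hfree u huX hup)
    (fst_ne_of_mem_side (h.1.1 hu)) hdp))

theorem IsDeficient.fst_ne (h : IsDeficient (key p) (side σ X p) ρ β k m L z)
    (hN : Near X p₀ p) (hσ : σ = 1 ∨ σ = -1) (hx : ∀ v ∈ X, ∀ w ∈ X, v.1 = w.1 → v = w)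
    (hfree : ∀ u ∈ X, u.1 = p₀.1 → p₀.2 < u.2)
    (hpos : ∀ S, Sep X S → ∑ v ∈ S, ρ v = k → m < ∑ v ∈ S, β v) :
    ∀ u ∈ insert z L, u.1 ≠ p₀.1 := by
  have hσ0 : σ ≠ 0 := by rcases hσ with rfl | rfl <;> norm_num
  have hlt := h.sum_lt
  have hL : ∀ u ∈ L, u.1 ≠ p₀.1 := by
    intro u hu hup
    have huX := side_subset (h.isPrefix.1 hu)
    have h1 := hN.eq_of_above hx h.isPrefix hu hup (hfree u huX hup)
    have := hpos L (h1 ▸ sep_side hσ0) h.sum_eq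
    omega
  intro u hu
  rcases Finset.mem_insert.1 hu with rfl | hu
  · intro hup
    have huX := side_subset (h.isPrefix_insert.1 hu)
    have hs := hN.sum_side_of_above hσ hx h.isPrefix_insert hu hup (hfree u huX hup)
    have h1 := hs ρ
    have h2 := hs β
    rw [Finset.sum_insert h.notMem] at h1 h2
    have := h.sum_eq
    have := hpos _ (sep_side (p := p₀) hσ0) (by omega)
    omega
  · exact hL u hu

theorem not_hasTie_key (hX : GenPos X) (hσ : σ = 1 ∨ σ = -1) (hp : p ∈ X) :
    ¬ HasTie (key p) (side σ X p) := by
  rintro ⟨v, hv, w, hw, hvw, h⟩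
  exact hX p hp v (side_subset hv) w (side_subset hw)
    (fun h => fst_ne_of_mem_side hv (by rw [h])) (fun h => fst_ne_of_mem_side hw (by rw [h])) hvw
    (cross_eq_zero_of_key_eq hσ hv hw h)

theorem nonempty_of_sum_pos (hk : 0 < k) (h : ∑ v ∈ L, ρ v = k) : L.Nonempty := by
  by_contra h'
  rw [Finset.not_nonempty_iff_eq_empty] at h'
  simp only [h', Finset.sum_empty] at h
  omega

/-- On a side of the limit point, the fit is exact if deficient segments accumulate there. -/
theorem IsFit.sum_eq_of_deficient (hσ : σ = 1 ∨ σ = -1) (hρ : ∀ v, ρ v ≤ 1) (hβ : ∀ v, β v ≤ 1)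
    (hX : GenPos X) (hx : ∀ v ∈ X, ∀ w ∈ X, v.1 = w.1 → v = w)
    (hG : ∀ u ∈ X, u.1 = p₀.1 → u.2 < p₀.2 →
      ¬ (HasTie (key p₀) (side σ X p₀) ∧ HasTie (key p₀) (side (-σ) X p₀)))
    (hpos : ∀ S, Sep X S → ∑ v ∈ S, ρ v = k → m < ∑ v ∈ S, β v)
    (hk : k ≤ ∑ v ∈ side σ X p₀, ρ v) (hk0 : 0 < k) (hk0' : 0 < k')
    (hN₃ : Near X p₀ p₃) (hN₁ : Near X p₀ p₁) (hN₂ : Near X p₀ p₂)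
    (hp₃ : ∀ v ∈ X, v.1 ≠ p₃.1)
    (hL₃ : IsFit (key p₃) (side σ X p₃) ρ β k m L₃) (ht : IsTight (key p₃) ρ β m L₃)
    (hR₃ : IsFit (key p₃) (side (-σ) X p₃) ρ β k' m' R₃)
    (hL₁ : IsDeficient (key p₁) (side σ X p₁) ρ β k m L₁ z₁)
    (hL₂ : IsDeficient (key p₂) (side (-σ) X p₂) ρ β k' m' L₂ z₂) :
    ∑ v ∈ L₃, β v = m := by
  have hσ' : -σ = 1 ∨ -σ = -1 := by rcases hσ with rfl | rfl <;> norm_num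
  by_contra hne
  have hexc : m < ∑ v ∈ L₃, β v := lt_of_le_of_ne hL₃.2.2 (Ne.symm hne)
  have hP₃ := hN₃.isPrefix_off hσ hL₃.1
  have hP₁ := hN₁.isPrefix_off hσ hL₁.isPrefix
  have hlast : (∀ d ∈ L₃, ρ d = 1 → d ∈ off p₀ L₃) →
      ∃ d ∈ off p₀ L₃, ρ d = 1 ∧ IsPrefix (key p₀) (side σ X p₀) ((off p₀ L₃).erase d) := by
    intro hoff
    obtain ⟨d, hd, hρd, hmax⟩ := ht hexc
    have hd' := hoff d hd hρd
    exact ⟨d, hd', hρd, hP₃.erase_max (hN₃.le_off (hL₃.1.1.trans side_subset) hd' hmax)⟩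
  by_cases hfree : ∀ u ∈ X, u.1 = p₀.1 → p₀.2 < u.2
  · have hne₃ := hL₃.fst_ne ht hN₃ hσ hx hfree hpos hk
    have hne₁ := hL₁.fst_ne hN₁ hσ hx hfree hpos
    have ho₃ := off_eq_self hne₃
    have ho₁ := off_eq_self fun v hv => hne₁ v (Finset.mem_insert_of_mem hv)
    have hz := hL₁.insert_off hN₁ hσ (hne₁ _ (Finset.mem_insert_self _ _))
    have hl := hlast fun d hd _ => ho₃.symm ▸ hd
    rw [ho₃] at hP₃ hl
    rw [ho₁] at hP₁ hz
    rcases hasTie_and_of_excess (e₁ := 0) (e₃ := 0) (ru := 0) (bu := 0) (noTriple_key hX hσ) hρ hβ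
      hP₃ hP₁ hz hL₁.notMem hL₁.weight (by omega) (by omega) (by omega) (by omega) hL₃.2.1
      hexc hL₁.sum_eq hL₁.sum_lt (fun _ => hl) with ⟨-, h | h⟩ <;> omega
  push Not at hfree
  obtain ⟨u, huX, hup, hu2⟩ := hfree
  have hsum := fun (L : Finset (ℝ × ℝ)) (hL : L ⊆ X) => sum_off hx hL huX hup
  have hl : (if u ∈ L₃ then 1 else 0) = 0 →
      ∃ d ∈ off p₀ L₃, ρ d = 1 ∧ IsPrefix (key p₀) (side σ X p₀) ((off p₀ L₃).erase d) := by
    intro h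
    refine hlast fun d hd _ => mem_off.2 ⟨hd, fun hdp => ?_⟩
    rw [hx d (side_subset (hL₃.1.1 hd)) u huX (hdp.trans hup.symm)] at hd
    simp [hd] at h
  have ite_le : ∀ L : Finset (ℝ × ℝ), (if u ∈ L then 1 else 0) ≤ 1 := fun L => by
    split_ifs <;> omega
  have hX₃ := hL₃.1.1.trans side_subset
  have hX₁ := hL₁.isPrefix.1.trans side_subset
  have hzX₁ := side_subset (hL₁.isPrefix_insert.1 (Finset.mem_insert_self _ _))
  have r₃ := (hsum L₃ hX₃ ρ).trans hL₃.2.1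
  have b₃ := hexc.trans_eq (hsum L₃ hX₃ β).symm
  have r₁ := (hsum L₁ hX₁ ρ).trans hL₁.sum_eq
  have b₁ := (hsum L₁ hX₁ β).trans_lt hL₁.sum_lt
  have main : z₁ ≠ u → HasTie (key p₀) (side σ X p₀) ∧ _ := fun hzu =>
    hasTie_and_of_excess (noTriple_key hX hσ) hρ hβ hP₃ hP₁
      (hL₁.insert_off hN₁ hσ fun h => hzu (hx _ hzX₁ _ huX (h.trans hup.symm)))
      (fun h => hL₁.notMem (off_subset h)) hL₁.weight (ite_le _) (ite_le _) (hρ u) (hβ u) r₃ b₃ r₁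
      b₁ hl
  rcases hu2.lt_or_eq with hlow | heq
  · have hmem : ∀ (σ : ℝ) (p : ℝ × ℝ) (L : Finset (ℝ × ℝ)) (k : ℕ), 0 < k → Near X p₀ p →
        IsPrefix (key p) (side σ X p) L → ∑ v ∈ L, ρ v = k → u ∈ side σ X p → u ∈ L :=
      fun σ p L k hk hN hL hr hu =>
        hN.mem_of_below hx hL (nonempty_of_sum_pos hk hr) hu hup hlow
    have hzne : ∀ (σ : ℝ) (p : ℝ × ℝ) (L : Finset (ℝ × ℝ)) (k m : ℕ) (z : ℝ × ℝ), 0 < k →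
        Near X p₀ p → IsDeficient (key p) (side σ X p) ρ β k m L z → z ≠ u := by
      rintro σ p L k m z hk hN h rfl
      exact h.notMem (hmem σ p L k hk hN h.isPrefix h.sum_eq
        (h.isPrefix_insert.1 (Finset.mem_insert_self _ _)))
    obtain ⟨htie, hmain⟩ := main (hzne _ _ _ _ _ _ hk0 hN₁ hL₁)
    have hnt : ¬ HasTie (key p₀) (side (-σ) X p₀) := fun h => hG u huX hup hlow ⟨htie, h⟩
    have hzu₂ := hzne _ _ _ _ _ _ hk0' hN₂ hL₂
    have hzX₂ := side_subset (hL₂.isPrefix_insert.1 (Finset.mem_insert_self _ _))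
    have hXR := hR₃.1.1.trans side_subset
    have hX₂ := hL₂.isPrefix.1.trans side_subset
    have hother := hasTie_or_of_valid (noTriple_key hX hσ') (hN₃.isPrefix_off hσ' hR₃.1)
      (hN₂.isPrefix_off hσ' hL₂.isPrefix)
      (hL₂.insert_off hN₂ hσ' fun h => hzu₂ (hx _ hzX₂ _ huX (h.trans hup.symm)))
      (fun h => hL₂.notMem (off_subset h)) hL₂.weight (ite_le L₂) (ite_le R₃) (hρ u) (hβ u)
      ((hsum R₃ hXR ρ).trans hR₃.2.1) (hR₃.2.2.trans_eq (hsum R₃ hXR β).symm)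
      ((hsum L₂ hX₂ ρ).trans hL₂.sum_eq) ((hsum L₂ hX₂ β).trans_lt hL₂.sum_lt)
    have hex : u ∈ L₃ → u ∉ R₃ := fun h h' => by
      have h1 := (mem_side.1 (hL₃.1.1 h)).2
      have h2 := (mem_side.1 (hR₃.1.1 h')).2
      linarith
    have hor : u ∈ L₃ ∨ u ∈ R₃ := by
      have hne := hp₃ u huX
      rcases lt_or_gt_of_ne (a := σ * u.1) (b := σ * p₃.1)
        (by rcases hσ with rfl | rfl <;> simpa using hne) with h | h
      · exact Or.inl (hmem σ p₃ L₃ k hk0 hN₃ hL₃.1 hL₃.2.1 (mem_side.2 ⟨huX, h⟩))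
      · exact Or.inr (hmem (-σ) p₃ R₃ k' hk0' hN₃ hR₃.1 hR₃.2.1
          (mem_side.2 ⟨huX, by linarith⟩))
    rcases hother with h | h | h
    · exact hnt h
    · have : u ∈ R₃ := by
        by_contra hn
        simp [hn] at h
      have h3 : u ∉ L₃ := fun h' => hex h' this
      simp only [h3, if_false] at hmain
      omega
    · have : u ∉ R₃ := by
        intro hn
        simp [hn] at h
      have h3 := hor.resolve_right this
      simp only [h3, if_true] at hmain
      omega
  · obtain rfl : u = p₀ := Prod.ext hup heq
    have hnt := not_hasTie_key hX hσ huX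
    by_cases hzu : z₁ = u
    · subst hzu
      rw [if_neg hL₁.notMem] at r₁ b₁
      rw [hL₁.weight, mul_one] at r₃
      exact not_excess_of_next hnt hβ hP₃ hP₁ (ite_le L₃) (hβ z₁) r₃ b₃ (by simpa using r₁)
        (by simpa using b₁) hl
    · exact hnt (main hzu).1

end Local

section Local

variable {X L R L₃ L₄ R₃ R₄ : Finset (ℝ × ℝ)} {p p₀ p₃ p₄ u v w d : ℝ × ℝ}
  {σ : ℝ} {ρ β : ℝ × ℝ → ℕ} {k m k' m' : ℕ}

theorem Near.isConvexPair_off (hN : Near X p₀ p)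
    (h : IsConvexPair (key p) (side 1 X p) (side (-1) X p) L R) :
    IsConvexPair (key p₀) (side 1 X p₀) (side (-1) X p₀) (off p₀ L) (off p₀ R) := by
  intro v hv hv' w hw hw'
  by_contra! hneg
  have h1 := fst_ne_of_mem_side hv
  have h2 := fst_ne_of_mem_side hw
  exact absurd (h v (hN.side_subset_side (Or.inl rfl) hv) (fun h => hv' (mem_off.2 ⟨h, h1⟩)) w
    (hN.side_subset_side (Or.inr rfl) hw) fun h => hw' (mem_off.2 ⟨h, h2⟩))
    (not_le.2 (hN.sum_neg v (side_subset hv) w (side_subset hw) h1 h2 hneg))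

theorem Near.nonpos_off (hN : Near X p₀ p) (hL : L ⊆ X) (hR : R ⊆ X)
    (h : ∀ v ∈ L, ∀ w ∈ R, key p v + key p w ≤ 0) :
    ∀ v ∈ off p₀ L, ∀ w ∈ off p₀ R, key p₀ v + key p₀ w ≤ 0 := by
  intro v hv w hw
  rw [mem_off] at hv hw
  by_contra! hpos
  exact absurd (h v hv.1 w hw.1)
    (not_le.2 (hN.sum_pos v (hL hv.1) w (hR hw.1) hv.2 hw.2 hpos))

theorem IsTight.off (ht : IsTight (key p) ρ β m L) (hN : Near X p₀ p) (hL : L ⊆ X)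
    (hu : ∀ v ∈ L, ρ v = 1 → v.1 ≠ p₀.1) (h : m < ∑ v ∈ L, β v) :
    ∃ d ∈ off p₀ L, ρ d = 1 ∧ ∀ v ∈ off p₀ L, key p₀ v ≤ key p₀ d := by
  obtain ⟨d, hd, hρd, hmax⟩ := ht h
  have hd' := mem_off.2 ⟨hd, hu d hd hρd⟩
  exact ⟨d, hd', hρd, hN.le_off hL hd' hmax⟩

/-- Fits bounding a convex angle are exact if fits bounding a reflex angle accumulate at the same
point. -/
theorem IsFit.sum_eq_of_convex_of_reflex (hρ : ∀ v, ρ v ≤ 1) (hβ : ∀ v, β v ≤ 1)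
    (hx : ∀ v ∈ X, ∀ w ∈ X, v.1 = w.1 → v = w)
    (hlev : ∀ S, Sep X S → ∑ v ∈ S, ρ v = k + k' → ∑ v ∈ S, β v < m + m')
    (hposL : ∀ S, Sep X S → ∑ v ∈ S, ρ v = k → m < ∑ v ∈ S, β v)
    (hposR : ∀ S, Sep X S → ∑ v ∈ S, ρ v = k' → m' < ∑ v ∈ S, β v)
    (hk : k ≤ ∑ v ∈ side 1 X p₀, ρ v) (hk' : k' ≤ ∑ v ∈ side (-1) X p₀, ρ v)
    (hk0 : 0 < k) (hk0' : 0 < k')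
    (hN₃ : Near X p₀ p₃) (hN₄ : Near X p₀ p₄)
    (hp₃ : ∀ v ∈ X, v.1 ≠ p₃.1) (hp₄ : ∀ v ∈ X, v.1 ≠ p₄.1)
    (hL₃ : IsFit (key p₃) (side 1 X p₃) ρ β k m L₃) (tL₃ : IsTight (key p₃) ρ β m L₃)
    (hR₃ : IsFit (key p₃) (side (-1) X p₃) ρ β k' m' R₃) (tR₃ : IsTight (key p₃) ρ β m' R₃)
    (hc₃ : IsConvexPair (key p₃) (side 1 X p₃) (side (-1) X p₃) L₃ R₃)
    (hL₄ : IsFit (key p₄) (side 1 X p₄) ρ β k m L₄) (tL₄ : IsTight (key p₄) ρ β m L₄)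
    (hR₄ : IsFit (key p₄) (side (-1) X p₄) ρ β k' m' R₄) (tR₄ : IsTight (key p₄) ρ β m' R₄)
    (hc₄ : ∀ v ∈ L₄, ∀ w ∈ R₄, key p₄ v + key p₄ w ≤ 0) :
    ∑ v ∈ L₃, β v = m ∧ ∑ v ∈ R₃, β v = m' := by
  have hl : (1 : ℝ) = 1 ∨ (1 : ℝ) = -1 := Or.inl rfl
  have hr : (-1 : ℝ) = 1 ∨ (-1 : ℝ) = -1 := Or.inr rfl
  have sL₃ := hL₃.1.1.trans side_subset
  have sR₃ := hR₃.1.1.trans side_subset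
  have sL₄ := hL₄.1.1.trans side_subset
  have sR₄ := hR₄.1.1.trans side_subset
  obtain ⟨a₃, b₃, la₃, lb₃, h₃⟩ := (hN₃.isConvexPair_off hc₃).exists_levels
    (hN₃.isPrefix_off hl hL₃.1) (hN₃.isPrefix_off hr hR₃.1)
  obtain ⟨a₄, b₄, la₄, lb₄, h₄⟩ := exists_levels_of_nonpos (hN₄.nonpos_off sL₄ sR₄ hc₄)
    (hN₄.isPrefix_off hl hL₄.1) (hN₄.isPrefix_off hr hR₄.1)
  by_cases hfree : ∀ u ∈ X, u.1 = p₀.1 → p₀.2 < u.2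
  · have nL₃ := hL₃.fst_ne tL₃ hN₃ hl hx hfree hposL hk
    have nR₃ := hR₃.fst_ne tR₃ hN₃ hr hx hfree hposR hk'
    have nL₄ := hL₄.fst_ne tL₄ hN₄ hl hx hfree hposL hk
    have nR₄ := hR₄.fst_ne tR₄ hN₄ hr hx hfree hposR hk'
    have h0 : AlignedBound (key p₀) (side 1 X p₀) (side (-1) X p₀) ρ β (k + k') (m + m') 0 0 :=
      alignedBound_key hlev (E := ∅) (Finset.empty_subset _) (by simp)
        fun v hv hv' _ => (hfree v hv hv').le
    have := h0.exact (e₃ := 0) (δ₃ := 0) (e₄ := 0) (δ₄ := 0) (by simp) (by simp) (by simp)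
      (by simp) (Or.inl h0) la₃ lb₃ h₃ la₄ lb₄ h₄
    simp only [off_eq_self nL₃, off_eq_self nR₃, off_eq_self nL₄, off_eq_self nR₄, mul_zero,
      add_zero, forall_const] at this
    refine this hL₃.2.1 hR₃.2.1 hL₄.2.1 hR₄.2.1 hL₃.2.2 hR₃.2.2 hL₄.2.2 hR₄.2.2 ?_ ?_
    · simpa only [off_eq_self nL₃] using tL₃.off hN₃ sL₃ fun v hv _ => nL₃ v hv
    · simpa only [off_eq_self nR₃] using tR₃.off hN₃ sR₃ fun v hv _ => nR₃ v hv
  push Not at hfree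
  obtain ⟨u, huX, hup, hu2⟩ := hfree
  have hsum := fun (L : Finset (ℝ × ℝ)) (hL : L ⊆ X) => sum_off hx hL huX hup
  have hex : ∀ (p : ℝ × ℝ) (L R : Finset (ℝ × ℝ)), L ⊆ side 1 X p → R ⊆ side (-1) X p →
      (if u ∈ L then 1 else 0) + (if u ∈ R then 1 else 0) ≤ 1 := by
    intro p L R hL hR
    split_ifs with h h' <;> try omega
    have h1 := (mem_side.1 (hL h)).2
    have h2 := (mem_side.1 (hR h')).2
    linarith
  have hone : u.2 < p₀.2 → ∀ (p : ℝ × ℝ) (L R : Finset (ℝ × ℝ)), Near X p₀ p →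
      (∀ v ∈ X, v.1 ≠ p.1) → IsFit (key p) (side 1 X p) ρ β k m L →
      IsFit (key p) (side (-1) X p) ρ β k' m' R →
      (if u ∈ L then 1 else 0) + (if u ∈ R then 1 else 0) = 1 := by
    intro hlow p L R hN hp hL hR
    refine le_antisymm (hex p L R hL.1.1 hR.1.1) ?_
    rcases lt_or_gt_of_ne (hp u huX) with h | h
    · have : u ∈ L := hN.mem_of_below hx hL.1 (nonempty_of_sum_pos hk0 hL.2.1)
        (mem_side.2 ⟨huX, by linarith⟩) hup hlow
      simp [this]
    · have : u ∈ R := hN.mem_of_below hx hR.1 (nonempty_of_sum_pos hk0' hR.2.1)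
        (mem_side.2 ⟨huX, by linarith⟩) hup hlow
      simp [this]
  have huE : ∀ v ∈ ({u} : Finset (ℝ × ℝ)), v.1 = p₀.1 ∧ v.2 ≤ p₀.2 := by
    simp [hup, hu2]
  have h1 := alignedBound_key hlev (p := p₀) (E := {u}) (by simpa using huX) huE
    fun v hv hv' hvu => absurd (hx v hv u huX (hv'.trans hup.symm)) (by simpa using hvu)
  simp only [Finset.sum_singleton] at h1
  have h0 : AlignedBound (key p₀) (side 1 X p₀) (side (-1) X p₀) ρ β (k + k') (m + m') 0 0 ∨
      (if u ∈ L₃ then 1 else 0) + (if u ∈ R₃ then 1 else 0) = 1 ∧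
      (if u ∈ L₄ then 1 else 0) + (if u ∈ R₄ then 1 else 0) = 1 := by
    rcases hu2.lt_or_eq with hlow | heq
    · exact Or.inr ⟨hone hlow p₃ L₃ R₃ hN₃ hp₃ hL₃ hR₃, hone hlow p₄ L₄ R₄ hN₄ hp₄ hL₄ hR₄⟩
    · exact Or.inl (alignedBound_key hlev (E := ∅) (Finset.empty_subset _) (by simp)
        fun v hv hv' _ => (hx v hv u huX (hv'.trans hup.symm) ▸ heq.ge))
  have hoff : ∀ L ⊆ X, (if u ∈ L then 1 else 0) = 0 → ∀ v ∈ L, ρ v = 1 → v.1 ≠ p₀.1 := by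
    intro L hL h v hv _ hvp
    rw [hx v (hL hv) u huX (hvp.trans hup.symm)] at hv
    simp [hv] at h
  have hexc : ∀ (p : ℝ × ℝ) (L : Finset (ℝ × ℝ)) (m : ℕ), Near X p₀ p → L ⊆ X →
      IsTight (key p) ρ β m L → (if u ∈ L then 1 else 0) = 0 → m < ∑ v ∈ off p₀ L, β v →
      ∃ d ∈ off p₀ L, ρ d = 1 ∧ ∀ v ∈ off p₀ L, key p₀ v ≤ key p₀ d :=
    fun p L m hN hL ht h0 hlt => ht.off hN hL (hoff L hL h0)
      (hlt.trans_le (Finset.sum_le_sum_of_subset off_subset))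
  have := h1.exact (hρ u) (hβ u) (hex _ _ _ hL₃.1.1 hR₃.1.1) (hex _ _ _ hL₄.1.1 hR₄.1.1) h0
    la₃ lb₃ h₃ la₄ lb₄ h₄
  simp only [hsum L₃ sL₃, hsum R₃ sR₃, hsum L₄ sL₄, hsum R₄ sR₄] at this
  exact this hL₃.2.1 hR₃.2.1 hL₄.2.1 hR₄.2.1 hL₃.2.2 hR₃.2.2 hL₄.2.2 hR₄.2.2
    (hexc p₃ L₃ m hN₃ sL₃ tL₃) (hexc p₃ R₃ m' hN₃ sR₃ tR₃)

/-- There are segments of given weights on both sides of `p` which bound a convex angle. -/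
def HasConvexFit (X : Finset (ℝ × ℝ)) (ρ β : ℝ × ℝ → ℕ) (k m k' m' : ℕ) (p : ℝ × ℝ) : Prop :=
  ∃ L R, IsFit (key p) (side 1 X p) ρ β k m L ∧ IsFit (key p) (side (-1) X p) ρ β k' m' R ∧
    IsConvexPair (key p) (side 1 X p) (side (-1) X p) L R

theorem exists_isDeficient (hρ : ∀ v, ρ v ≤ 1) (hσ : σ = 1 ∨ σ = -1)
    (hpos : ∀ S, Sep X S → ∑ v ∈ S, ρ v = k → m < ∑ v ∈ S, β v)
    (hk : k ≤ ∑ v ∈ side σ X p, ρ v)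
    (h : ¬ ∃ L, IsFit (key p) (side σ X p) ρ β k m L) :
    ∃ L z, IsDeficient (key p) (side σ X p) ρ β k m L z := by
  rcases hk.lt_or_eq with hlt | heq
  · obtain ⟨P, z, hP, hPz, -, hzP, hρz, hr⟩ := exists_prefix_next (key p) hρ hlt
    exact ⟨P, z, hP, hPz, hzP, hρz, hr, not_le.1 fun hm => h ⟨P, hP, hr, hm⟩⟩
  · exact absurd ⟨_, isPrefix_self, heq.symm, (hpos _ (sep_side (by
      rcases hσ with rfl | rfl <;> norm_num)) heq.symm).le⟩ h

theorem nonpos_of_not_isConvexPair (hL : IsPrefix (key p) (side 1 X p) L)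
    (hR : IsPrefix (key p) (side (-1) X p) R)
    (h : ¬ IsConvexPair (key p) (side 1 X p) (side (-1) X p) L R) :
    ∀ v ∈ L, ∀ w ∈ R, key p v + key p w ≤ 0 := by
  unfold IsConvexPair at h
  push Not at h
  obtain ⟨v, hv, hv', w, hw, hw', hneg⟩ := h
  intro a ha b hb
  linarith [hL.2 a ha v hv hv', hR.2 b hb w hw hw']

end Local

section Limit

variable {X : Finset (ℝ × ℝ)} {p₀ p₃ : ℝ × ℝ} {ρ β : ℝ × ℝ → ℕ} {k m k' m' : ℕ}

/-- Convex fits can be made exact at a limit of convex fits and of other configurations. -/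
theorem HasConvexFit.exists_exact (hρ : ∀ v, ρ v ≤ 1) (hβ : ∀ v, β v ≤ 1) (hX : GenPos X)
    (hx : ∀ v ∈ X, ∀ w ∈ X, v.1 = w.1 → v = w)
    (hG : ∀ u ∈ X, u.1 = p₀.1 → u.2 < p₀.2 →
      ¬ (HasTie (key p₀) (side 1 X p₀) ∧ HasTie (key p₀) (side (-1) X p₀)))
    (hlev : ∀ S, Sep X S → ∑ v ∈ S, ρ v = k + k' → ∑ v ∈ S, β v < m + m')
    (hposL : ∀ S, Sep X S → ∑ v ∈ S, ρ v = k → m < ∑ v ∈ S, β v)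
    (hposR : ∀ S, Sep X S → ∑ v ∈ S, ρ v = k' → m' < ∑ v ∈ S, β v)
    (hk : k ≤ ∑ v ∈ side 1 X p₀, ρ v) (hk' : k' ≤ ∑ v ∈ side (-1) X p₀, ρ v)
    (hk0 : 0 < k) (hk0' : 0 < k') (hN₃ : Near X p₀ p₃) (hp₃ : ∀ v ∈ X, v.1 ≠ p₃.1)
    (h₃ : HasConvexFit X ρ β k m k' m' p₃)
    (h : (∃ p, Near X p₀ p ∧ (∀ v ∈ X, v.1 ≠ p.1) ∧
        (∃ L, IsFit (key p) (side 1 X p) ρ β k m L) ∧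
        (∃ R, IsFit (key p) (side (-1) X p) ρ β k' m' R) ∧ ¬ HasConvexFit X ρ β k m k' m' p) ∨
      (∃ p, Near X p₀ p ∧ ¬ ∃ L, IsFit (key p) (side 1 X p) ρ β k m L) ∧
      ∃ p, Near X p₀ p ∧ ¬ ∃ R, IsFit (key p) (side (-1) X p) ρ β k' m' R) :
    ∃ L R, IsFit (key p₃) (side 1 X p₃) ρ β k m L ∧ IsFit (key p₃) (side (-1) X p₃) ρ β k' m' R ∧
      IsConvexPair (key p₃) (side 1 X p₃) (side (-1) X p₃) L R ∧
      ∑ v ∈ L, β v = m ∧ ∑ v ∈ R, β v = m' := by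
  have hl : (1 : ℝ) = 1 ∨ (1 : ℝ) = -1 := Or.inl rfl
  have hr : (-1 : ℝ) = 1 ∨ (-1 : ℝ) = -1 := Or.inr rfl
  obtain ⟨L, R, hL, hR, hc⟩ := h₃
  have h0 := alignedBound_key hlev (p := p₃) (E := ∅) (Finset.empty_subset _) (by simp)
    fun v hv hv' => absurd hv' (hp₃ v hv)
  obtain ⟨L, R, hL, hR, hc, tL, tR⟩ := IsConvexPair.exists_isTight hρ hβ h0 hL hR hc
  refine ⟨L, R, hL, hR, hc, ?_⟩
  rcases h with ⟨p, hN, hp, ⟨L₄, hL₄⟩, ⟨R₄, hR₄⟩, hno⟩ | ⟨⟨p₁, hN₁, h₁⟩, p₂, hN₂, h₂⟩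
  · obtain ⟨L₄, hL₄, tL₄⟩ := hL₄.exists_isTight hρ hβ
    obtain ⟨R₄, hR₄, tR₄⟩ := hR₄.exists_isTight hρ hβ
    exact hL.sum_eq_of_convex_of_reflex hρ hβ hx hlev hposL hposR hk hk' hk0 hk0' hN₃ hN hp₃ hp tL
      hR tR hc hL₄ tL₄ hR₄ tR₄
      (nonpos_of_not_isConvexPair hL₄.1 hR₄.1 fun h => hno ⟨L₄, R₄, hL₄, hR₄, h⟩)
  · obtain ⟨L₁, z₁, hL₁⟩ := exists_isDeficient hρ hl hposL
      (hk.trans (Finset.sum_le_sum_of_subset (hN₁.side_subset_side hl))) h₁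
    obtain ⟨L₂, z₂, hL₂⟩ := exists_isDeficient hρ hr hposR
      (hk'.trans (Finset.sum_le_sum_of_subset (hN₂.side_subset_side hr))) h₂
    refine ⟨hL.sum_eq_of_deficient hl hρ hβ hX hx hG hposL hk hk0 hk0' hN₃ hN₁ hN₂ hp₃ tL hR hL₁
      hL₂, hR.sum_eq_of_deficient hr hρ hβ hX hx (fun u hu h h' ht => hG u hu h h' ?_) hposR hk'
      hk0' hk0 hN₃ hN₂ hN₁ hp₃ tR (by rwa [neg_neg]) hL₂ (by rwa [neg_neg])⟩
    rw [neg_neg] at ht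
    exact ht.symm

end Limit

theorem interior_line_eq_empty {a b : ℝ} (h : a ≠ 0 ∨ b ≠ 0) (c : ℝ) :
    interior {p : ℝ × ℝ | a * p.1 + b * p.2 = c} = ∅ := by
  rw [Set.eq_empty_iff_forall_notMem]
  intro p hp
  have hc : Tendsto (fun t : ℝ => p + t • (a, b)) (𝓝[≠] 0) (𝓝 (p + (0 : ℝ) • (a, b))) :=
    (Continuous.tendsto (by fun_prop) 0).mono_left nhdsWithin_le_nhds
  rw [zero_smul, add_zero] at hc
  have hp' := interior_subset hp
  obtain ⟨t, ht, ht0 : t ≠ 0⟩ := ((hc.eventually (mem_interior_iff_mem_nhds.1 hp)).and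
    self_mem_nhdsWithin).exists
  simp only [Set.mem_ofPred_eq, Prod.fst_add, Prod.snd_add, Prod.smul_fst, Prod.smul_snd,
    smul_eq_mul] at ht hp'
  have h0 : t * (a ^ 2 + b ^ 2) = 0 := by linear_combination ht - hp'
  have h1 : a ^ 2 + b ^ 2 = 0 := (mul_eq_zero.1 h0).resolve_left ht0
  rcases h with h | h
  · have := sq_pos_of_ne_zero h
    nlinarith [sq_nonneg b]
  · have := sq_pos_of_ne_zero h
    nlinarith [sq_nonneg a]

section Search

variable {X L R : Finset (ℝ × ℝ)} {p u v w : ℝ × ℝ} {σ : ℝ} {ρ β : ℝ × ℝ → ℕ} {k m k' m' : ℕ}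

/-- `p` lies on no line spanned by `X` and on no vertical line through a point of `X`. -/
def Generic (X : Finset (ℝ × ℝ)) (p : ℝ × ℝ) : Prop :=
  (∀ v ∈ X, v.1 ≠ p.1) ∧ ∀ v ∈ X, ∀ w ∈ X, v ≠ w → cross p v w ≠ 0

theorem dense_generic (X : Finset (ℝ × ℝ)) : Dense {p | Generic X p} := by
  have key : ∀ a b c : ℝ, a ≠ 0 ∨ b ≠ 0 →
      IsOpen {p : ℝ × ℝ | a * p.1 + b * p.2 = c}ᶜ ∧ Dense {p : ℝ × ℝ | a * p.1 + b * p.2 = c}ᶜ :=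
    fun a b c h => ⟨(isClosed_eq (by fun_prop) (by fun_prop)).isOpen_compl,
      interior_eq_empty_iff_dense_compl.1 (interior_line_eq_empty h c)⟩
  have h1 := fun v : ℝ × ℝ => key 1 0 v.1 (by simp)
  have h2 := fun e : {e : (ℝ × ℝ) × (ℝ × ℝ) // e.1 ≠ e.2} =>
    key (e.1.1.2 - e.1.2.2) (e.1.2.1 - e.1.1.1) (e.1.2.1 * e.1.1.2 - e.1.1.1 * e.1.2.2) (by
      by_contra! h
      exact e.2 (Prod.ext (by linarith) (by linarith)))
  have d1 := dense_biInter_of_isOpen (S := (X : Set (ℝ × ℝ))) (fun v _ => (h1 v).1)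
    X.countable_toSet fun v _ => (h1 v).2
  have d2 := dense_biInter_of_isOpen
    (S := {e : {e : (ℝ × ℝ) × (ℝ × ℝ) // e.1 ≠ e.2} | e.1 ∈ X ×ˢ X}) (fun e _ => (h2 e).1)
    (((X ×ˢ X).finite_toSet.preimage Subtype.val_injective.injOn).countable) fun e _ => (h2 e).2
  have o1 : IsOpen (⋂ v ∈ (X : Set (ℝ × ℝ)), {p : ℝ × ℝ | 1 * p.1 + 0 * p.2 = v.1}ᶜ) :=
    X.finite_toSet.isOpen_biInter fun v _ => (h1 v).1
  refine (d1.inter_of_isOpen_left d2 o1).mono fun p hp => ⟨fun v hv h => ?_, fun v hv w hw hne h => ?_⟩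
  · exact Set.mem_iInter₂.1 hp.1 v hv (by simp [h])
  · refine Set.mem_iInter₂.1 hp.2 ⟨(v, w), hne⟩ (Finset.mem_product.2 ⟨hv, hw⟩) ?_
    unfold cross at h
    simp only [Set.mem_ofPred_eq]
    linear_combination h

theorem sum_side_add (hp : ∀ v ∈ X, v.1 ≠ p.1) (ρ : ℝ × ℝ → ℕ) :
    ∑ v ∈ side 1 X p, ρ v + ∑ v ∈ side (-1) X p, ρ v = ∑ v ∈ X, ρ v := by
  rw [← Finset.sum_filter_add_sum_filter_not X fun v => 1 * v.1 < 1 * p.1]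
  congr 2
  refine Finset.filter_congr fun v hv => ?_
  have := hp v hv
  constructor
  · intro h
    linarith
  · intro h
    have := lt_of_le_of_ne (by linarith) this.symm
    linarith

theorem exists_vertical (hρ : ∀ v, ρ v ≤ 1) (hx : ∀ v ∈ X, ∀ w ∈ X, v.1 = w.1 → v = w)
    (hk : k ≤ ∑ v ∈ X, ρ v) :
    ∃ t : ℝ, (∀ v ∈ X, v.1 ≠ t) ∧ ∀ y, ∑ v ∈ side 1 X (t, y), ρ v = k := by
  obtain ⟨P, hP, -, -, hr⟩ := (isPrefix_empty (f := fun v : ℝ × ℝ => v.1) (Y := X)).exists_between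
    hρ isPrefix_self (Finset.empty_subset _) (by simp) hk
  obtain ⟨t, h1, h2⟩ := Order.exists_between_finsets (P.image Prod.fst) ((X \ P).image Prod.fst) (by
    simp only [Finset.mem_image, Finset.mem_sdiff]
    rintro _ ⟨v, hv, rfl⟩ _ ⟨w, ⟨hw, hw'⟩, rfl⟩
    exact lt_of_le_of_ne (hP.2 v hv w hw hw') fun h => hw' (hx v (hP.1 hv) w hw h ▸ hv))
  simp only [Finset.forall_mem_image] at h1 h2
  refine ⟨t, fun v hv => ?_, fun y => ?_⟩
  · by_cases h : v ∈ P
    · exact (h1 h).ne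
    · exact (h2 (Finset.mem_sdiff.2 ⟨hv, h⟩)).ne'
  · rw [← hr]
    congr 1
    ext v
    rw [mem_side]
    constructor
    · rintro ⟨hv, hlt⟩
      by_contra h
      have := h2 (Finset.mem_sdiff.2 ⟨hv, h⟩)
      simp only at hlt
      linarith
    · intro h
      exact ⟨hP.1 h, by simpa using h1 h⟩

theorem not_hasConvexFit_of_above
    (hlev : ∀ S, Sep X S → ∑ v ∈ S, ρ v = k + k' → ∑ v ∈ S, β v < m + m')
    (hp : ∀ v ∈ X, v.1 ≠ p.1) (hp' : ∀ v ∈ X, v.2 < p.2) : ¬ HasConvexFit X ρ β k m k' m' p := by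
  rintro ⟨L, R, hL, hR, hc⟩
  have h0 := alignedBound_key hlev (p := p) (E := ∅) (Finset.empty_subset _) (by simp)
    fun v hv hv' => absurd hv' (hp v hv)
  have hneg : ∀ v ∈ X, key p v < 0 := fun v hv =>
    div_neg_of_neg_of_pos (sub_neg.2 (hp' v hv)) (abs_pos.2 (sub_ne_zero.2 (hp v hv)))
  have h1 := hL.2.2
  have h2 := hR.2.2
  suffices ∃ a, IsLevel (key p) (side 1 X p) L a ∧ IsLevel (key p) (side (-1) X p) R (-a) by
    obtain ⟨a, ha, hb⟩ := this
    have := h0 a L R ha hb (by rw [hL.2.1, hR.2.1]; rfl)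
    simp only [Finset.sum_empty] at this
    omega
  by_cases h : ∃ v ∈ side 1 X p, v ∉ L
  · obtain ⟨v, hv, hv'⟩ := h
    have hall : ∀ w ∈ side (-1) X p, w ∈ R := by
      intro w hw
      by_contra hw'
      linarith [hc v hv hv' w hw hw', hneg v (side_subset hv), hneg w (side_subset hw)]
    obtain ⟨a, ha⟩ := hL.1.exists_isLevel
    refine ⟨min a 0, ⟨ha.1, fun w hw => le_min (ha.2.1 w hw) (hneg w (side_subset (ha.1 hw))).le,
      fun w hw hw' => (min_le_left _ _).trans (ha.2.2 w hw hw')⟩, hR.1.1, fun w hw => ?_,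
      fun w hw hw' => absurd (hall w hw) hw'⟩
    linarith [min_le_right a 0, hneg w (side_subset (hR.1.1 hw))]
  · push Not at h
    obtain ⟨b, hb⟩ := hR.1.exists_isLevel
    refine ⟨-min b 0, ⟨hL.1.1, fun w hw => ?_, fun w hw hw' => absurd (h w hw) hw'⟩, ?_⟩
    · linarith [min_le_right b 0, hneg w (side_subset (hL.1.1 hw))]
    · rw [neg_neg]
      exact ⟨hb.1, fun w hw => le_min (hb.2.1 w hw) (hneg w (side_subset (hb.1 hw))).le,
        fun w hw hw' => (min_le_left _ _).trans (hb.2.2 w hw hw')⟩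

theorem hasConvexFit_of_below {t₀ t₁ : ℝ}
    (hposL : ∀ S, Sep X S → ∑ v ∈ S, ρ v = k → m < ∑ v ∈ S, β v)
    (hposR : ∀ S, Sep X S → ∑ v ∈ S, ρ v = k' → m' < ∑ v ∈ S, β v)
    (hL : ∀ y, ∑ v ∈ side 1 X (t₀, y), ρ v = k) (hR : ∀ y, ∑ v ∈ side (-1) X (t₁, y), ρ v = k')
    (ht₀ : ∀ v ∈ X, v.1 < t₀ → v.1 < p.1) (ht₁ : ∀ v ∈ X, t₁ < v.1 → p.1 < v.1)
    (hlow : ∀ v ∈ X, p.2 < v.2) (hp : ∀ v ∈ X, v.1 ≠ p.1)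
    (hkey : ∀ v ∈ X, ∀ w ∈ X, ∀ σ : ℝ, σ = 1 ∨ σ = -1 → σ * v.1 < σ * w.1 → σ * w.1 < σ * p.1 →
      key p v ≤ key p w) : HasConvexFit X ρ β k m k' m' p := by
  have hpos : ∀ v ∈ X, 0 < key p v := fun v hv =>
    div_pos (sub_pos.2 (hlow v hv)) (abs_pos.2 (sub_ne_zero.2 (hp v hv)))
  have main : ∀ (σ t : ℝ), σ = 1 ∨ σ = -1 → (∀ v ∈ X, σ * v.1 < σ * t → σ * v.1 < σ * p.1) →
      IsPrefix (key p) (side σ X p) (side σ X (t, 0)) := by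
    intro σ t hσ ht
    refine ⟨fun v hv => mem_side.2 ⟨side_subset hv, ht v (side_subset hv) (mem_side.1 hv).2⟩,
      fun v hv w hw hw' => hkey v (side_subset hv) w (side_subset hw) σ hσ ?_ (mem_side.1 hw).2⟩
    exact (mem_side.1 hv).2.trans_le (not_lt.1 fun h => hw' (mem_side.2 ⟨side_subset hw, h⟩))
  refine ⟨side 1 X (t₀, 0), side (-1) X (t₁, 0),
    ⟨main 1 t₀ (Or.inl rfl) fun v hv h => ?_, hL 0, (hposL _ (sep_side (by simp)) (hL 0)).le⟩,
    ⟨main (-1) t₁ (Or.inr rfl) fun v hv h => ?_, hR 0, (hposR _ (sep_side (by simp)) (hR 0)).le⟩,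
    fun v hv _ w hw _ => (add_pos (hpos v (side_subset hv)) (hpos w (side_subset hw))).le⟩
  · linarith [ht₀ v hv (by linarith)]
  · linarith [ht₁ v hv (by linarith)]

theorem eventually_key_le (X : Finset (ℝ × ℝ)) (S : ℝ) : ∀ᶠ h : ℝ in atTop, ∀ p : ℝ × ℝ, |p.1| ≤ S →
    p.2 ≤ -h → (∀ v ∈ X, p.2 < v.2) ∧
    ∀ v ∈ X, ∀ w ∈ X, ∀ σ : ℝ, σ = 1 ∨ σ = -1 → σ * v.1 < σ * w.1 → σ * w.1 < σ * p.1 →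
      key p v ≤ key p w := by
  have e1 : ∀ᶠ h : ℝ in atTop, ∀ v ∈ X, -v.2 < h :=
    (Finset.eventually_all X).2 fun v _ => eventually_gt_atTop _
  have e2 : ∀ᶠ h : ℝ in atTop, ∀ v ∈ X, ∀ w ∈ X,
      v.1 ≠ w.1 → |w.2 - v.2| * S + |v.2 * w.1 - w.2 * v.1| ≤ h * |w.1 - v.1| :=
    (Finset.eventually_all X).2 fun v _ => (Finset.eventually_all X).2 fun w _ => by
      by_cases hvw : v.1 = w.1
      · simp [hvw]
      · have : 0 < |w.1 - v.1| := abs_pos.2 (sub_ne_zero.2 (Ne.symm hvw))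
        filter_upwards [eventually_ge_atTop
          ((|w.2 - v.2| * S + |v.2 * w.1 - w.2 * v.1|) / |w.1 - v.1|)] with h hh _
        rwa [div_le_iff₀ this] at hh
  filter_upwards [e1, e2] with h h1 h2 p hS hp
  refine ⟨fun v hv => by linarith [h1 v hv], fun v hv w hw σ hσ hvw hwp => ?_⟩
  have hne : v.1 ≠ w.1 := fun h => hvw.ne (by rw [h])
  have h3 := h2 v hv w hw hne
  have h4 : |(w.2 - v.2) * p.1| ≤ |w.2 - v.2| * S := by
    rw [abs_mul]
    exact mul_le_mul_of_nonneg_left hS (abs_nonneg _)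
  have h5 := abs_le.1 h4
  have h6 := abs_le.1 (le_refl |v.2 * w.1 - w.2 * v.1|)
  have h7 : h * |w.1 - v.1| ≤ -p.2 * |w.1 - v.1| :=
    mul_le_mul_of_nonneg_right (by linarith) (abs_nonneg _)
  unfold key
  rw [div_le_div_iff₀ (abs_pos.2 (sub_ne_zero.2 fun h => by rw [h] at hvw; linarith))
    (abs_pos.2 (sub_ne_zero.2 fun h => by rw [h] at hwp; linarith))]
  rcases hσ with rfl | rfl
  · rw [abs_of_pos (by linarith : 0 < w.1 - v.1)] at h3 h7
    rw [abs_of_neg (by linarith), abs_of_neg (by linarith)]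
    nlinarith
  · rw [abs_of_neg (by linarith : w.1 - v.1 < 0)] at h3 h7
    rw [abs_of_pos (by linarith), abs_of_pos (by linarith)]
    nlinarith

end Search

theorem notMem_closure_of_eventually {α : Type*} [TopologicalSpace α] {S : Set α} {x : α}
    (h : ∀ᶠ y in 𝓝 x, y ∉ S) : x ∉ closure S := fun hx =>
  (mem_closure_iff_frequently.1 hx) h

theorem exists_generic_exact {X : Finset (ℝ × ℝ)} {ρ β : ℝ × ℝ → ℕ} {k m k' m' : ℕ}
    (hρ : ∀ v, ρ v ≤ 1) (hβ : ∀ v, β v ≤ 1) (hX : GenPos X)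
    (hx : ∀ v ∈ X, ∀ w ∈ X, v.1 = w.1 → v = w)
    (hG : ∀ p, ∀ u ∈ X, u.1 = p.1 → u.2 < p.2 →
      ¬ (HasTie (key p) (side 1 X p) ∧ HasTie (key p) (side (-1) X p)))
    (hlev : ∀ S, Sep X S → ∑ v ∈ S, ρ v = k + k' → ∑ v ∈ S, β v < m + m')
    (hposL : ∀ S, Sep X S → ∑ v ∈ S, ρ v = k → m < ∑ v ∈ S, β v)
    (hposR : ∀ S, Sep X S → ∑ v ∈ S, ρ v = k' → m' < ∑ v ∈ S, β v)
    (hk0 : 0 < k) (hk0' : 0 < k') (hsum : k + k' < ∑ v ∈ X, ρ v) :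
    ∃ p, Generic X p ∧ ∃ L R, IsFit (key p) (side 1 X p) ρ β k m L ∧
      IsFit (key p) (side (-1) X p) ρ β k' m' R ∧
      IsConvexPair (key p) (side 1 X p) (side (-1) X p) L R ∧
      ∑ v ∈ L, β v = m ∧ ∑ v ∈ R, β v = m' := by
  have hl : (1 : ℝ) = 1 ∨ (1 : ℝ) = -1 := Or.inl rfl
  have hr : (-1 : ℝ) = 1 ∨ (-1 : ℝ) = -1 := Or.inr rfl
  obtain ⟨t₀, ht₀, hL⟩ := exists_vertical (k := k) hρ hx (by omega)
  obtain ⟨t₁, ht₁, hR'⟩ := exists_vertical (k := ∑ v ∈ X, ρ v - k') hρ hx (by omega)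
  have hR : ∀ y, ∑ v ∈ side (-1) X (t₁, y), ρ v = k' := fun y => by
    have := sum_side_add (p := (t₁, y)) ht₁ ρ
    have := hR' y
    omega
  have ht : t₀ < t₁ := by
    by_contra! h
    have : side 1 X (t₁, 0) ⊆ side 1 X (t₀, 0) := fun v hv =>
      mem_side.2 ⟨side_subset hv, (mem_side.1 hv).2.trans_le (by simpa using h)⟩
    have := Finset.sum_le_sum_of_subset (f := ρ) this
    rw [hL, hR'] at this
    omega
  let A : ℝ × ℝ → Prop := fun p => ∃ L, IsFit (key p) (side 1 X p) ρ β k m L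
  let B : ℝ × ℝ → Prop := fun p => ∃ R, IsFit (key p) (side (-1) X p) ρ β k' m' R
  let Q : ℝ × ℝ → Prop := HasConvexFit X ρ β k m k' m'
  have hQA : ∀ p, Q p → A p := fun p ⟨L, R, h, _⟩ => ⟨L, h⟩
  have hQB : ∀ p, Q p → B p := fun p ⟨L, R, _, h, _⟩ => ⟨R, h⟩
  let S₁ : Set (ℝ × ℝ) := {p | Generic X p ∧ ¬ A p}
  let S₂ : Set (ℝ × ℝ) := {p | Generic X p ∧ ¬ B p}
  let S₃ : Set (ℝ × ℝ) := {p | Generic X p ∧ Q p}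
  let S₄ : Set (ℝ × ℝ) := {p | Generic X p ∧ A p ∧ B p ∧ ¬ Q p}
  let S₄' : Set (ℝ × ℝ) := S₄ ∩ {p | (t₀ + t₁) / 2 ≤ p.1}
  let S₄'' : Set (ℝ × ℝ) := S₄ ∩ {p | p.1 ≤ (t₀ + t₁) / 2}
  have hcov : closure (S₁ ∪ S₄') ∪ closure (S₂ ∪ S₄'') ∪ closure S₃ = Set.univ := by
    rw [← closure_union, ← closure_union, ← dense_iff_closure_eq]
    refine (dense_generic X).mono fun p (hp : Generic X p) => ?_
    by_cases hA : A p
    · by_cases hB : B p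
      · by_cases hQ : Q p
        · exact Or.inr ⟨hp, hQ⟩
        · rcases le_total ((t₀ + t₁) / 2) p.1 with h | h
          · exact Or.inl (Or.inl (Or.inr ⟨⟨hp, hA, hB, hQ⟩, h⟩))
          · exact Or.inl (Or.inr (Or.inr ⟨⟨hp, hA, hB, hQ⟩, h⟩))
      · exact Or.inl (Or.inr (Or.inl ⟨hp, hB⟩))
    · exact Or.inl (Or.inl (Or.inl ⟨hp, hA⟩))
  obtain ⟨h, hkey, hh, hh0⟩ := ((eventually_key_le X (max |t₀| |t₁| + 1)).and
    (((Finset.eventually_all X).2 fun v _ => eventually_gt_atTop v.2).and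
      (eventually_gt_atTop (0 : ℝ)))).exists
  have hfst : ∀ z : ℝ × ℝ, Tendsto (fun p : ℝ × ℝ => p.1) (𝓝 z) (𝓝 z.1) := fun z =>
    continuousAt_fst
  have hsnd : ∀ z : ℝ × ℝ, Tendsto (fun p : ℝ × ℝ => p.2) (𝓝 z) (𝓝 z.2) := fun z =>
    continuousAt_snd
  have hbot : ∀ x ∈ Set.Icc t₀ t₁, ∀ᶠ p in 𝓝 (x, -(h + 1)), Generic X p → Q p := by
    intro x hxt
    filter_upwards [eventually_near X (x, -(h + 1)),
      (hsnd (x, -(h + 1))).eventually (eventually_lt_nhds (b := -h) (by simp)),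
      (hfst (x, -(h + 1))).eventually (eventually_lt_nhds (b := t₁ + 1) (by
        simp only; linarith [hxt.2])),
      (hfst (x, -(h + 1))).eventually (eventually_gt_nhds (b := t₀ - 1) (by
        simp only; linarith [hxt.1]))] with p hN h1 h2 h3 hg
    obtain ⟨h4, h5⟩ := hkey p (abs_le.2
      ⟨by linarith [neg_abs_le t₀, le_max_left |t₀| |t₁|],
        by linarith [le_abs_self t₁, le_max_right |t₀| |t₁|]⟩) h1.le
    exact hasConvexFit_of_below hposL hposR hL hR (fun v hv hv' => hN.lt v hv (hv'.trans_le hxt.1))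
      (fun v hv hv' => hN.gt v hv (hxt.2.trans_lt hv')) h4 hg.1 h5
  obtain ⟨p₀, hp₀, hF⟩ := exists_common_point ht (by linarith : -(h + 1) < h + 1)
    ![closure (S₁ ∪ S₄'), closure (S₂ ∪ S₄''), closure S₃]
    (by intro i; fin_cases i <;> exact isClosed_closure)
    (fun p _ => by
      have hp := hcov.ge (Set.mem_univ p)
      rcases hp with (hp | hp) | hp
      · exact Set.mem_iUnion.2 ⟨0, hp⟩
      · exact Set.mem_iUnion.2 ⟨1, hp⟩
      · exact Set.mem_iUnion.2 ⟨2, hp⟩)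
    (fun y _ => notMem_closure_of_eventually (by
      filter_upwards [eventually_near X (t₀, y), (hfst (t₀, y)).eventually
        (eventually_lt_nhds (b := (t₀ + t₁) / 2) (by simp only; linarith))] with p hN hp
      rintro (⟨hg, hA⟩ | ⟨-, hp' : (t₀ + t₁) / 2 ≤ p.1⟩)
      · have he := (hN.off_side hl).symm.trans
          (off_eq_self fun v hv => ht₀ v (side_subset hv))
        have hs := he ▸ hL y
        exact hA ⟨_, isPrefix_self, hs, (hposL _ (sep_side (by simp)) hs).le⟩
      · linarith))
    (fun y _ => notMem_closure_of_eventually (by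
      filter_upwards [eventually_near X (t₁, y), (hfst (t₁, y)).eventually
        (eventually_gt_nhds (b := (t₀ + t₁) / 2) (by simp only; linarith))] with p hN hp
      rintro (⟨hg, hB⟩ | ⟨-, hp' : p.1 ≤ (t₀ + t₁) / 2⟩)
      · have he := (hN.off_side hr).symm.trans
          (off_eq_self fun v hv => ht₁ v (side_subset hv))
        have hs := he ▸ hR y
        exact hB ⟨_, isPrefix_self, hs, (hposR _ (sep_side (by simp)) hs).le⟩
      · linarith))
    (fun x _ => notMem_closure_of_eventually (by
      filter_upwards [(hsnd (x, h + 1)).eventually (eventually_gt_nhds (b := h) (by simp))]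
        with p hp hQ
      exact not_hasConvexFit_of_above hlev hQ.1.1 (fun v hv => (hh v hv).trans hp) hQ.2))
    (fun x hx => ⟨notMem_closure_of_eventually (by
        filter_upwards [hbot x hx] with p hp
        rintro (h | h)
        · exact h.2 (hQA p (hp h.1))
        · exact h.1.2.2.2 (hp h.1.1)), notMem_closure_of_eventually (by
        filter_upwards [hbot x hx] with p hp
        rintro (h | h)
        · exact h.2 (hQB p (hp h.1))
        · exact h.1.2.2.2 (hp h.1.1))⟩)
  have near : ∀ {S : Set (ℝ × ℝ)}, p₀ ∈ closure S → ∃ p ∈ S, Near X p₀ p := fun hS => by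
    obtain ⟨p, h1, h2⟩ := ((mem_closure_iff_frequently.1 hS).and_eventually
      (eventually_near X p₀)).exists
    exact ⟨p, h1, h2⟩
  have h0 : p₀ ∈ closure (S₁ ∪ S₄') := hF 0
  have h1 : p₀ ∈ closure (S₂ ∪ S₄'') := hF 1
  obtain ⟨p₃, ⟨hg₃, hQ₃⟩, hN₃⟩ := near (show p₀ ∈ closure S₃ from hF 2)
  refine ⟨p₃, hg₃, hQ₃.exists_exact hρ hβ hX hx (hG p₀) hlev hposL hposR ?_ ?_ hk0 hk0' hN₃ hg₃.1
    ?_⟩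
  · rw [← hL 0]
    exact Finset.sum_le_sum_of_subset fun v hv => mem_side.2 ⟨side_subset hv,
      (mem_side.1 hv).2.trans_le (by simpa using hp₀.1.1)⟩
  · rw [← hR 0]
    exact Finset.sum_le_sum_of_subset fun v hv => mem_side.2 ⟨side_subset hv,
      (mem_side.1 hv).2.trans_le (by simpa using hp₀.1.2)⟩
  · obtain ⟨p, hp, hN⟩ := near h0
    obtain ⟨q, hq, hN'⟩ := near h1
    rcases hp with hp | hp
    · rcases hq with hq | hq
      · exact Or.inr ⟨⟨p, hN, hp.2⟩, q, hN', hq.2⟩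
      · exact Or.inl ⟨q, hN', hq.1.1.1, hq.1.2⟩
    · exact Or.inl ⟨p, hN, hp.1.1.1, hp.1.2⟩

/-- A convex partition together with the induced parts of a finite set. -/
structure IsCut (X : Finset (ℝ × ℝ)) {r : ℕ} (D : Fin r → Set (ℝ × ℝ))
    (P : Fin r → Finset (ℝ × ℝ)) : Prop where
  convexPartition : ConvexPartition D
  mem_iff : ∀ j v, v ∈ P j ↔ v ∈ X ∧ v ∈ D j

section Cut

variable {X L R S : Finset (ℝ × ℝ)} {p : ℝ × ℝ}

theorem IsCut.subset {r : ℕ} {D : Fin r → Set (ℝ × ℝ)} {P : Fin r → Finset (ℝ × ℝ)}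
    (h : IsCut X D P) (i : Fin r) : P i ⊆ X := fun v hv => ((h.mem_iff i v).1 hv).1

/-- Subdividing every part of a cut. -/
theorem IsCut.sigma {s : ℕ} {a : Fin s → ℕ} {D : Fin s → Set (ℝ × ℝ)}
    {P : Fin s → Finset (ℝ × ℝ)} {C : ∀ i, Fin (a i) → Set (ℝ × ℝ)}
    {Q : ∀ i, Fin (a i) → Finset (ℝ × ℝ)} (h : IsCut X D P) (h' : ∀ i, IsCut (P i) (C i) (Q i)) :
    IsCut X (fun j => D (finSigmaFinEquiv.symm j).1 ∩
        C (finSigmaFinEquiv.symm j).1 (finSigmaFinEquiv.symm j).2)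
      fun j => Q (finSigmaFinEquiv.symm j).1 (finSigmaFinEquiv.symm j).2 := by
  refine ⟨⟨fun j => (h.1.1 _).inter ((h' _).1.1 _), fun j => (h.1.2.1 _).inter ((h' _).1.2.1 _),
    Set.eq_univ_of_forall fun v => ?_, fun j j' hjj' => ?_⟩, fun j v => ?_⟩
  · obtain ⟨i, hi⟩ := Set.mem_iUnion.1 (h.1.2.2.1.ge (Set.mem_univ v))
    obtain ⟨t, ht⟩ := Set.mem_iUnion.1 ((h' i).1.2.2.1.ge (Set.mem_univ v))
    refine Set.mem_iUnion.2 ⟨finSigmaFinEquiv ⟨i, t⟩, ?_⟩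
    rw [Equiv.symm_apply_apply]
    exact ⟨hi, ht⟩
  · have hne : finSigmaFinEquiv.symm j ≠ finSigmaFinEquiv.symm j' := fun h =>
      hjj' (finSigmaFinEquiv.symm.injective h)
    dsimp only
    generalize finSigmaFinEquiv.symm j = t at hne ⊢
    generalize finSigmaFinEquiv.symm j' = t' at hne ⊢
    obtain ⟨i, t⟩ := t
    obtain ⟨i', t'⟩ := t'
    simp only [interior_inter]
    rw [Set.eq_empty_iff_forall_notMem]
    rintro v ⟨⟨h1, h2⟩, h3, h4⟩
    by_cases hi : i = i'
    · subst hi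
      exact Set.eq_empty_iff_forall_notMem.1 ((h' i).1.2.2.2 fun h : t = t' => hne (h ▸ rfl)) v
        ⟨h2, h4⟩
    · exact Set.eq_empty_iff_forall_notMem.1 (h.1.2.2.2 hi) v ⟨h1, h3⟩
  · rw [(h' _).mem_iff, h.mem_iff, and_assoc, Set.mem_inter_iff]

theorem IsCut.preimage {r : ℕ} {D : Fin r → Set (ℝ × ℝ)} {P : Fin r → Finset (ℝ × ℝ)}
    (e : (ℝ × ℝ) ≃L[ℝ] (ℝ × ℝ)) (h : IsCut (X.map e.toEquiv.toEmbedding) D P) :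
    IsCut X (fun j => e ⁻¹' D j) fun j => (P j).map e.symm.toEquiv.toEmbedding := by
  refine ⟨⟨fun j => (h.1.1 j).preimage e.continuous,
    fun j => (h.1.2.1 j).linear_preimage e.toLinearEquiv.toLinearMap, ?_, fun i j hij => ?_⟩,
    fun j v => ?_⟩
  · rw [← Set.preimage_iUnion, h.1.2.2.1, Set.preimage_univ]
  · have := fun s => (e.toHomeomorph.preimage_interior s).symm
    simp only [ContinuousLinearEquiv.coe_toHomeomorph] at this
    dsimp only
    rw [this, this, ← Set.preimage_inter, h.1.2.2.2 hij, Set.preimage_empty]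
  · simp only [Finset.mem_map_equiv, h.mem_iff, Set.mem_preimage]
    simp

theorem convex_halfPlane (a b c : ℝ) : Convex ℝ {q : ℝ × ℝ | a * q.1 + b * q.2 ≤ c} := by
  intro q hq s hs x y hx hy hxy
  simp only [Set.mem_ofPred_eq, Prod.fst_add, Prod.snd_add, Prod.smul_fst, Prod.smul_snd,
    smul_eq_mul] at hq hs ⊢
  have h1 := mul_le_mul_of_nonneg_left hq hx
  have h2 := mul_le_mul_of_nonneg_left hs hy
  have h3 : x * c + y * c = c := by rw [← add_mul, hxy, one_mul]
  linarith

theorem isClosed_halfPlane (a b c : ℝ) : IsClosed {q : ℝ × ℝ | a * q.1 + b * q.2 ≤ c} :=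
  isClosed_le (by fun_prop) continuous_const

theorem interior_inter_eq_empty_of_line {A B : Set (ℝ × ℝ)} {a b c : ℝ} (h : a ≠ 0 ∨ b ≠ 0)
    (hAB : ∀ q ∈ A, q ∈ B → a * q.1 + b * q.2 = c) : interior A ∩ interior B = ∅ := by
  rw [← interior_inter, ← Set.subset_empty_iff, ← interior_line_eq_empty h c]
  exact interior_mono fun q hq => hAB q hq.1 hq.2

/-- A line separating `S` from its complement cuts the plane into two parts. -/
theorem Sep.exists_isCut (hX : GenPos X) (h : Sep X S) :
    ∃ D : Fin 2 → Set (ℝ × ℝ), IsCut X D ![S, X \ S] := by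
  obtain ⟨w, hw, c, h1, h2⟩ := h.exists_strict hX
  have hw' : w.1 ≠ 0 ∨ w.2 ≠ 0 := by
    by_contra! h
    exact hw (Prod.ext h.1 h.2)
  have hw'' : interior {q : ℝ × ℝ | w.1 * q.1 + w.2 * q.2 ≤ c} ∩
      interior {q : ℝ × ℝ | -w.1 * q.1 + -w.2 * q.2 ≤ -c} = ∅ :=
    interior_inter_eq_empty_of_line (c := c) hw' fun q hq hq' => by
      simp only [Set.mem_ofPred_eq] at hq hq'
      linarith
  refine ⟨![{q | w.1 * q.1 + w.2 * q.2 ≤ c}, {q | -w.1 * q.1 + -w.2 * q.2 ≤ -c}],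
    ⟨⟨?_, ?_, Set.eq_univ_of_forall fun q => ?_, ?_⟩, ?_⟩⟩
  · intro i
    fin_cases i <;> exact isClosed_halfPlane _ _ _
  · intro i
    fin_cases i <;> exact convex_halfPlane _ _ _
  · rcases le_total (w.1 * q.1 + w.2 * q.2) c with hq | hq
    · exact Set.mem_iUnion.2 ⟨0, hq⟩
    · exact Set.mem_iUnion.2 ⟨1, show -w.1 * q.1 + -w.2 * q.2 ≤ -c by linarith⟩
  · intro i j hij
    fin_cases i <;> fin_cases j
    · exact absurd rfl hij
    · exact hw''
    · exact (Set.inter_comm _ _).trans hw''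
    · exact absurd rfl hij
  · intro i v
    fin_cases i
    · change v ∈ S ↔ v ∈ X ∧ w.1 * v.1 + w.2 * v.2 ≤ c
      refine ⟨fun hv => ⟨h.subset hv, (h1 v hv).le⟩, fun ⟨hv, hv'⟩ => ?_⟩
      by_contra hvS
      exact absurd (h2 v hv hvS) (not_lt.2 hv')
    · change v ∈ X \ S ↔ v ∈ X ∧ -w.1 * v.1 + -w.2 * v.2 ≤ -c
      rw [Finset.mem_sdiff]
      refine and_congr_right fun hv => ⟨fun hvS => by linarith [h2 v hv hvS], fun hv' hvS => ?_⟩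
      linarith [h1 v hvS]

theorem exists_strict_level {f : ℝ × ℝ → ℝ} {Y : Finset (ℝ × ℝ)}
    (h : ∀ v ∈ L, ∀ w ∈ Y, w ∉ L → f v < f w) (c : ℝ) (hc : ∀ w ∈ Y, w ∉ L → c < f w) :
    ∃ a, c < a ∧ (∀ v ∈ L, f v < a) ∧ ∀ w ∈ Y, w ∉ L → a < f w := by
  obtain ⟨a, h1, h2⟩ := Order.exists_between_finsets (insert c (L.image f)) ((Y \ L).image f) (by
    simp only [Finset.mem_insert, Finset.mem_image, Finset.mem_sdiff]
    rintro _ (rfl | ⟨v, hv, rfl⟩) _ ⟨w, ⟨hw, hw'⟩, rfl⟩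
    · exact hc w hw hw'
    · exact h v hv w hw hw')
  exact ⟨a, h1 c (Finset.mem_insert_self _ _), fun v hv =>
    h1 _ (Finset.mem_insert_of_mem (Finset.mem_image_of_mem _ hv)), fun w hw hw' =>
    h2 _ (Finset.mem_image_of_mem _ (Finset.mem_sdiff.2 ⟨hw, hw'⟩))⟩

theorem exists_strict_levels {f : ℝ × ℝ → ℝ} {Y Z : Finset (ℝ × ℝ)}
    (h : ∀ v ∈ L, ∀ w ∈ Y, w ∉ L → f v < f w) (h' : ∀ v ∈ R, ∀ w ∈ Z, w ∉ R → f v < f w)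
    (hc : ∀ v ∈ Y, v ∉ L → ∀ w ∈ Z, w ∉ R → 0 < f v + f w) :
    ∃ a b, 0 < a + b ∧ (∀ v ∈ L, f v < a) ∧ (∀ w ∈ Y, w ∉ L → a < f w) ∧
      (∀ v ∈ R, f v < b) ∧ ∀ w ∈ Z, w ∉ R → b < f w := by
  obtain ⟨s, h1, h2⟩ := Order.exists_between_finsets ((Y \ L).image fun v => -f v)
    ((Z \ R).image f) (by
      simp only [Finset.mem_image, Finset.mem_sdiff]
      rintro _ ⟨v, ⟨hv, hv'⟩, rfl⟩ _ ⟨w, ⟨hw, hw'⟩, rfl⟩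
      linarith [hc v hv hv' w hw hw'])
  simp only [Finset.forall_mem_image, Finset.mem_sdiff] at h1 h2
  obtain ⟨a, ha, ha'⟩ := exists_strict_level h (-s) fun w hw hw' => by linarith [h1 ⟨hw, hw'⟩]
  obtain ⟨b, hb, hb'⟩ := exists_strict_level h' s fun w hw hw' => h2 ⟨hw, hw'⟩
  exact ⟨a, b, by linarith, ha'.1, ha'.2, hb'⟩

end Cut

section ThreeCut

variable {X L R : Finset (ℝ × ℝ)} {p v w : ℝ × ℝ} {σ a : ℝ}

theorem Generic.key_lt (hp : Generic X p) (hσ : σ = 1 ∨ σ = -1)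
    (hL : IsPrefix (key p) (side σ X p) L) (hv : v ∈ L) (hw : w ∈ side σ X p) (hw' : w ∉ L) :
    key p v < key p w :=
  lt_of_le_of_ne (hL.2 v hv w hw hw') fun h =>
    hp.2 v (side_subset (hL.1 hv)) w (side_subset hw) (fun h => hw' (h ▸ hv))
      (cross_eq_zero_of_key_eq hσ (hL.1 hv) hw h)

theorem Generic.key_add_ne_zero (hp : Generic X p) (hv : v ∈ side 1 X p)
    (hw : w ∈ side (-1) X p) : key p v + key p w ≠ 0 := by
  intro h
  have h1 := snd_eq_key (Or.inl rfl) hv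
  have h2 := snd_eq_key (Or.inr rfl) hw
  refine hp.2 v (side_subset hv) w (side_subset hw) (fun h => ?_) ?_
  · have h3 := (mem_side.1 hv).2
    have h4 := (mem_side.1 hw).2
    rw [h] at h3
    linarith
  · have h5 : key p w = -key p v := by linarith
    rw [h5] at h2
    unfold cross
    rw [h1, h2]
    ring

theorem snd_lt_iff (hσ : σ = 1 ∨ σ = -1) (hv : v ∈ side σ X p) :
    key p v < a ↔ v.2 < p.2 + a * (σ * (p.1 - v.1)) := by
  have h1 := snd_eq_key hσ hv
  have h2 : 0 < σ * (p.1 - v.1) := by linarith [(mem_side.1 hv).2]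
  rw [h1, add_lt_add_iff_left, mul_lt_mul_iff_of_pos_right h2]

theorem lt_snd_iff (hσ : σ = 1 ∨ σ = -1) (hv : v ∈ side σ X p) :
    a < key p v ↔ p.2 + a * (σ * (p.1 - v.1)) < v.2 := by
  have h1 := snd_eq_key hσ hv
  have h2 : 0 < σ * (p.1 - v.1) := by linarith [(mem_side.1 hv).2]
  rw [h1, add_lt_add_iff_left, mul_lt_mul_iff_of_pos_right h2]

/-- Three rays from a generic point cut the plane into three convex parts. -/
theorem IsConvexPair.exists_isCut (hp : Generic X p) (hL : IsPrefix (key p) (side 1 X p) L)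
    (hR : IsPrefix (key p) (side (-1) X p) R)
    (hc : IsConvexPair (key p) (side 1 X p) (side (-1) X p) L R) :
    ∃ D : Fin 3 → Set (ℝ × ℝ), IsCut X D ![L, R, X \ (L ∪ R)] := by
  obtain ⟨a, b, hab, hL1, hL2, hR1, hR2⟩ := exists_strict_levels
    (fun v hv w hw hw' => hp.key_lt (Or.inl rfl) hL hv hw hw')
    (fun v hv w hw hw' => hp.key_lt (Or.inr rfl) hR hv hw hw')
    fun v hv hv' w hw hw' => lt_of_le_of_ne (hc v hv hv' w hw hw') (hp.key_add_ne_zero hv hw).symm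
  let DL : Set (ℝ × ℝ) := {q | 1 * q.1 + 0 * q.2 ≤ p.1} ∩ {q | a * q.1 + 1 * q.2 ≤ p.2 + a * p.1}
  let DR : Set (ℝ × ℝ) :=
    {q | -1 * q.1 + 0 * q.2 ≤ -p.1} ∩ {q | -b * q.1 + 1 * q.2 ≤ p.2 - b * p.1}
  let DT : Set (ℝ × ℝ) :=
    {q | -a * q.1 + -1 * q.2 ≤ -(p.2 + a * p.1)} ∩ {q | b * q.1 + -1 * q.2 ≤ -(p.2 - b * p.1)}
  have mL : ∀ q, q ∈ DL ↔ q.1 ≤ p.1 ∧ q.2 ≤ p.2 + a * (p.1 - q.1) := fun q => by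
    simp only [DL, Set.mem_inter_iff, Set.mem_ofPred_eq]
    constructor <;> rintro ⟨h1, h2⟩ <;> constructor <;> linarith
  have mR : ∀ q, q ∈ DR ↔ p.1 ≤ q.1 ∧ q.2 ≤ p.2 + b * (q.1 - p.1) := fun q => by
    simp only [DR, Set.mem_inter_iff, Set.mem_ofPred_eq]
    constructor <;> rintro ⟨h1, h2⟩ <;> constructor <;> linarith
  have mT : ∀ q, q ∈ DT ↔ p.2 + a * (p.1 - q.1) ≤ q.2 ∧ p.2 + b * (q.1 - p.1) ≤ q.2 := fun q => by
    simp only [DT, Set.mem_inter_iff, Set.mem_ofPred_eq]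
    constructor <;> rintro ⟨h1, h2⟩ <;> constructor <;> linarith
  have iLR : interior DL ∩ interior DR = ∅ :=
    interior_inter_eq_empty_of_line (a := 1) (b := 0) (c := p.1) (by simp) fun q h h' => by
      linarith [((mL q).1 h).1, ((mR q).1 h').1]
  have iLT : interior DL ∩ interior DT = ∅ :=
    interior_inter_eq_empty_of_line (a := a) (b := 1) (c := p.2 + a * p.1) (by simp)
      fun q h h' => by linarith [((mL q).1 h).2, ((mT q).1 h').1]
  have iRT : interior DR ∩ interior DT = ∅ :=
    interior_inter_eq_empty_of_line (a := -b) (b := 1) (c := p.2 - b * p.1) (by simp)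
      fun q h h' => by linarith [((mR q).1 h).2, ((mT q).1 h').2]
  refine ⟨![DL, DR, DT], ⟨⟨fun i => ?_, fun i => ?_, Set.eq_univ_of_forall fun q => ?_,
    fun i j hij => ?_⟩, fun i v => ?_⟩⟩
  · fin_cases i <;> exact (isClosed_halfPlane _ _ _).inter (isClosed_halfPlane _ _ _)
  · fin_cases i <;> exact (convex_halfPlane _ _ _).inter (convex_halfPlane _ _ _)
  · by_cases hT : q ∈ DT
    · exact Set.mem_iUnion.2 ⟨2, hT⟩
    · rw [mT] at hT
      rcases le_total q.1 p.1 with h | h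
      · refine Set.mem_iUnion.2 ⟨0, (mL q).2 ⟨h, ?_⟩⟩
        by_contra! h'
        exact hT ⟨h'.le, by nlinarith⟩
      · refine Set.mem_iUnion.2 ⟨1, (mR q).2 ⟨h, ?_⟩⟩
        by_contra! h'
        exact hT ⟨by nlinarith, h'.le⟩
  · fin_cases i <;> fin_cases j
    · exact absurd rfl hij
    · exact iLR
    · exact iLT
    · exact (Set.inter_comm _ _).trans iLR
    · exact absurd rfl hij
    · exact iRT
    · exact (Set.inter_comm _ _).trans iLT
    · exact (Set.inter_comm _ _).trans iRT
    · exact absurd rfl hij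
  · by_cases hvX : v ∈ X
    swap
    · simp only [hvX, false_and, iff_false]
      fin_cases i
      · exact fun h => hvX (side_subset (hL.1 h))
      · exact fun h => hvX (side_subset (hR.1 h))
      · exact fun h => hvX (Finset.mem_sdiff.1 h).1
    simp only [hvX, true_and]
    rcases lt_or_gt_of_ne (hp.1 v hvX) with h | h
    · have hv : v ∈ side 1 X p := mem_side.2 ⟨hvX, by linarith⟩
      have hvR : v ∉ R := fun h' => by linarith [(mem_side.1 (hR.1 h')).2]
      have e1 := snd_lt_iff (a := a) (Or.inl rfl) hv
      have e2 := lt_snd_iff (a := a) (Or.inl rfl) hv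
      rw [one_mul] at e1 e2
      by_cases hvL : v ∈ L
      · have h1 := e1.1 (hL1 v hvL)
        fin_cases i
        · exact iff_of_true hvL ((mL v).2 ⟨h.le, h1.le⟩)
        · exact iff_of_false hvR fun h' => by linarith [((mR v).1 h').1]
        · exact iff_of_false (by simp [hvL]) fun h' => by linarith [((mT v).1 h').1]
      · have h1 := e2.1 (hL2 v hv hvL)
        fin_cases i
        · exact iff_of_false hvL fun h' => by linarith [((mL v).1 h').2]
        · exact iff_of_false hvR fun h' => by linarith [((mR v).1 h').1]
        · exact iff_of_true (by simp [hvX, hvL, hvR]) ((mT v).2 ⟨h1.le, by nlinarith⟩)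
    · have hv : v ∈ side (-1) X p := mem_side.2 ⟨hvX, by linarith⟩
      have hvL : v ∉ L := fun h' => by linarith [(mem_side.1 (hL.1 h')).2]
      have e1 := snd_lt_iff (a := b) (Or.inr rfl) hv
      have e2 := lt_snd_iff (a := b) (Or.inr rfl) hv
      rw [neg_one_mul, neg_sub] at e1 e2
      by_cases hvR : v ∈ R
      · have h1 := e1.1 (hR1 v hvR)
        fin_cases i
        · exact iff_of_false hvL fun h' => by linarith [((mL v).1 h').1]
        · exact iff_of_true hvR ((mR v).2 ⟨h.le, h1.le⟩)
        · exact iff_of_false (by simp [hvR]) fun h' => by linarith [((mT v).1 h').2]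
      · have h1 := e2.1 (hR2 v hv hvR)
        fin_cases i
        · exact iff_of_false hvL fun h' => by linarith [((mL v).1 h').1]
        · exact iff_of_false hvR fun h' => by linarith [((mR v).1 h').2]
        · exact iff_of_true (by simp [hvX, hvL, hvR]) ((mT v).2 ⟨by nlinarith, h1.le⟩)

end ThreeCut

section Shear

variable {X : Finset (ℝ × ℝ)}

/-- A linear shear preserving horizontal lines. -/
noncomputable def shear (κ : ℝ) : (ℝ × ℝ) ≃L[ℝ] (ℝ × ℝ) :=
  ContinuousLinearEquiv.equivOfInverse
    ((ContinuousLinearMap.fst ℝ ℝ ℝ + κ • ContinuousLinearMap.snd ℝ ℝ ℝ).prod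
      (ContinuousLinearMap.snd ℝ ℝ ℝ))
    ((ContinuousLinearMap.fst ℝ ℝ ℝ - κ • ContinuousLinearMap.snd ℝ ℝ ℝ).prod
      (ContinuousLinearMap.snd ℝ ℝ ℝ))
    (fun v => by simp) fun v => by simp

theorem shear_fst (κ : ℝ) (v : ℝ × ℝ) : (shear κ v).1 = v.1 + κ * v.2 := by simp [shear]

theorem shear_snd (κ : ℝ) (v : ℝ × ℝ) : (shear κ v).2 = v.2 := by simp [shear]

theorem cross_shear (κ : ℝ) (p q s : ℝ × ℝ) :
    cross (shear κ p) (shear κ q) (shear κ s) = cross p q s := by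
  simp only [cross, shear_fst, shear_snd]
  ring

theorem GenPos.map_shear (hX : GenPos X) (κ : ℝ) :
    GenPos (X.map (shear κ).toEquiv.toEmbedding) := by
  unfold GenPos
  simp only [Finset.forall_mem_map]
  intro p hp q hq s hs hpq hps hqs
  exact (cross_shear κ p q s).trans_ne (hX p hp q hq s hs (ne_of_apply_ne _ hpq)
    (ne_of_apply_ne _ hps) (ne_of_apply_ne _ hqs))

theorem Sep.of_shear {κ : ℝ} {S : Finset (ℝ × ℝ)}
    (h : Sep (X.map (shear κ).toEquiv.toEmbedding) S) :
    Sep X (S.map (shear κ).symm.toEquiv.toEmbedding) := by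
  obtain ⟨w, hw, h1, h2⟩ := h
  have hmem : ∀ v, v ∈ S.map (shear κ).symm.toEquiv.toEmbedding ↔ shear κ v ∈ S := fun v =>
    Finset.mem_map_equiv
  refine ⟨(w.1, w.2 + κ * w.1), fun h => hw ?_, fun v hv => ?_, fun v hv u hu hu' => ?_⟩
  · rw [Prod.mk_eq_zero] at h
    have := h.2
    rw [h.1, mul_zero, add_zero] at this
    exact Prod.ext h.1 this
  · obtain ⟨u, hu, huv⟩ := Finset.mem_map.1 (h1 ((hmem v).1 hv))
    rwa [← (shear κ).injective huv]
  · have := h2 _ ((hmem v).1 hv) (shear κ u) (Finset.mem_map_of_mem _ hu)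
      fun h => hu' ((hmem u).2 h)
    simp only [shear_fst, shear_snd] at this
    linarith

theorem parallel_trans {a b c : ℝ × ℝ} (hb : b ≠ 0) (h1 : a.1 * b.2 = a.2 * b.1)
    (h2 : b.1 * c.2 = b.2 * c.1) : a.1 * c.2 = a.2 * c.1 := by
  have e1 : b.1 * (a.1 * c.2 - a.2 * c.1) = 0 := by linear_combination a.1 * h2 + c.1 * h1
  have e2 : b.2 * (a.1 * c.2 - a.2 * c.1) = 0 := by linear_combination c.2 * h1 + a.2 * h2
  by_contra h
  exact hb (Prod.ext ((mul_eq_zero.1 e1).resolve_right (sub_ne_zero.2 h))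
    ((mul_eq_zero.1 e2).resolve_right (sub_ne_zero.2 h)))

/-- Two distinct lines meet in at most one point. -/
theorem eq_of_cross_eq_zero {p q v w v' w' : ℝ × ℝ} (hvw : v ≠ w) (hvw' : v' ≠ w')
    (h : cross v w v' ≠ 0) (hp : cross p v w = 0) (hp' : cross p v' w' = 0)
    (hq : cross q v w = 0) (hq' : cross q v' w' = 0) : p = q := by
  by_contra hpq
  unfold cross at *
  have h1 := parallel_trans (a := v - p) (b := w - v) (c := q - p) (sub_ne_zero.2 hvw.symm)
    (by simp only [Prod.fst_sub, Prod.snd_sub]; linear_combination hp)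
    (by simp only [Prod.fst_sub, Prod.snd_sub]; linear_combination hq - hp)
  have h2 := parallel_trans (a := v' - p) (b := w' - v') (c := q - p) (sub_ne_zero.2 hvw'.symm)
    (by simp only [Prod.fst_sub, Prod.snd_sub]; linear_combination hp')
    (by simp only [Prod.fst_sub, Prod.snd_sub]; linear_combination hq' - hp')
  have h3 := parallel_trans (a := w - v) (b := q - p) (c := v' - v)
    (sub_ne_zero.2 (Ne.symm hpq))
    (by simp only [Prod.fst_sub, Prod.snd_sub]; linear_combination hq - hp)
    (by
      simp only [Prod.fst_sub, Prod.snd_sub] at h1 h2 ⊢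
      linear_combination h1 - h2)
  simp only [Prod.fst_sub, Prod.snd_sub] at h3
  exact h (by linear_combination h3)

/-- After a generic shear, the points of `X` have distinct abscissas, and no point above a point
of `X` lies both on a line spanned on its left and on a line spanned on its right. -/
theorem exists_shear (hX : GenPos X) : ∃ κ : ℝ,
    (∀ v ∈ X, ∀ w ∈ X, (shear κ v).1 = (shear κ w).1 → v = w) ∧
    ∀ v ∈ X, ∀ w ∈ X, ∀ v' ∈ X, ∀ w' ∈ X, v ≠ w → v ≠ v' → w ≠ v' → v' ≠ w' → ∀ u ∈ X, ∀ p,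
      cross p v w = 0 → cross p v' w' = 0 → (shear κ u).1 = (shear κ p).1 → ¬ u.2 < p.2 := by
  have fin1 : ∀ v w : ℝ × ℝ, ∀ᶠ κ in cofinite, (shear κ v).1 = (shear κ w).1 → v = w := by
    intro v w
    by_cases hvw : v = w
    · simp [hvw]
    · rw [eventually_cofinite]
      refine Set.Subsingleton.finite fun κ h κ' h' => ?_
      simp only [hvw, imp_false, not_not, Set.mem_ofPred_eq, shear_fst] at h h'
      by_contra hκ
      have h2 : v.2 = w.2 := by
        rw [← sub_eq_zero]
        refine (mul_eq_zero.1 ?_).resolve_left (sub_ne_zero.2 hκ)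
        linear_combination h - h'
      exact hvw (Prod.ext (by rw [h2] at h; linarith) h2)
  have fin2 : ∀ v w v' w' u : ℝ × ℝ, v ≠ w → v' ≠ w' → cross v w v' ≠ 0 →
      ∀ᶠ κ in cofinite, ∀ p, cross p v w = 0 → cross p v' w' = 0 →
        (shear κ u).1 = (shear κ p).1 → ¬ u.2 < p.2 := by
    intro v w v' w' u hvw hvw' hc
    rw [eventually_cofinite]
    refine Set.Subsingleton.finite fun κ h κ' h' => ?_
    simp only [Set.mem_ofPred_eq, shear_fst] at h h'
    push Not at h h'
    obtain ⟨p, h1, h2, h3, h4⟩ := h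
    obtain ⟨q, h1', h2', h3', h4'⟩ := h'
    obtain rfl := eq_of_cross_eq_zero hvw hvw' hc h1 h2 h1' h2'
    have := mul_eq_zero.1 (show (κ - κ') * (p.2 - u.2) = 0 by linear_combination h3' - h3)
    exact sub_eq_zero.1 (this.resolve_right (sub_ne_zero.2 h4.ne'))
  have ev1 : ∀ᶠ κ in cofinite, ∀ v ∈ X, ∀ w ∈ X, (shear κ v).1 = (shear κ w).1 → v = w :=
    (Finset.eventually_all X).2 fun v _ => (Finset.eventually_all X).2 fun w _ => fin1 v w
  have ev2 : ∀ᶠ κ in cofinite, ∀ v ∈ X, ∀ w ∈ X, ∀ v' ∈ X, ∀ w' ∈ X, v ≠ w → v ≠ v' → w ≠ v' →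
      v' ≠ w' → ∀ u ∈ X, ∀ p, cross p v w = 0 → cross p v' w' = 0 →
        (shear κ u).1 = (shear κ p).1 → ¬ u.2 < p.2 :=
    (Finset.eventually_all X).2 fun v hv => (Finset.eventually_all X).2 fun w hw =>
      (Finset.eventually_all X).2 fun v' hv' => (Finset.eventually_all X).2 fun w' _ => by
        simp only [eventually_all]
        exact fun h1 h2 h3 h4 => (Finset.eventually_all X).2 fun u _ =>
          fin2 v w v' w' u h1 h4 (hX v hv w hw v' hv' h1 h2 h3)
  exact (ev1.and ev2).exists

/-- Three rays from a point cut off prescribed weights, provided that the separable sets of the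
corresponding sizes are unbalanced in opposite ways. -/
theorem exists_three_cut {ρ β : ℝ × ℝ → ℕ} {k m k' m' : ℕ} (hρ : ∀ v, ρ v ≤ 1)
    (hβ : ∀ v, β v ≤ 1) (hX : GenPos X)
    (hlev : ∀ S, Sep X S → ∑ v ∈ S, ρ v = k + k' → ∑ v ∈ S, β v < m + m')
    (hposL : ∀ S, Sep X S → ∑ v ∈ S, ρ v = k → m < ∑ v ∈ S, β v)
    (hposR : ∀ S, Sep X S → ∑ v ∈ S, ρ v = k' → m' < ∑ v ∈ S, β v)
    (hk0 : 0 < k) (hk0' : 0 < k') (hsum : k + k' < ∑ v ∈ X, ρ v) :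
    ∃ (D : Fin 3 → Set (ℝ × ℝ)) (P : Fin 3 → Finset (ℝ × ℝ)), IsCut X D P ∧
      (∀ f : ℝ × ℝ → ℕ, ∑ v ∈ P 0, f v + ∑ v ∈ P 1, f v + ∑ v ∈ P 2, f v = ∑ v ∈ X, f v) ∧
      (∑ v ∈ P 0, ρ v = k ∧ ∑ v ∈ P 0, β v = m) ∧
      ∑ v ∈ P 1, ρ v = k' ∧ ∑ v ∈ P 1, β v = m' := by
  obtain ⟨κ, hκ1, hκ2⟩ := exists_shear hX
  let e := shear κ
  let X' := X.map e.toEquiv.toEmbedding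
  have hsymm : ∀ (f : ℝ × ℝ → ℕ) (S : Finset (ℝ × ℝ)),
      ∑ v ∈ S.map e.symm.toEquiv.toEmbedding, f v = ∑ v ∈ S, f (e.symm v) := fun f S =>
    Finset.sum_map _ _ _
  have hX' : ∀ f : ℝ × ℝ → ℕ, ∑ v ∈ X', f (e.symm v) = ∑ v ∈ X, f v := fun f => by
    rw [Finset.sum_map]
    exact Finset.sum_congr rfl fun v _ => congrArg f (e.symm_apply_apply v)
  obtain ⟨p, hp, L, R, hL, hR, hc, hLm, hRm⟩ := exists_generic_exact (X := X')
    (ρ := fun v => ρ (e.symm v)) (β := fun v => β (e.symm v)) (k := k) (m := m) (k' := k')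
    (m' := m') (fun v => hρ _) (fun v => hβ _) (hX.map_shear κ)
    (by
      simp only [X', Finset.forall_mem_map]
      exact fun v hv w hw h => congrArg e (hκ1 v hv w hw h))
    (by
      rintro p u' hu' hup hlow ⟨⟨v, hv, w, hw, hvw, h⟩, v', hv', w', hw', hvw', h'⟩
      have c1 := cross_eq_zero_of_key_eq (Or.inl rfl) hv hw h
      have c2 := cross_eq_zero_of_key_eq (Or.inr rfl) hv' hw' h'
      obtain ⟨hv1, hv2⟩ := mem_side.1 hv
      obtain ⟨hw1, hw2⟩ := mem_side.1 hw
      obtain ⟨hv1', hv2'⟩ := mem_side.1 hv'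
      obtain ⟨hw1', -⟩ := mem_side.1 hw'
      obtain ⟨p, rfl⟩ := e.surjective p
      obtain ⟨u, hu, rfl⟩ := Finset.mem_map.1 hu'
      obtain ⟨v, hvX, rfl⟩ := Finset.mem_map.1 hv1
      obtain ⟨w, hwX, rfl⟩ := Finset.mem_map.1 hw1
      obtain ⟨v', hvX', rfl⟩ := Finset.mem_map.1 hv1'
      obtain ⟨w', hwX', rfl⟩ := Finset.mem_map.1 hw1'
      refine hκ2 v hvX w hwX v' hvX' w' hwX' (ne_of_apply_ne _ hvw) ?_ ?_ (ne_of_apply_ne _ hvw') u hu p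
        ((cross_shear κ p v w).symm.trans c1) ((cross_shear κ p v' w').symm.trans c2) hup ?_
      · rintro rfl
        linarith
      · rintro rfl
        linarith
      · exact (shear_snd κ u).symm.trans_lt (hlow.trans_eq (shear_snd κ p)))
    (fun S hS => by simpa only [hsymm] using hlev (S.map e.symm.toEquiv.toEmbedding) hS.of_shear)
    (fun S hS => by simpa only [hsymm] using hposL (S.map e.symm.toEquiv.toEmbedding) hS.of_shear)
    (fun S hS => by simpa only [hsymm] using hposR (S.map e.symm.toEquiv.toEmbedding) hS.of_shear)
    hk0 hk0' (by rwa [hX'])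
  obtain ⟨D, hD⟩ := hc.exists_isCut hp hL.1 hR.1
  have hLX : L ⊆ X' := hL.1.1.trans side_subset
  have hRX : R ⊆ X' := hR.1.1.trans side_subset
  have hdisj : Disjoint L R := Finset.disjoint_left.2 fun v hv hv' => by
    linarith [(mem_side.1 (hL.1.1 hv)).2, (mem_side.1 (hR.1.1 hv')).2]
  refine ⟨_, _, hD.preimage e, fun f => ?_, ⟨?_, ?_⟩, ?_, ?_⟩
  · simp only [hsymm]
    rw [← hX', ← Finset.sum_sdiff (Finset.union_subset hLX hRX), Finset.sum_union hdisj, add_comm]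
    rfl
  · exact (hsymm ρ L).trans hL.2.1
  · exact (hsymm β L).trans hLm
  · exact (hsymm ρ R).trans hR.2.1
  · exact (hsymm β R).trans hRm

end Shear

section Equipartition

variable {X : Finset (ℝ × ℝ)} {ρ β : ℝ × ℝ → ℕ} {g n m : ℕ}

theorem exists_sep_sum_eq (hρ : ∀ v, ρ v ≤ 1) {k : ℕ} (hk : k ≤ ∑ v ∈ X, ρ v) :
    ∃ S, Sep X S ∧ ∑ v ∈ S, ρ v = k := by
  obtain ⟨S, hS, -, -, h⟩ := isPrefix_empty.exists_between hρ (m := k)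
    (isPrefix_self (f := fun v : ℝ × ℝ => (1 : ℝ) * v.1 + 0 * v.2) (Y := X))
    (Finset.empty_subset _) (by simp) hk
  exact ⟨S, ⟨(1, 0), by simp, hS⟩, h⟩

/-- Every part of the cut has weights proportional to `(n, m)`, with factor less than `g`. -/
def HasProperCut (X : Finset (ℝ × ℝ)) (ρ β : ℝ × ℝ → ℕ) (g n m : ℕ) : Prop :=
  ∃ (s : ℕ) (D : Fin s → Set (ℝ × ℝ)) (P : Fin s → Finset (ℝ × ℝ)) (a : Fin s → ℕ),
    IsCut X D P ∧ (∀ i, 0 < a i ∧ a i < g) ∧ ∑ i, a i = g ∧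
      ∀ i, ∑ v ∈ P i, ρ v = a i * n ∧ ∑ v ∈ P i, β v = a i * m

theorem HasProperCut.swap (h : HasProperCut X β ρ g m n) : HasProperCut X ρ β g n m := by
  obtain ⟨s, D, P, a, h1, h2, h3, h4⟩ := h
  exact ⟨s, D, P, a, h1, h2, h3, fun i => (h4 i).symm⟩

theorem hasProperCut_of_sep (hX : GenPos X) (hn : ∑ v ∈ X, ρ v = g * n)
    (hm : ∑ v ∈ X, β v = g * m) {a : ℕ} (ha : 0 < a) (hag : a < g) {S : Finset (ℝ × ℝ)}
    (hS : Sep X S) (hSn : ∑ v ∈ S, ρ v = a * n) (hSm : ∑ v ∈ S, β v = a * m) :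
    HasProperCut X ρ β g n m := by
  obtain ⟨D, hD⟩ := hS.exists_isCut hX
  have hr := Finset.sum_sdiff hS.subset (f := ρ)
  have hb := Finset.sum_sdiff hS.subset (f := β)
  obtain ⟨c, rfl⟩ := Nat.exists_eq_add_of_lt hag
  rw [hn, hSn] at hr
  rw [hm, hSm] at hb
  refine ⟨2, D, _, ![a, c + 1], hD, fun i => ?_, by simp; ring, fun i => ?_⟩
  · fin_cases i <;> simp <;> omega
  · fin_cases i
    · exact ⟨hSn, hSm⟩
    · exact ⟨show ∑ v ∈ X \ S, ρ v = (c + 1) * n by linarith,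
        show ∑ v ∈ X \ S, β v = (c + 1) * m by linarith⟩

theorem hasProperCut_of_pos (hρ : ∀ v, ρ v ≤ 1) (hβ : ∀ v, β v ≤ 1) (hX : GenPos X)
    (hn : ∑ v ∈ X, ρ v = g * n) (hm : ∑ v ∈ X, β v = g * m) (hg : 2 ≤ g)
    (hpos : ∀ S, Sep X S → ∑ v ∈ S, ρ v = n → m < ∑ v ∈ S, β v)
    (hsign : ∀ a, 0 < a → a < g → (∀ S, Sep X S → ∑ v ∈ S, ρ v = a * n → a * m < ∑ v ∈ S, β v) ∨
      ∀ S, Sep X S → ∑ v ∈ S, ρ v = a * n → ∑ v ∈ S, β v < a * m) :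
    HasProperCut X ρ β g n m := by
  have hn0 : 0 < n := by
    by_contra! h
    have := hpos ∅ sep_empty (by simp; omega)
    simp at this
  have hneg : ¬ ∀ S, Sep X S → ∑ v ∈ S, ρ v = (g - 1) * n → (g - 1) * m < ∑ v ∈ S, β v := by
    intro h
    obtain ⟨S, hS, hSn⟩ := exists_sep_sum_eq (X := X) hρ (k := (g - 1) * n)
      (hn ▸ Nat.mul_le_mul_right n (Nat.sub_le g 1))
    have hr := Finset.sum_sdiff hS.subset (f := ρ)
    have hb := Finset.sum_sdiff hS.subset (f := β)
    have h1 := h S hS hSn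
    obtain ⟨c, rfl⟩ : ∃ c, g = c + 1 := ⟨g - 1, by omega⟩
    rw [Nat.add_sub_cancel] at hSn h1
    have h2 := hpos _ hS.sdiff (by linarith)
    linarith
  classical
  have hex : ∃ a, 0 < a ∧ ¬ ∀ S, Sep X S → ∑ v ∈ S, ρ v = a * n → a * m < ∑ v ∈ S, β v :=
    ⟨g - 1, by omega, hneg⟩
  obtain ⟨j, hj, hj0, hjg, hj1, hj2⟩ : ∃ j, Nat.find hex = j + 1 ∧ 0 < j ∧ j + 1 < g ∧
      (∀ S, Sep X S → ∑ v ∈ S, ρ v = j * n → j * m < ∑ v ∈ S, β v) ∧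
      ¬ ∀ S, Sep X S → ∑ v ∈ S, ρ v = (j + 1) * n → (j + 1) * m < ∑ v ∈ S, β v := by
    have h1 := Nat.find_spec hex
    have h2 : Nat.find hex ≤ g - 1 := Nat.find_min' hex ⟨by omega, hneg⟩
    obtain ⟨j, hj⟩ : ∃ j, Nat.find hex = j + 1 := ⟨Nat.find hex - 1, by omega⟩
    rw [hj] at h1 h2
    have hj0 : 0 < j := by
      rw [Nat.pos_iff_ne_zero]
      rintro rfl
      exact h1.2 (by simpa using hpos)
    have h3 := Nat.find_min hex (m := j) (by omega)
    exact ⟨j, hj, hj0, by omega, not_not.1 fun h => h3 ⟨hj0, h⟩, h1.2⟩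
  have hlev := (hsign (j + 1) (by omega) hjg).resolve_left hj2
  obtain ⟨c, rfl⟩ := Nat.exists_eq_add_of_lt hjg
  obtain ⟨D, P, hD, hsum, ⟨h0, h0'⟩, h1, h1'⟩ := exists_three_cut hρ hβ hX (k := n) (m := m)
    (k' := j * n) (m' := j * m) (fun S hS h => by linarith [hlev S hS (by linarith)]) hpos hj1 hn0
    (Nat.mul_pos hj0 hn0) (by rw [hn]; nlinarith)
  have h2 := hsum ρ
  have h2' := hsum β
  refine ⟨3, D, P, ![1, j, c + 1], hD, fun i => ?_, by simp [Fin.sum_univ_three]; ring, fun i => ?_⟩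
  · fin_cases i <;> simp; omega
  · fin_cases i
    · exact ⟨h0.trans (one_mul n).symm, h0'.trans (one_mul m).symm⟩
    · exact ⟨h1, h1'⟩
    · exact ⟨show ∑ v ∈ P 2, ρ v = (c + 1) * n by linarith,
        show ∑ v ∈ P 2, β v = (c + 1) * m by linarith⟩

theorem hasProperCut (hρ : ∀ v, ρ v ≤ 1) (hβ : ∀ v, β v ≤ 1) (hX : GenPos X)
    (hn : ∑ v ∈ X, ρ v = g * n) (hm : ∑ v ∈ X, β v = g * m) (hg : 2 ≤ g) :
    HasProperCut X ρ β g n m := by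
  by_contra hcut
  have hsign : ∀ {ρ β : ℝ × ℝ → ℕ} {n m : ℕ}, (∀ v, ρ v ≤ 1) → (∀ v, β v ≤ 1) →
      ∑ v ∈ X, ρ v = g * n → ∑ v ∈ X, β v = g * m → ¬ HasProperCut X ρ β g n m →
      ∀ a, 0 < a → a < g → (∀ S, Sep X S → ∑ v ∈ S, ρ v = a * n → a * m < ∑ v ∈ S, β v) ∨
        ∀ S, Sep X S → ∑ v ∈ S, ρ v = a * n → ∑ v ∈ S, β v < a * m := by
    intro ρ β n m hρ hβ hn hm hcut a ha hag
    by_contra! h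
    obtain ⟨⟨S, hS, hr, hb⟩, S', hS', hr', hb'⟩ := h
    obtain ⟨T, hT, hTr, hTb⟩ := Sep.exists_eq hρ hβ hX hS hS' hr hr' hb hb'
    exact hcut (hasProperCut_of_sep hX hn hm ha hag hT hTr hTb)
  have hs := hsign hρ hβ hn hm hcut
  rcases hs 1 one_pos (by omega) with h | h
  · exact hcut (hasProperCut_of_pos hρ hβ hX hn hm hg (by simpa using h) hs)
  · refine hcut (HasProperCut.swap (hasProperCut_of_pos hβ hρ hX hm hn hg (fun S hS hSm => ?_)
      (hsign hβ hρ hm hn fun h => hcut h.swap)))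
    by_contra! hle
    obtain ⟨w, hw, hS⟩ := hS
    obtain ⟨R, hR, h1, -, h2⟩ := hS.exists_between hρ isPrefix_self hS.1 hle
      (by rw [hn]; nlinarith)
    have h3 := h R ⟨w, hw, hR⟩ (by rw [h2, one_mul])
    have h4 := Finset.sum_le_sum_of_subset (f := β) h1
    omega

theorem exists_equipartition (hρ : ∀ v, ρ v ≤ 1) (hβ : ∀ v, β v ≤ 1) (hg : 0 < g) :
    ∀ {X : Finset (ℝ × ℝ)}, GenPos X → ∑ v ∈ X, ρ v = g * n → ∑ v ∈ X, β v = g * m →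
      ∃ (C : Fin g → Set (ℝ × ℝ)) (P : Fin g → Finset (ℝ × ℝ)), IsCut X C P ∧
        ∀ j, ∑ v ∈ P j, ρ v = n ∧ ∑ v ∈ P j, β v = m := by
  induction g using Nat.strong_induction_on with
  | _ g ih =>
    intro X hX hn hm
    rcases (show g = 1 ∨ 2 ≤ g by omega) with rfl | hg2
    · refine ⟨fun _ => Set.univ, fun _ => X, ⟨⟨fun _ => isClosed_univ, fun _ => convex_univ,
        Set.iUnion_const _, fun i j hij => absurd (Subsingleton.elim i j) hij⟩, by simp⟩,
        fun _ => ⟨by rw [hn, one_mul], by rw [hm, one_mul]⟩⟩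
    · obtain ⟨s, D, P, a, hD, ha, hsum, hP⟩ := hasProperCut hρ hβ hX hn hm hg2
      have hgen : ∀ i, GenPos (P i) := fun i p hp q hq s hs =>
        hX p (hD.subset i hp) q (hD.subset i hq) s (hD.subset i hs)
      choose C Q hQ hQs using fun i => ih (a i) (ha i).2 (ha i).1 (hgen i) (hP i).1 (hP i).2
      subst hsum
      exact ⟨_, _, hD.sigma hQ, fun j => hQs _ _⟩

end Equipartition

theorem genPos_of_not_collinear {X : Finset (ℝ × ℝ)}
    (hX : ∀ p ∈ X, ∀ q ∈ X, ∀ s ∈ X, p ≠ q → p ≠ s → q ≠ s →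
      ¬ Collinear ℝ ({p, q, s} : Set (ℝ × ℝ))) : GenPos X := by
  intro p hp q hq s hs hpq hps hqs h
  refine hX p hp q hq s hs hpq hps hqs ((collinear_iff_of_mem (p₀ := p) (by simp)).2 ⟨q - p, ?_⟩)
  have hpos : (q.1 - p.1) ^ 2 + (q.2 - p.2) ^ 2 ≠ 0 := by
    intro h0
    apply hpq
    ext <;> nlinarith [sq_nonneg (q.1 - p.1), sq_nonneg (q.2 - p.2)]
  unfold cross at h
  rintro v (rfl | rfl | rfl)
  · exact ⟨0, by simp⟩
  · exact ⟨1, by simp⟩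
  · refine ⟨((q.1 - p.1) * (v.1 - p.1) + (q.2 - p.2) * (v.2 - p.2)) /
      ((q.1 - p.1) ^ 2 + (q.2 - p.2) ^ 2), ?_⟩
    ext
    · simp only [vadd_eq_add, Prod.fst_add, Prod.smul_fst, Prod.fst_sub, smul_eq_mul]
      field_simp
      linear_combination (-(q.2 - p.2)) * h
    · simp only [vadd_eq_add, Prod.snd_add, Prod.smul_snd, Prod.snd_sub, smul_eq_mul]
      field_simp
      linear_combination (q.1 - p.1) * h

theorem IsCut.ncard_inter {X A : Finset (ℝ × ℝ)} {r : ℕ} {C : Fin r → Set (ℝ × ℝ)}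
    {P : Fin r → Finset (ℝ × ℝ)} (h : IsCut X C P) (hA : A ⊆ X) (j : Fin r) :
    ((A : Set (ℝ × ℝ)) ∩ C j).ncard = ∑ v ∈ P j, if v ∈ A then 1 else 0 := by
  rw [← Finset.card_filter, ← Set.ncard_coe_finset]
  congr 1
  ext v
  simp only [Set.mem_inter_iff, Finset.mem_coe, Finset.mem_filter, h.mem_iff]
  exact ⟨fun h => ⟨⟨hA h.1, h.2⟩, h.1⟩, fun h => ⟨h.2, h.1.2⟩⟩

end Equipartition

/-- **Equipartition of two point sets by a convex partition**
(Ito–Uehara–Yokoyama, Bespamyatnikh–Kirkpatrick–Snoeyink, Sakai).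
If `A₁ ∪ A₂` is in general position (no three points collinear) and `r` divides both
cardinalities, there is a convex partition of the plane into `r` parts with each part
containing exactly `|Aᵢ|/r` points of each `Aᵢ`. -/
theorem equipartition_of_points (A₁ A₂ : Finset (ℝ × ℝ)) (r : ℕ) (hr : 0 < r)
    (hgp : ∀ p ∈ A₁ ∪ A₂, ∀ q ∈ A₁ ∪ A₂, ∀ s ∈ A₁ ∪ A₂,
      p ≠ q → p ≠ s → q ≠ s → ¬ Collinear ℝ ({p, q, s} : Set (ℝ × ℝ)))
    (h₁ : r ∣ A₁.card) (h₂ : r ∣ A₂.card) :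
    ∃ C : Fin r → Set (ℝ × ℝ), ConvexPartition C ∧
      ∀ j, ((A₁ : Set (ℝ × ℝ)) ∩ C j).ncard = A₁.card / r ∧
           ((A₂ : Set (ℝ × ℝ)) ∩ C j).ncard = A₂.card / r := by
  have hle : ∀ (A : Finset (ℝ × ℝ)) (v : ℝ × ℝ), (if v ∈ A then 1 else 0) ≤ 1 := fun A v => by
    split_ifs <;> simp
  have hcard : ∀ A ⊆ A₁ ∪ A₂, r ∣ A.card →
      (∑ v ∈ A₁ ∪ A₂, if v ∈ A then 1 else 0) = r * (A.card / r) := fun A hA h => by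
    rw [← Finset.card_filter, Finset.filter_mem_eq_inter, Finset.inter_eq_right.2 hA,
      Nat.mul_div_cancel' h]
  obtain ⟨C, P, hC, hP⟩ := Equipartition.exists_equipartition (hle A₁) (hle A₂) hr
    (Equipartition.genPos_of_not_collinear hgp) (hcard A₁ Finset.subset_union_left h₁)
    (hcard A₂ Finset.subset_union_right h₂)
  exact ⟨C, hC.convexPartition, fun j => ⟨(hC.ncard_inter Finset.subset_union_left j).trans (hP j).1,
    (hC.ncard_inter Finset.subset_union_right j).trans (hP j).2⟩⟩
end

section
/- Let A and B be two finite nonempty sets of lines in ℝ² such that no two lines of A ∪ B are parallel. Then there exists a line ℓ such that each of the two closed half-planes determined by ℓ encloses a subset of A of cardinality at least √|A| and encloses a subset of B of cardinality at least √|B|. -/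
open scoped Classical

/-- A line in the plane: the solution set of `a*x + b*y = c` with `(a,b) ≠ (0,0)`. -/
def IsLine (L : Set (ℝ × ℝ)) : Prop :=
  ∃ a b c : ℝ, (a, b) ≠ (0, 0) ∧ L = {p : ℝ × ℝ | a * p.1 + b * p.2 = c}

/-- The incidence set of a finite family of lines: all pairwise intersection points. -/
def incSet (L : Finset (Set (ℝ × ℝ))) : Set (ℝ × ℝ) :=
  {p | ∃ ℓ₁ ∈ L, ∃ ℓ₂ ∈ L, ℓ₁ ≠ ℓ₂ ∧ p ∈ ℓ₁ ∧ p ∈ ℓ₂}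

/-- Two lines are non-parallel if they meet in exactly one point. -/
def NotParallel (L₁ L₂ : Set (ℝ × ℝ)) : Prop := ∃! p : ℝ × ℝ, p ∈ L₁ ∩ L₂

/-- No two lines of the family are parallel. -/
def PairwiseNonParallel (L : Finset (Set (ℝ × ℝ))) : Prop :=
  ∀ ℓ₁ ∈ L, ∀ ℓ₂ ∈ L, ℓ₁ ≠ ℓ₂ → NotParallel ℓ₁ ℓ₂

/-- A finite set carrying a strict order contains a chain or an antichain of at least
square-root size. -/
theorem exists_chain_or_antichain {α : Type*} (R : α → α → Prop) (hirr : ∀ a, ¬ R a a)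
    (htrans : ∀ a b c, R a b → R b c → R a c) (A : Finset α) (hA : A.Nonempty) :
    ∃ S ⊆ A, A.card ≤ S.card ^ 2 ∧
      ((∀ a ∈ S, ∀ b ∈ S, a ≠ b → R a b ∨ R b a) ∨ (∀ a ∈ S, ∀ b ∈ S, ¬ R a b)) := by
  set k := Nat.sqrt (A.card - 1) with hk
  have hpos := hA.card_pos
  have hk1 : k * k < A.card := by have := Nat.sqrt_le (A.card - 1); rw [← hk] at this; omega
  have hk2 : A.card ≤ (k + 1) ^ 2 := by
    have := Nat.lt_succ_sqrt (A.card - 1)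
    rw [← hk, Nat.succ_eq_add_one] at this
    rw [pow_two]; omega
  have hbig : ∀ S : Finset α, k < S.card → A.card ≤ S.card ^ 2 := fun S hS =>
    hk2.trans (Nat.pow_le_pow_left hS 2)
  let C : α → Finset (Finset α) := fun a => A.powerset.filter fun S =>
    (∀ x ∈ S, ∀ y ∈ S, x ≠ y → R x y ∨ R y x) ∧ ∀ x ∈ S, R x a
  let h : α → ℕ := fun a => (C a).sup Finset.card
  have hmem : ∀ a, ∃ S ∈ C a, h a = S.card := fun a =>
    Finset.exists_mem_eq_sup (C a) ⟨∅, by simp [C]⟩ Finset.card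
  have hinsert : ∀ a ∈ A, ∃ S ⊆ A, (∀ x ∈ S, ∀ y ∈ S, x ≠ y → R x y ∨ R y x) ∧
      (∀ x ∈ S, x = a ∨ R x a) ∧ S.card = h a + 1 := by
    intro a ha
    obtain ⟨S, hS, hcard⟩ := hmem a
    simp only [C, Finset.mem_filter, Finset.mem_powerset] at hS
    obtain ⟨hSA, hchain, hbelow⟩ := hS
    refine ⟨insert a S, Finset.insert_subset ha hSA, ?_, ?_, ?_⟩
    · intro x hx y hy hxy
      rw [Finset.mem_insert] at hx hy
      rcases hx with rfl | hx <;> rcases hy with rfl | hy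
      · exact absurd rfl hxy
      · exact Or.inr (hbelow y hy)
      · exact Or.inl (hbelow x hx)
      · exact hchain x hx y hy hxy
    · intro x hx
      exact (Finset.mem_insert.1 hx).imp id (hbelow x)
    · rw [Finset.card_insert_of_notMem fun haS => hirr a (hbelow a haS), hcard]
  have hmono : ∀ a ∈ A, ∀ b, R a b → h a < h b := by
    intro a ha b hab
    obtain ⟨S, hSA, hchain, hbelow, hcard⟩ := hinsert a ha
    have hSb : S ∈ C b := by
      simp only [C, Finset.mem_filter, Finset.mem_powerset]
      refine ⟨hSA, hchain, fun x hx => ?_⟩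
      rcases hbelow x hx with rfl | hxa
      · exact hab
      · exact htrans _ _ _ hxa hab
    have : S.card ≤ h b := Finset.le_sup (f := Finset.card) hSb
    omega
  by_cases hlong : ∃ a ∈ A, k ≤ h a
  · obtain ⟨a, ha, hka⟩ := hlong
    obtain ⟨S, hSA, hchain, -, hcard⟩ := hinsert a ha
    exact ⟨S, hSA, hbig S (by omega), Or.inl hchain⟩
  · push Not at hlong
    obtain ⟨y, -, hy⟩ := Finset.exists_lt_card_fiber_of_mul_lt_card_of_maps_to
      (s := A) (t := Finset.range k) (f := h) (n := k)
      (fun a ha => Finset.mem_range.2 (hlong a ha)) (by simpa using hk1)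
    refine ⟨_, Finset.filter_subset _ _, hbig _ hy, Or.inr ?_⟩
    intro a ha b hb hab
    rw [Finset.mem_filter] at ha hb
    have := hmono a ha.1 b hab
    omega

/-- In the coordinates `X = u₁ x + u₂ y`, `Y = u₁ y - u₂ x`, a line is either vertical or the graph
of an affine function of `X`. -/
theorem IsLine.vertical_or_graph {l : Set (ℝ × ℝ)} (hl : IsLine l) {u : ℝ × ℝ} (hu : u ≠ 0)
    (c : ℝ) :
    (∃ k : ℝ, ∀ p, p ∈ l ↔ u.1 * p.1 + u.2 * p.2 = k) ∨
      ∃ m v : ℝ, ∀ p, p ∈ l ↔ u.1 * p.2 - u.2 * p.1 = m * (u.1 * p.1 + u.2 * p.2 - c) + v := by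
  obtain ⟨a, b, d, hab, rfl⟩ := hl
  obtain ⟨x, y⟩ := u
  have hN : 0 < x ^ 2 + y ^ 2 := by
    by_contra! h
    have hx : x = 0 := by nlinarith [sq_nonneg x, sq_nonneg y]
    have hy : y = 0 := by nlinarith [sq_nonneg x, sq_nonneg y]
    exact hu (by simp [hx, hy])
  have hrepr : ∀ p : ℝ × ℝ, a * p.1 + b * p.2 = d ↔
      (a * x + b * y) * (x * p.1 + y * p.2) + (b * x - a * y) * (x * p.2 - y * p.1) =
        d * (x ^ 2 + y ^ 2) := by
    intro p
    rw [← mul_left_inj' hN.ne']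
    constructor <;> intro h <;> linear_combination h
  simp only [Set.mem_ofPred_eq, hrepr]
  by_cases hD : b * x - a * y = 0
  · left
    have hs : a * x + b * y ≠ 0 := by
      intro hs
      have ha : a * (x ^ 2 + y ^ 2) = 0 := by linear_combination x * hs - y * hD
      have hb : b * (x ^ 2 + y ^ 2) = 0 := by linear_combination y * hs + x * hD
      exact hab (by simp [(mul_eq_zero.1 ha).resolve_right hN.ne',
        (mul_eq_zero.1 hb).resolve_right hN.ne'])
    refine ⟨d * (x ^ 2 + y ^ 2) / (a * x + b * y), fun p => ?_⟩
    rw [hD, eq_div_iff hs, zero_mul, add_zero, mul_comm]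
  · right
    refine ⟨-(a * x + b * y) / (b * x - a * y),
      (d * (x ^ 2 + y ^ 2) - (a * x + b * y) * c) / (b * x - a * y), fun p => ?_⟩
    rw [div_mul_eq_mul_div, ← add_div, eq_div_iff hD]
    constructor <;> intro h <;> linear_combination h

/-- For a line `u · p = c`, the lines of the plane carry a strict order in which two
intersecting lines are comparable exactly when they meet in the half-plane `u · p ≤ c`. -/
theorem exists_strictOrder_comparable_iff {u : ℝ × ℝ} (hu : u ≠ 0) (c : ℝ) :
    ∃ R : Set (ℝ × ℝ) → Set (ℝ × ℝ) → Prop, (∀ l, ¬ R l l) ∧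
      (∀ l₁ l₂ l₃, R l₁ l₂ → R l₂ l₃ → R l₁ l₃) ∧
      ∀ l₁ l₂, IsLine l₁ → IsLine l₂ → l₁ ≠ l₂ → ∀ p ∈ l₁, p ∈ l₂ →
        (R l₁ l₂ ∨ R l₂ l₁ ↔ u.1 * p.1 + u.2 * p.2 ≤ c) := by
  have key : ∀ l : Set (ℝ × ℝ), ∃ M V : EReal, IsLine l →
      (∃ k : ℝ, M = ⊤ ∧ V = (if k ≤ c then ⊤ else ⊥) ∧
        ∀ p, p ∈ l ↔ u.1 * p.1 + u.2 * p.2 = k) ∨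
      ∃ m v : ℝ, M = m ∧ V = v ∧
        ∀ p, p ∈ l ↔ u.1 * p.2 - u.2 * p.1 = m * (u.1 * p.1 + u.2 * p.2 - c) + v := by
    intro l
    by_cases hl : IsLine l
    · rcases hl.vertical_or_graph hu c with ⟨k, hk⟩ | ⟨m, v, hmv⟩
      · exact ⟨_, _, fun _ => Or.inl ⟨k, rfl, rfl, hk⟩⟩
      · exact ⟨_, _, fun _ => Or.inr ⟨m, v, rfl, rfl, hmv⟩⟩
    · exact ⟨0, 0, fun h => absurd h hl⟩
  choose M V hMV using key
  refine ⟨fun l₁ l₂ => M l₁ < M l₂ ∧ V l₁ ≤ V l₂, fun l h => lt_irrefl _ h.1,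
    fun _ _ _ h h' => ⟨h.1.trans h'.1, h.2.trans h'.2⟩, ?_⟩
  intro l₁ l₂ h₁ h₂ hne p hp₁ hp₂
  beta_reduce
  rcases hMV l₁ h₁ with ⟨k₁, hM₁, hV₁, e₁⟩ | ⟨m₁, v₁, hM₁, hV₁, e₁⟩ <;>
    rcases hMV l₂ h₂ with ⟨k₂, hM₂, hV₂, e₂⟩ | ⟨m₂, v₂, hM₂, hV₂, e₂⟩
  · refine absurd (Set.ext fun q => ?_) hne
    rw [e₁, e₂, ← (e₁ p).1 hp₁, ← (e₂ p).1 hp₂]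
  · rw [hM₁, hM₂, hV₁, hV₂, (e₁ p).1 hp₁]
    by_cases h : k₁ ≤ c <;> simp [h]
  · rw [hM₁, hM₂, hV₁, hV₂, (e₂ p).1 hp₂]
    by_cases h : k₂ ≤ c <;> simp [h]
  · have q₁ := (e₁ p).1 hp₁
    have q₂ := (e₂ p).1 hp₂
    rw [hM₁, hM₂, hV₁, hV₂]
    simp only [EReal.coe_lt_coe_iff, EReal.coe_le_coe_iff]
    rcases lt_trichotomy m₁ m₂ with hm | rfl | hm
    · simp only [hm, hm.not_gt, true_and, false_and, or_false]
      constructor <;> intro h <;> nlinarith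
    · have hv : v₁ = v₂ := by linarith
      refine absurd (Set.ext fun q => ?_) hne
      rw [e₁, e₂, hv]
    · simp only [hm, hm.not_gt, true_and, false_and, false_or]
      constructor <;> intro h <;> nlinarith

/-- Every line has, on one of its two sides, all the incidences of a subset of at least square-root
size. -/
theorem exists_subset_incSet_one_side {A : Finset (Set (ℝ × ℝ))} (hA : A.Nonempty)
    (hlines : ∀ l ∈ A, IsLine l) {u : ℝ × ℝ} (hu : u ≠ 0) (c : ℝ) :
    ∃ S ⊆ A, A.card ≤ S.card ^ 2 ∧
      ((∀ p ∈ incSet S, u.1 * p.1 + u.2 * p.2 ≤ c) ∨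
        ∀ p ∈ incSet S, c ≤ u.1 * p.1 + u.2 * p.2) := by
  obtain ⟨R, hirr, htrans, hR⟩ := exists_strictOrder_comparable_iff hu c
  obtain ⟨S, hSA, hcard, hS⟩ := exists_chain_or_antichain R hirr htrans A hA
  refine ⟨S, hSA, hcard, hS.imp ?_ ?_⟩
  · rintro h p ⟨l₁, h₁, l₂, h₂, hne, hp₁, hp₂⟩
    exact (hR l₁ l₂ (hlines _ (hSA h₁)) (hlines _ (hSA h₂)) hne p hp₁ hp₂).1 (h _ h₁ _ h₂ hne)
  · rintro h p ⟨l₁, h₁, l₂, h₂, hne, hp₁, hp₂⟩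
    by_contra! hlt
    exact ((hR l₁ l₂ (hlines _ (hSA h₁)) (hlines _ (hSA h₂)) hne p hp₁ hp₂).2 hlt.le).elim
      (h _ h₁ _ h₂) (h _ h₂ _ h₁)

/-- If every line has a member of a finite family of nonempty finite sets on one of its sides, then
one can choose, continuously and antisymmetrically in the direction, a line having members of the
family on both of its sides. -/
theorem exists_continuous_odd_level {ι : Type*} [Fintype ι] [Nonempty ι]
    (T : ι → Finset (ℝ × ℝ)) (hT : ∀ i, (T i).Nonempty)
    (hside : ∀ u : ℝ × ℝ, u ≠ 0 → ∀ c : ℝ, ∃ i, (∀ p ∈ T i, u.1 * p.1 + u.2 * p.2 ≤ c) ∨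
      ∀ p ∈ T i, c ≤ u.1 * p.1 + u.2 * p.2) :
    ∃ m : ℝ × ℝ → ℝ, Continuous m ∧ (∀ u, m (-u) = -m u) ∧ ∀ u, u ≠ 0 →
      (∃ i, ∀ p ∈ T i, u.1 * p.1 + u.2 * p.2 ≤ m u) ∧
        ∃ i, ∀ p ∈ T i, m u ≤ u.1 * p.1 + u.2 * p.2 := by
  let s : ι → ℝ × ℝ → ℝ := fun i u => (T i).sup' (hT i) fun p => u.1 * p.1 + u.2 * p.2
  let g : ℝ × ℝ → ℝ := fun u => Finset.univ.inf' Finset.univ_nonempty fun i => s i u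
  have hg : Continuous g := Continuous.finset_inf'_apply _ fun i _ =>
    Continuous.finset_sup'_apply _ fun p _ => by fun_prop
  have hgle : ∀ i u c, (∀ p ∈ T i, u.1 * p.1 + u.2 * p.2 ≤ c) → g u ≤ c := fun i u c h =>
    (Finset.inf'_le _ (Finset.mem_univ i)).trans (Finset.sup'_le _ _ h)
  have hgmem : ∀ u, ∃ i, ∀ p ∈ T i, u.1 * p.1 + u.2 * p.2 ≤ g u := by
    intro u
    obtain ⟨i, -, hi⟩ := Finset.exists_mem_eq_inf' (Finset.univ_nonempty (α := ι)) fun i => s i u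
    refine ⟨i, fun p hp => ?_⟩
    have : g u = s i u := hi
    rw [this]
    exact Finset.le_sup' (fun p : ℝ × ℝ => u.1 * p.1 + u.2 * p.2) hp
  have hneg : ∀ u, u ≠ 0 → g u ≤ -g (-u) := by
    intro u hu
    by_contra! hlt
    obtain ⟨c, hc₁, hc₂⟩ := exists_between hlt
    obtain ⟨i, hi | hi⟩ := hside u hu c
    · exact absurd (hgle i u c hi) (not_le.2 hc₂)
    · have := hgle i (-u) (-c) fun p hp => by
        have := hi p hp
        simp only [Prod.fst_neg, Prod.snd_neg]
        linarith
      linarith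
  refine ⟨fun u => (g u - g (-u)) / 2, by fun_prop, fun u => by simp only [neg_neg]; ring, ?_⟩
  intro u hu
  have hgu := hneg u hu
  constructor
  · obtain ⟨i, hi⟩ := hgmem u
    exact ⟨i, fun p hp => (hi p hp).trans (by linarith)⟩
  · obtain ⟨i, hi⟩ := hgmem (-u)
    refine ⟨i, fun p hp => ?_⟩
    have := hi p hp
    simp only [Prod.fst_neg, Prod.snd_neg] at this
    linarith

theorem PairwiseNonParallel.mono {A B : Finset (Set (ℝ × ℝ))} (hB : PairwiseNonParallel B)
    (h : A ⊆ B) : PairwiseNonParallel A :=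
  fun l₁ h₁ l₂ h₂ => hB l₁ (h h₁) l₂ (h h₂)

theorem PairwiseNonParallel.finite_incSet {A : Finset (Set (ℝ × ℝ))}
    (hpar : PairwiseNonParallel A) : (incSet A).Finite := by
  have hsub : incSet A ⊆ ⋃ q ∈ (A.offDiag : Set (Set (ℝ × ℝ) × Set (ℝ × ℝ))), q.1 ∩ q.2 := by
    rintro p ⟨l₁, h₁, l₂, h₂, hne, hp⟩
    exact Set.mem_biUnion (x := (l₁, l₂)) (by simp [h₁, h₂, hne]) hp
  refine Set.Finite.subset (Set.Finite.biUnion A.offDiag.finite_toSet fun q hq => ?_) hsub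
  rw [Finset.mem_coe, Finset.mem_offDiag] at hq
  obtain ⟨p, -, hp⟩ := hpar _ hq.1 _ hq.2.1 hq.2.2
  exact (Set.finite_singleton p).subset hp

theorem incSet_eq_empty_of_card_le_one {A : Finset (Set (ℝ × ℝ))} (hA : A.card ≤ 1) :
    incSet A = ∅ := by
  refine Set.eq_empty_of_forall_notMem ?_
  rintro p ⟨l₁, h₁, l₂, h₂, hne, -⟩
  exact hne (Finset.card_le_one.1 hA _ h₁ _ h₂)

theorem PairwiseNonParallel.incSet_nonempty {A : Finset (Set (ℝ × ℝ))}
    (hpar : PairwiseNonParallel A) (hA : 1 < A.card) : (incSet A).Nonempty := by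
  obtain ⟨l₁, h₁, l₂, h₂, hne⟩ := Finset.one_lt_card.1 hA
  obtain ⟨p, hp, -⟩ := hpar _ h₁ _ h₂ hne
  exact ⟨p, l₁, h₁, l₂, h₂, hne, hp⟩

theorem exists_continuous_odd_bisector {A : Finset (Set (ℝ × ℝ))} (hA : A.Nonempty)
    (hlines : ∀ l ∈ A, IsLine l) (hpar : PairwiseNonParallel A) :
    ∃ m : ℝ × ℝ → ℝ, Continuous m ∧ (∀ u, m (-u) = -m u) ∧ ∀ u, u ≠ 0 →
      (∃ S ⊆ A, incSet S ⊆ {p : ℝ × ℝ | u.1 * p.1 + u.2 * p.2 ≤ m u} ∧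
        Real.sqrt A.card ≤ S.card) ∧
      (∃ S ⊆ A, incSet S ⊆ {p : ℝ × ℝ | m u ≤ u.1 * p.1 + u.2 * p.2} ∧
        Real.sqrt A.card ≤ S.card) := by
  have hsqrt : ∀ S : Finset (Set (ℝ × ℝ)), A.card ≤ S.card ^ 2 →
      Real.sqrt A.card ≤ S.card := fun S hS =>
    Real.sqrt_le_iff.2 ⟨Nat.cast_nonneg _, by exact_mod_cast hS⟩
  have hself : A.card ≤ A.card ^ 2 := Nat.le_self_pow two_ne_zero _
  rcases le_or_gt A.card 1 with h1 | h1
  · refine ⟨0, continuous_zero, fun u => by simp, fun u _ => ?_⟩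
    have hempty := incSet_eq_empty_of_card_le_one h1
    exact ⟨⟨A, subset_rfl, by simp [hempty], hsqrt A hself⟩,
      ⟨A, subset_rfl, by simp [hempty], hsqrt A hself⟩⟩
  · let F := A.powerset.filter fun S => A.card ≤ S.card ^ 2
    let ι := {S // S ∈ F}
    have hF : ∀ S, S ∈ F ↔ S ⊆ A ∧ A.card ≤ S.card ^ 2 := fun S => by simp [F]
    have hι : ∀ i : ι, i.1 ⊆ A ∧ A.card ≤ i.1.card ^ 2 := fun i => (hF i.1).1 i.2
    let mk : ∀ S ⊆ A, A.card ≤ S.card ^ 2 → ι := fun S h h' => ⟨S, (hF S).2 ⟨h, h'⟩⟩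
    have : Fintype ι := inferInstanceAs (Fintype {S // S ∈ F})
    have : Nonempty ι := ⟨mk A subset_rfl hself⟩
    let T : ι → Finset (ℝ × ℝ) := fun i => (hpar.mono (hι i).1).finite_incSet.toFinset
    have hmem : ∀ i p, p ∈ T i ↔ p ∈ incSet i.1 := fun i p => Set.Finite.mem_toFinset _
    have hT : ∀ i, (T i).Nonempty := by
      intro i
      have : 1 < i.1.card := by nlinarith [(hι i).2]
      obtain ⟨p, hp⟩ := (hpar.mono (hι i).1).incSet_nonempty this
      exact ⟨p, (hmem i p).2 hp⟩
    obtain ⟨m, hm, hodd, hlevel⟩ := exists_continuous_odd_level T hT fun u hu c => by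
      obtain ⟨S, hS, hcard, h⟩ := exists_subset_incSet_one_side hA hlines hu c
      refine ⟨mk S hS hcard, ?_⟩
      simpa only [hmem] using h
    refine ⟨m, hm, hodd, fun u hu => ?_⟩
    obtain ⟨⟨i, hi⟩, ⟨j, hj⟩⟩ := hlevel u hu
    exact ⟨⟨i.1, (hι i).1, fun p hp => hi p ((hmem i p).2 hp), hsqrt _ (hι i).2⟩,
      ⟨j.1, (hι j).1, fun p hp => hj p ((hmem j p).2 hp), hsqrt _ (hι j).2⟩⟩

/-- **Ham sandwich theorem for lines** (Dujmović–Langerman).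
Given finite nonempty sets `A`, `B` of pairwise non-parallel lines, there is a line such
that each of the two closed half-planes it determines encloses at least `√|A|` lines of `A`
and at least `√|B|` lines of `B`. -/
theorem ham_sandwich_for_lines (A B : Finset (Set (ℝ × ℝ)))
    (hA : A.Nonempty) (hB : B.Nonempty)
    (hlines : ∀ ℓ ∈ A ∪ B, IsLine ℓ) (hpar : PairwiseNonParallel (A ∪ B)) :
    ∃ a b c : ℝ, (a, b) ≠ (0, 0) ∧
      (∃ A' ⊆ A, incSet A' ⊆ {p : ℝ × ℝ | a * p.1 + b * p.2 ≤ c} ∧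
        Real.sqrt A.card ≤ A'.card) ∧
      (∃ A' ⊆ A, incSet A' ⊆ {p : ℝ × ℝ | c ≤ a * p.1 + b * p.2} ∧
        Real.sqrt A.card ≤ A'.card) ∧
      (∃ B' ⊆ B, incSet B' ⊆ {p : ℝ × ℝ | a * p.1 + b * p.2 ≤ c} ∧
        Real.sqrt B.card ≤ B'.card) ∧
      (∃ B' ⊆ B, incSet B' ⊆ {p : ℝ × ℝ | c ≤ a * p.1 + b * p.2} ∧
        Real.sqrt B.card ≤ B'.card) := by
  obtain ⟨f, hf, hfodd, hfA⟩ := exists_continuous_odd_bisector hA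
    (fun l hl => hlines l (Finset.mem_union_left _ hl)) (hpar.mono Finset.subset_union_left)
  obtain ⟨g, hg, hgodd, hgB⟩ := exists_continuous_odd_bisector hB
    (fun l hl => hlines l (Finset.mem_union_right _ hl)) (hpar.mono Finset.subset_union_right)
  let d : ℝ → ℝ := fun t => f (Real.cos t, Real.sin t) - g (Real.cos t, Real.sin t)
  have hd : Continuous d := by fun_prop
  have hdπ : d Real.pi = -d 0 := by
    have hneg : ((-1, 0) : ℝ × ℝ) = -(1, 0) := by simp
    simp only [d, Real.cos_pi, Real.sin_pi, Real.cos_zero, Real.sin_zero, hneg, hfodd, hgodd]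
    ring
  obtain ⟨t, -, ht⟩ : (0 : ℝ) ∈ d '' Set.uIcc 0 Real.pi := by
    refine intermediate_value_uIcc hd.continuousOn ?_
    rw [hdπ, Set.mem_uIcc]
    rcases le_total (d 0) 0 with h | h
    · exact Or.inl ⟨h, by linarith⟩
    · exact Or.inr ⟨by linarith, h⟩
  have hu : ((Real.cos t, Real.sin t) : ℝ × ℝ) ≠ 0 := by
    intro h
    have h₁ : Real.cos t = 0 := congrArg Prod.fst h
    have h₂ : Real.sin t = 0 := congrArg Prod.snd h
    simpa [h₁, h₂] using Real.sin_sq_add_cos_sq t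
  have hfg : f (Real.cos t, Real.sin t) = g (Real.cos t, Real.sin t) := sub_eq_zero.1 ht
  obtain ⟨hA₁, hA₂⟩ := hfA _ hu
  obtain ⟨hB₁, hB₂⟩ := hgB _ hu
  rw [← hfg] at hB₁ hB₂
  exact ⟨_, _, _, hu, hA₁, hA₂, hB₁, hB₂⟩
end
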